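/- arXiv:1703.07624 — 9 statements merged into one kernel-verified Lean document; each statement's English description precedes it below -/
import Mathlib

section
/- (Gordan–Noether) Let f ∈ K[x₁,…,xₙ] be a homogeneous polynomial of degree ≥ 2 with zero Hessian. Then one variable can be eliminated from f by a birational transformation of the variables: there exist elements s₁,…,s_{n−1} of the fraction field K(x₁,…,xₙ) and an index i ∈ {1,…,n} such that f lies in the subfield K(s₁,…,s_{n−1}) generated over K by s₁,…,s_{n−1}, and K(s₁,…,s_{n−1}, xᵢ) = K(x₁,…,xₙ). -/
open MvPolynomial

/-- A derivation of a domain of characteristic zero that vanishes on a subalgebra also vanishes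
on every element algebraic over that subalgebra. -/
theorem Derivation.eq_zero_of_isAlgebraic {K R : Type*} [CommRing K] [CommRing R] [IsDomain R]
    [CharZero R] [Algebra K R] (D : Derivation K R R) (A : Subalgebra K R)
    (hA : ∀ a ∈ A, D a = 0) {x : R} (hx : IsAlgebraic A x) : D x = 0 := by
  let E : Derivation A R R := Derivation.mk'
    { toFun := D
      map_add' := map_add D
      map_smul' := fun a y => by
        simp [Subalgebra.smul_def, D.leibniz, hA a a.2] }
    (fun a b => D.leibniz a b)
  have hE : ∀ y, E y = D y := fun _ => rfl
  have key : ∀ (N : ℕ) (p : Polynomial A), p.natDegree ≤ N → p ≠ 0 →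
      Polynomial.aeval x p = 0 → D x = 0 := by
    intro N
    induction N with
    | zero =>
      intro p hp hp0 hpx
      rw [Polynomial.eq_C_of_natDegree_le_zero hp] at hpx hp0
      simp at hpx hp0
      exact absurd hpx hp0
    | succ N ih =>
      intro p hp hp0 hpx
      by_cases hd : p.natDegree = 0
      · exact ih p (by omega) hp0 hpx
      have h := E.map_aeval p x
      rw [hpx, map_zero, hE, smul_eq_mul] at h
      rcases mul_eq_zero.mp h.symm with h | h
      · refine ih (Polynomial.derivative p) ?_ ?_ h
        · exact (Polynomial.natDegree_derivative_le p).trans (by omega)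
        · exact fun h0 => hd (Polynomial.derivative_eq_zero.mp h0)
      · exact h
  obtain ⟨p, hp0, hpx⟩ := hx
  exact key _ p le_rfl hp0 hpx

namespace MvPolynomial

theorem pderiv_comm {σ K : Type*} [CommRing K] (i j : σ) (f : MvPolynomial σ K) :
    pderiv i (pderiv j f) = pderiv j (pderiv i f) := by
  let D : σ → Derivation K (MvPolynomial σ K) (MvPolynomial σ K) := fun k => pderiv k
  have h : ⁅D i, D j⁆ = 0 := by
    classical
    refine derivation_ext fun k => ?_
    simp only [D, Derivation.commutator_apply, pderiv_X, Pi.single_apply]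
    split_ifs <;> simp
  have hf := congrArg (fun E => E f) h
  simpa [D, Derivation.commutator_apply, sub_eq_zero] using hf

/-- The chain rule for a derivation applied to a polynomial expression. -/
theorem derivation_aeval {ι K A : Type*} [Fintype ι] [CommRing K] [CommRing A] [Algebra K A]
    (D : Derivation K A A) (g : ι → A) (p : MvPolynomial ι K) :
    D (aeval g p) = ∑ i, aeval g (pderiv i p) * D (g i) := by
  classical
  induction p using MvPolynomial.induction_on with
  | C a => simp
  | add p q hp hq => simp [hp, hq, add_mul, Finset.sum_add_distrib]
  | mul_X p j hp =>
    have hj : ∀ i, aeval g (pderiv i (p * X j)) * D (g i) =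
        g j * (aeval g (pderiv i p) * D (g i)) + if i = j then aeval g p * D (g j) else 0 := by
      intro i
      rw [pderiv_mul, pderiv_X]
      split_ifs with h
      · subst h
        simp
        ring
      · simp [Ne.symm h]
        ring
    simp only [hj, Finset.sum_add_distrib, Finset.sum_ite_eq', Finset.mem_univ, if_true,
      ← Finset.mul_sum, ← hp, map_mul, aeval_X, D.leibniz, smul_eq_mul]
    ring

theorem mkDerivation_eq_sum {ι K : Type*} [Fintype ι] [CommRing K] (v : ι → MvPolynomial ι K)
    (q : MvPolynomial ι K) : mkDerivation K v q = ∑ i, v i * pderiv i q := by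
  simpa [mkDerivation_X, mul_comm] using derivation_aeval (mkDerivation K v) X q

/-- The easy half of the Jacobian criterion: in characteristic zero, `n` polynomials in `n`
variables with vanishing Jacobian determinant are algebraically dependent. -/
theorem not_algebraicIndependent_of_det_pderiv_eq_zero {K : Type*} [Field K] [CharZero K] {n : ℕ}
    (g : Fin n → MvPolynomial (Fin n) K)
    (hg : (Matrix.of fun i j : Fin n => pderiv i (g j)).det = 0) :
    ¬ AlgebraicIndependent K g := by
  intro hind
  obtain ⟨v, hv0, hv⟩ := Matrix.exists_vecMul_eq_zero_iff.mpr hg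
  have hbasis : IsTranscendenceBasis K g := by
    refine hind.isTranscendenceBasis_of_lift_trdeg_le_of_finite ?_
    simp [MvPolynomial.trdeg_of_isDomain]
  let D := mkDerivation K v
  have hDA : ∀ a ∈ Algebra.adjoin K (Set.range g), D a = 0 := by
    intro a ha
    induction ha using Algebra.adjoin_induction with
    | mem x hx =>
      obtain ⟨j, rfl⟩ := hx
      rw [mkDerivation_eq_sum]
      simpa [Matrix.vecMul, dotProduct] using congrFun hv j
    | algebraMap r => exact D.map_algebraMap r
    | add x y _ _ hx hy => rw [map_add, hx, hy, add_zero]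
    | mul x y _ _ hx hy => simp [D.leibniz, hx, hy]
  refine hv0 (_root_.funext fun i => ?_)
  have := hbasis.isAlgebraic
  have h := D.eq_zero_of_isAlgebraic _ hDA (this.isAlgebraic (X i))
  simpa [D, mkDerivation_X] using h

/-- In characteristic zero, a polynomial all of whose partial derivatives vanish is constant. -/
theorem eq_C_of_forall_pderiv_eq_zero {σ K : Type*} [Field K] [CharZero K]
    (p : MvPolynomial σ K) (h : ∀ i, pderiv i p = 0) : p = C (coeff 0 p) := by
  classical
  ext m
  rw [coeff_C]
  split_ifs with hm
  · rw [hm]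
  obtain ⟨i, hi⟩ : ∃ i, m i ≠ 0 := by
    by_contra! hc
    exact hm (Finsupp.ext fun i => (hc i).symm)
  have hc := coeff_pderiv (i := i) p (m - Finsupp.single i 1)
  have hle : Finsupp.single i 1 ≤ m := by
    rw [Finsupp.single_le_iff]; omega
  rw [h i, coeff_zero, tsub_add_cancel_of_le hle] at hc
  rcases mul_eq_zero.mp hc.symm with h | h
  · exact h
  · exact absurd h (by norm_cast)

theorem totalDegree_pderiv_lt {σ K : Type*} [CommSemiring K]
    (p : MvPolynomial σ K) (i : σ) (h : pderiv i p ≠ 0) :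
    (pderiv i p).totalDegree < p.totalDegree := by
  classical
  have hlt : ∀ m ∈ (pderiv i p).support, (m.sum fun _ e => e) < p.totalDegree := by
    intro m hm
    have hm' : m + Finsupp.single i 1 ∈ p.support := by
      rw [mem_support_iff, coeff_pderiv] at hm
      exact mem_support_iff.mpr (left_ne_zero_of_mul hm)
    have := le_totalDegree hm'
    rw [Finsupp.sum_add_index' (by simp) (by simp)] at this
    simp at this
    omega
  obtain ⟨m, hm⟩ := support_nonempty.mpr h
  exact (Finset.sup_lt_iff (lt_of_le_of_lt (Nat.zero_le _) (hlt m hm))).mpr hlt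

/-- Algebraically dependent polynomials satisfy a relation whose gradient does not vanish
along them. -/
theorem exists_relation_pderiv_ne_zero {ι K A : Type*} [Field K] [CharZero K] [CommRing A]
    [Nontrivial A] [Algebra K A] (g : ι → A) (hg : ¬ AlgebraicIndependent K g) :
    ∃ p : MvPolynomial ι K, aeval g p = 0 ∧ ∃ i, aeval g (pderiv i p) ≠ 0 := by
  have hex : ∃ p : MvPolynomial ι K, aeval g p = 0 ∧ p ≠ 0 := by
    by_contra! hc
    exact hg (algebraicIndependent_iff.mpr hc)
  by_contra! hc
  have key : ∀ (N : ℕ) (p : MvPolynomial ι K), p.totalDegree ≤ N → aeval g p = 0 → p = 0 := by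
    intro N
    induction N using Nat.strong_induction_on with
    | _ N ih =>
      intro p hp hpg
      have hder : ∀ i, pderiv i p = 0 := by
        intro i
        by_contra hi
        exact hi (ih _ ((totalDegree_pderiv_lt p i hi).trans_le hp) _ le_rfl (hc p hpg i))
      rw [eq_C_of_forall_pderiv_eq_zero p hder] at hpg ⊢
      simpa using hpg
  obtain ⟨p, hp, hp0⟩ := hex
  exact hp0 (key _ p le_rfl hp)

/-- The constants of the derivation `D = ∑ hᵢ ∂ᵢ`, when `D hᵢ = 0` for all `i`, are invariant under
the substitution `xᵢ ↦ xᵢ + τ hᵢ`. -/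
theorem aeval_add_mul_of_mkDerivation_eq_zero {σ K B : Type*} [Field K] [CharZero K] [CommRing B]
    [Algebra K B] [Algebra (MvPolynomial σ K) B] [IsScalarTower K (MvPolynomial σ K) B]
    (h : σ → MvPolynomial σ K) (hh : ∀ i, mkDerivation K h (h i) = 0) (τ : B)
    (g : MvPolynomial σ K) (hg : mkDerivation K h g = 0) :
    aeval (fun i => algebraMap (MvPolynomial σ K) B (X i) + τ * algebraMap _ B (h i)) g =
      algebraMap _ B g := by
  set D := mkDerivation K h with hD
  let φ : MvPolynomial σ K →ₐ[K] Polynomial (MvPolynomial σ K) :=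
    aeval fun i => Polynomial.C (X i) + Polynomial.X * Polynomial.C (h i)
  have hφX : ∀ i, φ (X i) = Polynomial.C (X i) + Polynomial.X * Polynomial.C (h i) :=
    fun i => aeval_X _ i
  have hzero : ∀ q, (φ q).coeff 0 = q := by
    intro q
    induction q using MvPolynomial.induction_on with
    | C a => simp [φ, Polynomial.algebraMap_apply]
    | add p q hp hq => simp [hp, hq]
    | mul_X p i hp => simp [hφX, hp, Polynomial.mul_coeff_zero]
  have hcoeff : ∀ q k, (φ q).coeff (k + 1) * ((k : MvPolynomial σ K) + 1) =
      D ((φ q).coeff k) := by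
    intro q
    induction q using MvPolynomial.induction_on with
    | C a =>
      intro k
      have : φ (C a) = Polynomial.C (C a) := by simp [φ, Polynomial.algebraMap_apply]
      rw [this, Polynomial.coeff_C_succ, Polynomial.coeff_C]
      split_ifs <;> simp [D]
    | add p q hp hq => intro k; simp [add_mul, hp, hq]
    | mul_X p i hp =>
      intro k
      have hmul : φ (p * X i) = φ p * Polynomial.C (X i) + φ p * Polynomial.C (h i) *
          Polynomial.X := by
        rw [map_mul, hφX]; ring
      have hDX : D (X i) = h i := mkDerivation_X _ _ _
      rw [hmul]
      simp only [Polynomial.coeff_add, Polynomial.coeff_mul_C, Polynomial.coeff_mul_X]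
      have hk := hp k
      cases k with
      | zero =>
        simp only [Polynomial.mul_coeff_zero, Polynomial.coeff_X_zero, mul_zero, add_zero,
          D.leibniz, hDX, smul_eq_mul, ← hk]
        push_cast
        ring
      | succ k =>
        have hk' := hp k
        simp only [Polynomial.coeff_mul_X, Polynomial.coeff_mul_C, map_add, D.leibniz, hDX, hh,
          smul_eq_mul, ← hk, ← hk', mul_zero]
        push_cast
        ring
  have hvanish : ∀ k, (φ g).coeff (k + 1) = 0 := by
    intro k
    have hDk : D ((φ g).coeff k) = 0 := by
      induction k with
      | zero => rw [hzero, hg]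
      | succ k ih =>
        have := hcoeff g k
        rw [ih] at this
        rw [(mul_eq_zero.mp this).resolve_right (by norm_cast), map_zero]
    have := hcoeff g k
    rw [hDk] at this
    exact (mul_eq_zero.mp this).resolve_right (by norm_cast)
  have hφg : φ g = Polynomial.C g := by
    ext1 k
    cases k with
    | zero => rw [hzero, Polynomial.coeff_C_zero]
    | succ k => rw [hvanish, Polynomial.coeff_C_succ]
  have hcomp : aeval (fun i => algebraMap (MvPolynomial σ K) B (X i) + τ * algebraMap _ B (h i)) =
      ((Polynomial.aeval τ).restrictScalars K).comp φ := by
    refine algHom_ext fun i => ?_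
    simp [hφX, mul_comm τ]
  rw [hcomp]
  simp [hφg]

/-- **Gordan–Noether**: a form of degree at least two with zero Hessian is killed by a nonzero
derivation `D = ∑ hᵢ ∂ᵢ` with `D hᵢ = 0` for all `i`. -/
theorem IsHomogeneous.exists_mkDerivation_eq_zero_of_hessian {K : Type*} [Field K] [CharZero K]
    {n : ℕ} {f : MvPolynomial (Fin n) K} {d : ℕ} (hd : 2 ≤ d) (hf : f.IsHomogeneous d)
    (hHess : (Matrix.of fun i j : Fin n => pderiv i (pderiv j f)).det = 0) :
    ∃ h : Fin n → MvPolynomial (Fin n) K, (∃ i, h i ≠ 0) ∧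
      (∀ i, mkDerivation K h (h i) = 0) ∧ mkDerivation K h f = 0 := by
  obtain ⟨p, hp, i₀, hi₀⟩ := exists_relation_pderiv_ne_zero (fun j => pderiv j f)
    (not_algebraicIndependent_of_det_pderiv_eq_zero _ hHess)
  set g : Fin n → MvPolynomial (Fin n) K := fun j => pderiv j f with hg
  let h : Fin n → MvPolynomial (Fin n) K := fun i => MvPolynomial.aeval g (pderiv i p)
  let D := mkDerivation K h
  have hDg : ∀ j, D (g j) = 0 := by
    intro j
    have hj := derivation_aeval (pderiv j) g p
    rw [hp, map_zero] at hj
    rw [mkDerivation_eq_sum, hj]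
    exact Finset.sum_congr rfl fun i _ => by rw [hg, pderiv_comm i j]
  have hDh : ∀ i, D (h i) = 0 := by
    intro i
    exact (derivation_aeval D g _).trans (Finset.sum_eq_zero fun j _ => by rw [hDg, mul_zero])
  refine ⟨h, ⟨i₀, hi₀⟩, hDh, ?_⟩
  have hEuler := congrArg D hf.sum_X_mul_pderiv
  have hDX : ∀ i, D (X i) = h i := fun i => mkDerivation_X _ _ _
  have hsum : D (∑ i, X i * pderiv i f) = D f := by
    have hDf : D f = ∑ i, h i * pderiv i f := mkDerivation_eq_sum h f
    rw [map_sum, hDf]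
    refine Finset.sum_congr rfl fun i _ => ?_
    have hi : D (pderiv i f) = 0 := hDg i
    rw [D.leibniz, hi, hDX, smul_zero, zero_add, smul_eq_mul, mul_comm]
  rw [hsum, map_nsmul, nsmul_eq_mul] at hEuler
  have hmul : ((d : MvPolynomial (Fin n) K) - 1) * D f = 0 := by
    rw [sub_mul, one_mul, ← hEuler, sub_self]
  refine (mul_eq_zero.mp hmul).resolve_left (sub_ne_zero.mpr ?_)
  exact_mod_cast (by omega : d ≠ 1)

/-- If `f` is killed by `D = ∑ hⱼ ∂ⱼ` with `D hⱼ = 0` for all `j` and `hᵢ ≠ 0`, then `xᵢ` can be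
eliminated from `f` by the birational substitution `xⱼ ↦ xⱼ - (xᵢ / hᵢ) hⱼ`. -/
theorem exists_adjoin_of_mkDerivation_eq_zero {K F : Type*} [Field K] [CharZero K] {n : ℕ} [Field F]
    [Algebra K F] [Algebra (MvPolynomial (Fin n) K) F] [IsScalarTower K (MvPolynomial (Fin n) K) F]
    [IsFractionRing (MvPolynomial (Fin n) K) F] (h : Fin n → MvPolynomial (Fin n) K)
    (hh : ∀ j, mkDerivation K h (h j) = 0) {i : Fin n} (hi : h i ≠ 0) {f : MvPolynomial (Fin n) K}
    (hhf : mkDerivation K h f = 0) :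
    ∃ s : Fin (n - 1) → F,
      algebraMap (MvPolynomial (Fin n) K) F f ∈ IntermediateField.adjoin K (Set.range s) ∧
      IntermediateField.adjoin K
        (Set.range s ∪ {algebraMap (MvPolynomial (Fin n) K) F (X i)}) = ⊤ := by
  obtain ⟨m, rfl⟩ : ∃ m, n = m + 1 := ⟨n - 1, by have := i.isLt; omega⟩
  let a : MvPolynomial (Fin (m + 1)) K →ₐ[K] F := IsScalarTower.toAlgHom K _ F
  have ha : ∀ q, a q = algebraMap _ F q := fun _ => rfl
  have hi' : a (h i) ≠ 0 := by
    rw [ha, ne_eq, FaithfulSMul.algebraMap_eq_zero_iff]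
    exact hi
  let τ : F := -(a (X i) / a (h i))
  let t : Fin (m + 1) → F := fun j => a (X j) + τ * a (h j)
  have ht : ∀ g, mkDerivation K h g = 0 → aeval t g = a g := fun g hg =>
    aeval_add_mul_of_mkDerivation_eq_zero h hh τ g hg
  have hti : t i = 0 := by
    simp only [t, τ]
    field_simp
    ring
  let s : Fin m → F := fun k => t (i.succAbove k)
  have hts : ∀ (L : IntermediateField K F), Set.range s ⊆ L →
      ∀ q : MvPolynomial (Fin (m + 1)) K, aeval t q ∈ L := by
    intro L hL q
    have htL : ∀ j, t j ∈ L := by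
      intro j
      rcases eq_or_ne j i with rfl | hj
      · rw [hti]
        exact zero_mem L
      · obtain ⟨k, rfl⟩ := Fin.exists_succAbove_eq hj
        exact hL ⟨k, rfl⟩
    induction q using MvPolynomial.induction_on with
    | C c => simp
    | add p q hp hq => simpa using add_mem hp hq
    | mul_X p j hp => simpa using mul_mem hp (htL j)
  refine ⟨s, ?_, ?_⟩
  · rw [← ha, ← ht f hhf]
    exact hts _ (IntermediateField.subset_adjoin K _) f
  · rw [← ha]
    set L := IntermediateField.adjoin K (Set.range s ∪ {a (X i)})
    have hsub : Set.range s ∪ {a (X i)} ⊆ (L : Set F) :=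
      IntermediateField.subset_adjoin K _
    have hsL : Set.range s ⊆ (L : Set F) := Set.subset_union_left.trans hsub
    have hiL : a (X i) ∈ L := hsub (Or.inr rfl)
    have hhL : ∀ j, a (h j) ∈ L := fun j => ht (h j) (hh j) ▸ hts L hsL (h j)
    have htL : ∀ j, t j ∈ L := fun j =>
      aeval_X (R := K) t j ▸ hts L hsL (X j)
    have hXL : ∀ j, a (X j) ∈ L := by
      intro j
      have hj : a (X j) = t j - τ * a (h j) := by simp [t]
      rw [hj]
      exact sub_mem (htL j) (mul_mem (neg_mem (div_mem hiL (hhL i))) (hhL j))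
    have haL : ∀ q, a q ∈ L := by
      intro q
      induction q using MvPolynomial.induction_on with
      | C c =>
        rw [show a (C c) = algebraMap K F c from a.commutes c]
        exact L.algebraMap_mem c
      | add p q hp hq => simpa using add_mem hp hq
      | mul_X p j hp => simpa using mul_mem hp (hXL j)
    refine eq_top_iff.mpr fun z _ => ?_
    obtain ⟨p, q, -, rfl⟩ := IsFractionRing.div_surjective (A := MvPolynomial (Fin (m + 1)) K) z
    exact div_mem (haL p) (haL q)

end MvPolynomial

/-- **Gordan–Noether.** If `f` is a homogeneous polynomial of degree at least `2`
whose Hessian determinant vanishes identically, then a variable can be eliminated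
from `f` by a birational transformation of the variables: there are elements
`s₁, …, s_{n-1}` of the fraction field `K(x₁, …, xₙ)` and an index `i` such that
`f ∈ K(s₁, …, s_{n-1})` and `K(s₁, …, s_{n-1}, xᵢ) = K(x₁, …, xₙ)`. -/
theorem gordan_noether_birational_elimination
    {K : Type*} [Field K] [IsAlgClosed K] [CharZero K] {n : ℕ}
    (f : MvPolynomial (Fin n) K) (d : ℕ) (hd : 2 ≤ d) (hf : f.IsHomogeneous d)
    (hHess : (Matrix.of fun i j : Fin n => pderiv i (pderiv j f)).det = 0) :
    ∃ (s : Fin (n - 1) → FractionRing (MvPolynomial (Fin n) K)) (i : Fin n),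
      algebraMap (MvPolynomial (Fin n) K) (FractionRing (MvPolynomial (Fin n) K)) f ∈
        IntermediateField.adjoin K (Set.range s) ∧
      IntermediateField.adjoin K
        (Set.range s ∪
          {algebraMap (MvPolynomial (Fin n) K) (FractionRing (MvPolynomial (Fin n) K)) (X i)})
        = ⊤ := by
  obtain ⟨h, ⟨i, hi⟩, hh, hhf⟩ := hf.exists_mkDerivation_eq_zero_of_hessian hd hHess
  obtain ⟨s, hs⟩ := exists_adjoin_of_mkDerivation_eq_zero
    (F := FractionRing (MvPolynomial (Fin n) K)) h hh hi hhf
  exact ⟨s, i, hs⟩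
end

section
/- Let f ∈ K[x₁,x₂] be a homogeneous polynomial of degree d ≥ 2 with zero Hessian. Then f = (a₁x₁ + a₂x₂)^d for some a₁, a₂ ∈ K, up to a nonzero scalar multiple (i.e., f = c·(a₁x₁+a₂x₂)^d with c ∈ K). -/
open MvPolynomial

namespace MvPolynomial

theorem pderiv_pderiv_comm {σ R : Type*} [CommSemiring R] (i j : σ) (p : MvPolynomial σ R) :
    pderiv i (pderiv j p) = pderiv j (pderiv i p) := by
  classical
  induction p using MvPolynomial.induction_on with
  | C a => simp
  | add p q hp hq => simp [hp, hq]
  | mul_X p k h =>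
    simp only [Derivation.leibniz, pderiv_X, Pi.single_apply, smul_eq_mul, map_add, h]
    split_ifs <;> simp <;> ring

theorem derivative_aeval_X_one {R : Type*} [CommSemiring R] (p : MvPolynomial (Fin 2) R) :
    Polynomial.derivative (aeval ![Polynomial.X, (1 : Polynomial R)] p) =
      aeval ![Polynomial.X, (1 : Polynomial R)] (pderiv 0 p) := by
  induction p using MvPolynomial.induction_on with
  | C a => simp
  | add p q hp hq => simp [hp, hq]
  | mul_X p i h => fin_cases i <;> simp [h, pderiv_X, mul_comm]

/-- A binary form of degree `n + 1` with zero Hessian satisfies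
`(n + 1) f ∂₀²f = n (∂₀f)²`. -/
theorem IsHomogeneous.mul_pderiv_pderiv_eq_of_hessian_eq_zero {K : Type*} [Field K] [CharZero K]
    {f : MvPolynomial (Fin 2) K} {n : ℕ} (hn : n ≠ 0) (hf : f.IsHomogeneous (n + 1))
    (hHess : (Matrix.of fun i j : Fin 2 => pderiv i (pderiv j f)).det = 0) :
    (n + 1) * (f * pderiv 0 (pderiv 0 f)) = n * (pderiv 0 f) ^ 2 := by
  have h := hf.sum_X_mul_pderiv
  have h₀ := (hf.pderiv (i := 0)).sum_X_mul_pderiv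
  have h₁ := (hf.pderiv (i := 1)).sum_X_mul_pderiv
  simp only [Fin.sum_univ_two, nsmul_eq_mul, Nat.add_sub_cancel, Nat.cast_add, Nat.cast_one,
    pderiv_pderiv_comm 1 0 f] at h h₀ h₁
  simp only [Matrix.det_fin_two, Matrix.of_apply, pderiv_pderiv_comm 1 0 f] at hHess
  have hn' : (n : MvPolynomial (Fin 2) K) ≠ 0 := Nat.cast_ne_zero.mpr hn
  apply mul_left_cancel₀ hn'
  set a := pderiv 0 (pderiv 0 f)
  set b := pderiv 0 (pderiv 1 f)
  linear_combination (-n * a) * h - (X 0 * a) * h₀ - X 1 * a * h₁ +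
    (X 0 * a + X 1 * b + n * pderiv 0 f) * h₀ + X 1 ^ 2 * hHess

end MvPolynomial

namespace Polynomial

theorem rootMultiplicity_eq_of_mul_derivative_derivative_eq {K : Type*} [Field K] [CharZero K]
    {g : K[X]} (hg : g ≠ 0) {n : ℕ}
    (h : (n + 1) * (g * derivative (derivative g)) = n * (derivative g) ^ 2)
    {a : K} (ha : g.IsRoot a) : g.rootMultiplicity a = n + 1 := by
  obtain ⟨q, hq, hdvd⟩ := exists_eq_pow_rootMultiplicity_mul_and_not_dvd g hg a
  have hm : g.rootMultiplicity a ≠ 0 := ((rootMultiplicity_pos hg).mpr ha).ne'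
  obtain ⟨m, hm⟩ := Nat.exists_eq_add_one_of_ne_zero hm
  rw [dvd_iff_isRoot, IsRoot.def] at hdvd
  rw [hm] at hq ⊢
  set t := X - C a with ht
  have ht0 : t ≠ 0 := X_sub_C_ne_zero a
  have hdt : derivative t = 1 := by simp [ht]
  have h1 : derivative g = t ^ m * ((m + 1) * q + t * derivative q) := by
    rw [hq]
    simp [derivative_pow, hdt]
    ring
  have h2 : t * derivative (derivative g) = t ^ m * (m * ((m + 1) * q + t * derivative q) +
      t * ((m + 1) * derivative q + derivative q + t * derivative (derivative q))) := by
    rw [h1]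
    cases m with
    | zero => simp [hdt, ht0]; ring
    | succ m => simp [derivative_pow, hdt]; ring
  have h3 : (n + 1) * (q * (m * ((m + 1) * q + t * derivative q) +
      t * ((m + 1) * derivative q + derivative q + t * derivative (derivative q)))) =
      n * ((m + 1) * q + t * derivative q) ^ 2 := by
    apply mul_left_cancel₀ (pow_ne_zero (2 * m) ht0)
    rw [h1] at h
    rw [h1] at h2
    rw [hq] at h
    linear_combination h - (n + 1) * q * t ^ m * h2
  have h4 := congrArg (eval a) h3
  simp [ht] at h4
  have h5 : ((m : K) + 1) * q.eval a ^ 2 * (m - n) = 0 := by linear_combination h4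
  have h6 : (m : K) + 1 ≠ 0 := by exact_mod_cast m.succ_ne_zero
  have h7 : (m : K) = n := by simpa [h6, hdvd, sub_eq_zero] using h5
  have h8 : m = n := by exact_mod_cast h7
  rw [h8]

theorem exists_eq_C_or_eq_C_mul_pow_of_mul_derivative_derivative_eq {K : Type*} [Field K]
    [IsAlgClosed K] [CharZero K] {g : K[X]} {n : ℕ} (hdeg : g.natDegree ≤ n + 1)
    (h : (n + 1) * (g * derivative (derivative g)) = n * (derivative g) ^ 2) :
    (∃ c, g = C c) ∨ ∃ a c, g = C c * (X - C a) ^ (n + 1) := by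
  by_cases h0 : g.degree = 0 ∨ g = 0
  · left
    rcases h0 with h0 | h0
    · exact ⟨_, eq_C_of_degree_eq_zero h0⟩
    · exact ⟨0, by simp [h0]⟩
  · right
    push Not at h0
    obtain ⟨a, ha⟩ := IsAlgClosed.exists_root g h0.1
    refine ⟨a, g.leadingCoeff, eq_leadingCoeff_mul_of_monic_of_dvd_of_natDegree_le
      ((monic_X_sub_C a).pow _) ?_ (by simpa using hdeg)⟩
    rw [← rootMultiplicity_eq_of_mul_derivative_derivative_eq h0.2 h ha]
    exact pow_rootMultiplicity_dvd g a

end Polynomial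

/-- A binary form of degree `d ≥ 2` with identically vanishing Hessian determinant is,
up to a scalar multiple, the `d`-th power of a linear form. -/
theorem binary_form_with_zero_hessian
    {K : Type*} [Field K] [IsAlgClosed K] [CharZero K]
    (f : MvPolynomial (Fin 2) K) (d : ℕ) (hd : 2 ≤ d) (hf : f.IsHomogeneous d)
    (hHess : (Matrix.of fun i j : Fin 2 => pderiv i (pderiv j f)).det = 0) :
    ∃ a₁ a₂ c : K, f = C c * (C a₁ * X 0 + C a₂ * X 1) ^ d := by
  obtain ⟨n, rfl⟩ : ∃ n, d = n + 1 := ⟨d - 1, by omega⟩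
  set g := aeval ![Polynomial.X, (1 : Polynomial K)] f with hg
  have hdeg : g.natDegree ≤ n + 1 := by
    simpa using aeval_natDegree_le (n := 1) f hf.totalDegree_le ![Polynomial.X, 1]
      (by simp [Fin.forall_fin_two])
  have hode := congrArg (aeval ![Polynomial.X, (1 : Polynomial K)])
    (hf.mul_pderiv_pderiv_eq_of_hessian_eq_zero (by omega) hHess)
  simp only [map_mul, map_add, map_pow, map_natCast, map_one, ← derivative_aeval_X_one,
    ← hg] at hode
  have key (a₁ a₂ c : K)
      (h : g = .C c * (.C a₁ * Polynomial.X + .C a₂) ^ (n + 1)) :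
      f = C c * (C a₁ * X 0 + C a₂ * X 1) ^ (n + 1) := by
    rw [← Polynomial.homogenize_eq_of_isHomogeneous hf hg.symm]
    apply Polynomial.homogenize_eq_of_isHomogeneous
    · have hl : (C a₁ * X 0 + C a₂ * X 1 : MvPolynomial (Fin 2) K).IsHomogeneous 1 :=
        (isHomogeneous_C_mul_X _ _).add (isHomogeneous_C_mul_X _ _)
      simpa using (hl.pow (n + 1)).C_mul c
    · simp [h, Polynomial.C_eq_algebraMap]
  rcases Polynomial.exists_eq_C_or_eq_C_mul_pow_of_mul_derivative_derivative_eq hdeg hode with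
    ⟨c, hc⟩ | ⟨a, c, hc⟩
  · exact ⟨0, 1, c, key _ _ _ (by simp [hc])⟩
  · exact ⟨1, -a, c, key _ _ _ (by simp [hc, sub_eq_add_neg])⟩
end

section
/- Let f ∈ K[x₁,x₂,x₃] be a homogeneous polynomial of degree ≥ 2 with zero Hessian. Then a variable can be eliminated from f by a linear transformation of the variables: the partial derivatives ∂f/∂x₁, ∂f/∂x₂, ∂f/∂x₃ are linearly dependent over K; equivalently, there exists an invertible matrix A ∈ GL(3,K) such that the polynomial f′ defined by f′(Ax) = f(x) satisfies ∂f′/∂x₃ = 0. -/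
open MvPolynomial

theorem MvPolynomial.IsHomogeneous.aeval_mul {σ R S : Type*} [CommSemiring R] [CommSemiring S]
    [Algebra R S] {u : MvPolynomial σ R} {n : ℕ} (hu : u.IsHomogeneous n) (c : S) (g : σ → S) :
    MvPolynomial.aeval (fun i => c * g i) u = c ^ n * MvPolynomial.aeval g u := by
  simp only [aeval_def, eval₂_eq, Finset.mul_sum]
  refine Finset.sum_congr rfl fun s hs => ?_
  have h : ∑ i ∈ s.support, s i = n := by
    have := hu (mem_support_iff.mp hs)
    simpa [Finsupp.weight_apply, Finsupp.sum] using this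
  rw [← h]
  simp only [mul_pow, Finset.prod_mul_distrib, Finset.prod_pow_eq_pow_sum]
  ring

theorem MvPolynomial.coeff_aeval_X_mul_C {σ R S : Type*} [CommSemiring R] [CommSemiring S]
    [Algebra R S] (u : MvPolynomial σ R) (g : σ → S) (k : ℕ) :
    (aeval (fun i => Polynomial.X * Polynomial.C (g i)) u).coeff k =
      aeval g (homogeneousComponent k u) := by
  have key : ∀ n, aeval (fun i => Polynomial.X * Polynomial.C (g i)) (homogeneousComponent n u) =
      Polynomial.X ^ n * Polynomial.C (aeval g (homogeneousComponent n u)) := fun n => by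
    rw [(homogeneousComponent_isHomogeneous n u).aeval_mul]
    congr 1
    exact (aeval_algebraMap_apply (Polynomial S) g (homogeneousComponent n u))
  conv_lhs => rw [← sum_homogeneousComponent u]
  simp only [map_sum, key, Polynomial.finsetSum_coeff, Polynomial.coeff_X_pow_mul',
    Polynomial.coeff_C]
  by_cases hk : k ≤ u.totalDegree
  · rw [Finset.sum_eq_single k]
    · simp
    · intro b _ hb
      split_ifs <;> first | rfl | omega
    · intro h
      exact absurd (Finset.mem_range.2 (by omega)) h
  · rw [homogeneousComponent_eq_zero _ _ (by omega), map_zero]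
    refine Finset.sum_eq_zero fun b hb => ?_
    have := Finset.mem_range.1 hb
    split_ifs <;> first | rfl | omega

theorem Polynomial.exists_forall_ne_coeff_eq_zero_of_mul_eq {A : Type*} [CommRing A] [IsDomain A]
    {p q : Polynomial A} {a : A} {n : ℕ} (ha : a ≠ 0)
    (h : p * q = Polynomial.X ^ n * Polynomial.C a) :
    ∃ k, ∀ j, j ≠ k → p.coeff j = 0 := by
  have hp : p ≠ 0 := by
    rintro rfl
    simp [ha] at h
  have hq : q ≠ 0 := by
    rintro rfl
    simp [ha] at h
  have h1 := congrArg Polynomial.natDegree h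
  have h2 := congrArg Polynomial.natTrailingDegree h
  rw [Polynomial.natDegree_mul hp hq, mul_comm (Polynomial.X ^ n),
    Polynomial.natDegree_C_mul_X_pow n a ha] at h1
  rw [Polynomial.natTrailingDegree_mul hp hq, mul_comm (Polynomial.X ^ n),
    Polynomial.C_mul_X_pow_eq_monomial, Polynomial.natTrailingDegree_monomial ha] at h2
  have h3 := Polynomial.natTrailingDegree_le_natDegree p
  have h4 := Polynomial.natTrailingDegree_le_natDegree q
  refine ⟨p.natDegree, fun j hj => ?_⟩
  rcases lt_or_gt_of_ne hj with hj | hj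
  · exact Polynomial.coeff_eq_zero_of_lt_natTrailingDegree (by omega)
  · exact Polynomial.coeff_eq_zero_of_natDegree_lt hj

theorem MvPolynomial.IsHomogeneous.of_mul_left {σ K : Type*} [CommRing K] [IsDomain K]
    {u v : MvPolynomial σ K} {n : ℕ} (h : (u * v).IsHomogeneous n) (h0 : u * v ≠ 0) :
    ∃ k, u.IsHomogeneous k := by
  have e := h.aeval_mul Polynomial.X
    (fun i => (Polynomial.C (X i) : Polynomial (MvPolynomial σ K)))
  have e' : MvPolynomial.aeval (fun i => (Polynomial.C (X i) : Polynomial (MvPolynomial σ K)))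
      (u * v) =
      Polynomial.C (u * v) := by
    have := aeval_algebraMap_apply (Polynomial (MvPolynomial σ K)) (X : σ → MvPolynomial σ K)
      (u * v)
    rw [aeval_X_left_apply] at this
    exact this
  rw [e', map_mul] at e
  obtain ⟨k, hk⟩ := Polynomial.exists_forall_ne_coeff_eq_zero_of_mul_eq h0 e
  have hk' : ∀ j, j ≠ k → homogeneousComponent j u = 0 := fun j hj => by
    have := hk j hj
    rwa [coeff_aeval_X_mul_C u X j, aeval_X_left_apply] at this
  refine ⟨k, ?_⟩
  have : u = homogeneousComponent k u := by
    by_cases hle : k ≤ u.totalDegree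
    · conv_lhs => rw [← sum_homogeneousComponent u]
      rw [Finset.sum_eq_single k]
      · intro j _ hj
        exact hk' j hj
      · intro h
        exact absurd (Finset.mem_range.2 (by omega)) h
    · exfalso
      apply h0
      rw [← sum_homogeneousComponent u, Finset.sum_eq_zero, zero_mul]
      intro j hj
      have := Finset.mem_range.1 hj
      exact hk' j (by omega)
  rw [this]
  exact homogeneousComponent_isHomogeneous k u

theorem Polynomial.coeff_prod_sum_of_natDegree_le {ι R : Type*} [CommSemiring R] (s : Finset ι)
    (f : ι → Polynomial R) (n : ι → ℕ) (h : ∀ i ∈ s, (f i).natDegree ≤ n i) :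
    (∏ i ∈ s, f i).coeff (∑ i ∈ s, n i) = ∏ i ∈ s, (f i).coeff (n i) := by
  classical
  induction s using Finset.induction_on with
  | empty => simp
  | insert a s ha ih =>
    rw [Finset.prod_insert ha, Finset.sum_insert ha, Finset.prod_insert ha,
      Polynomial.coeff_mul_add_eq_of_natDegree_le (h a (Finset.mem_insert_self a s)),
      ih fun i hi => h i (Finset.mem_insert_of_mem hi)]
    exact (Polynomial.natDegree_prod_le s f).trans
      (Finset.sum_le_sum fun i hi => h i (Finset.mem_insert_of_mem hi))

/-- The top coefficient of the restriction of a form to a line is its value at the direction. -/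
theorem MvPolynomial.IsHomogeneous.coeff_aeval_line {σ R S : Type*} [CommSemiring R]
    [CommSemiring S] [Algebra R S] {u : MvPolynomial σ R} {n : ℕ} (hu : u.IsHomogeneous n)
    (x y : σ → S) :
    (MvPolynomial.aeval (fun i => Polynomial.C (x i) + Polynomial.C (y i) * Polynomial.X) u).coeff
      n = MvPolynomial.aeval y u := by
  simp only [aeval_def, eval₂_eq, Polynomial.finsetSum_coeff]
  refine Finset.sum_congr rfl fun s hs => ?_
  have h : ∑ i ∈ s.support, s i = n := by
    have := hu (mem_support_iff.mp hs)
    simpa [Finsupp.weight_apply, Finsupp.sum] using this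
  have hl : ∀ i, (Polynomial.C (x i) + Polynomial.C (y i) * Polynomial.X).natDegree ≤ 1 :=
    fun i => by rw [add_comm]; exact Polynomial.natDegree_linear_le
  rw [Polynomial.algebraMap_apply, Polynomial.coeff_C_mul, ← h,
    Polynomial.coeff_prod_sum_of_natDegree_le]
  · congr 1
    refine Finset.prod_congr rfl fun i _ => ?_
    have := Polynomial.coeff_pow_of_natDegree_le (m := s i) (hl i)
    simpa using this
  · intro i _
    simpa using Polynomial.natDegree_pow_le_of_le (s i) (hl i)

theorem Derivation.exists_polynomial_extension {R A : Type*} [CommRing R] [CommRing A]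
    [Algebra R A] (D : Derivation R A A) :
    ∃ δ : Derivation R (Polynomial A) (Polynomial A), ∀ q k, (δ q).coeff k = D (q.coeff k) :=
  ⟨(PolynomialModule.equivPolynomialSelf (R := A)).toLinearMap.compDer D.mapCoeffs,
    fun _ _ => rfl⟩

theorem MvPolynomial.line_derivation {σ K : Type*} [Fintype σ] [CommRing K]
    (h : σ → MvPolynomial σ K) (D : Derivation K (MvPolynomial σ K) (MvPolynomial σ K))
    (hD : ∀ i, D (X i) = h i) (a b : MvPolynomial σ K) (hab : ∀ i, a * D (h i) = b * h i)
    (p : MvPolynomial σ K) (k : ℕ) :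
    let c := fun k => (aeval (fun i => Polynomial.C (X i) + Polynomial.C (h i) * Polynomial.X)
      p : Polynomial (MvPolynomial σ K)).coeff k
    a * D (c k) = a * ((k + 1) * c (k + 1)) + b * (k * c k) := by
  obtain ⟨δ, hδ⟩ := D.exists_polynomial_extension
  have hδX : δ Polynomial.X = 0 := by
    ext1 k
    rw [hδ, Polynomial.coeff_X]
    split_ifs <;> simp
  have hδC : ∀ r, δ (Polynomial.C r) = Polynomial.C (D r) := fun r => by
    ext1 k
    rw [hδ, Polynomial.coeff_C, Polynomial.coeff_C]
    split_ifs <;> simp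
  set Φ : MvPolynomial σ K →ₐ[K] Polynomial (MvPolynomial σ K) :=
    aeval (fun i => Polynomial.C (X i) + Polynomial.C (h i) * Polynomial.X) with hΦ
  have key : Polynomial.C a * δ (Φ p) =
      (Polynomial.C a + Polynomial.C b * Polynomial.X) * Polynomial.derivative (Φ p) := by
    induction p using MvPolynomial.induction_on with
    | C r =>
      have : Φ (C r) = algebraMap K _ r := by rw [hΦ, aeval_C]
      rw [this, Derivation.map_algebraMap, Polynomial.algebraMap_apply, Polynomial.derivative_C]
      simp
    | add p q hp hq => simp only [map_add, mul_add, hp, hq]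
    | mul_X p i hp =>
      have hX : Φ (X i) = Polynomial.C (X i) + Polynomial.C (h i) * Polynomial.X := by
        rw [hΦ, aeval_X]
      have hi := congrArg Polynomial.C (hab i)
      simp only [map_mul] at hi
      rw [map_mul, Derivation.leibniz, Polynomial.derivative_mul, hX]
      simp only [map_add, Derivation.leibniz, hδX, hδC, hD, smul_eq_mul, Polynomial.derivative_C,
        Polynomial.derivative_mul, Polynomial.derivative_X]
      linear_combination (Polynomial.C (X i) + Polynomial.C (h i) * Polynomial.X) * hp +
        Φ p * Polynomial.X * hi
  have := congrArg (fun q => Polynomial.coeff q k) key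
  simp only [add_mul, Polynomial.coeff_add, Polynomial.coeff_C_mul, hδ, mul_assoc] at this
  intro c
  change a * D ((Φ p).coeff k) = a * ((k + 1) * (Φ p).coeff (k + 1)) + b * (k * (Φ p).coeff k)
  rw [this]
  rcases k with _ | k
  · simp [Polynomial.coeff_derivative, mul_comm]
  · simp [Polynomial.coeff_derivative, mul_comm]

/-- A polynomial killed by a vector field with straight integral curves is constant on the
lines tangent to the field. -/
theorem MvPolynomial.aeval_line_eq_C {σ K : Type*} [Fintype σ] [Field K] [CharZero K]
    (h : σ → MvPolynomial σ K) (D : Derivation K (MvPolynomial σ K) (MvPolynomial σ K))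
    (hD : ∀ i, D (X i) = h i) (a b : MvPolynomial σ K) (ha : a ≠ 0)
    (hab : ∀ i, a * D (h i) = b * h i) (p : MvPolynomial σ K) (hp : D p = 0) :
    aeval (fun i => Polynomial.C (X i) + Polynomial.C (h i) * Polynomial.X) p =
      Polynomial.C p := by
  set Φ := aeval (R := K) (fun i => Polynomial.C (X i) + Polynomial.C (h i) * Polynomial.X)
    with hΦ
  have hrec := MvPolynomial.line_derivation h D hD a b hab p
  simp only [← hΦ] at hrec
  have h0 : (Φ p).coeff 0 = p := by
    have e : (Polynomial.aeval (0 : MvPolynomial σ K)).toRingHom.comp Φ.toRingHom = RingHom.id _ := by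
      ext i
      · simp [hΦ]
      · simp [hΦ]
    have := congrArg (fun g => g p) e
    simpa [Polynomial.coeff_zero_eq_aeval_zero] using this
  have hs : ∀ k, (Φ p).coeff (k + 1) = 0 := by
    intro k
    induction k with
    | zero =>
      have := hrec 0
      rw [h0, hp] at this
      simpa [ha] using this
    | succ k ih =>
      have := hrec (k + 1)
      rw [ih] at this
      have hk : ((k : MvPolynomial σ K) + 1 + 1) ≠ 0 := by exact_mod_cast Nat.succ_ne_zero (k + 1)
      simpa [ha, hk] using this
  ext1 k
  rcases k with _ | k
  · simpa using h0
  · rw [hs, Polynomial.coeff_C_succ]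

theorem Polynomial.dvd_of_common_root {R L : Type*} [CommRing R] [IsDomain R]
    [IsGCDMonoid R] [Field L] {φ : R →+* L} (hφ : Function.Injective φ) (ζ : L)
    {p q : Polynomial R} (hp : Irreducible p) (hp0 : p.eval₂ φ ζ = 0) (hq0 : q.eval₂ φ ζ = 0) :
    p ∣ q := by
  by_cases hdeg : p.natDegree = 0
  · obtain ⟨r, rfl⟩ : ∃ r, p = Polynomial.C r :=
      ⟨_, Polynomial.eq_C_of_natDegree_eq_zero hdeg⟩
    rw [Polynomial.eval₂_C, map_eq_zero_iff φ hφ] at hp0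
    exact absurd (by simp [hp0]) hp.ne_zero
  have hprim : p.IsPrimitive := hp.isPrimitive hdeg
  have hirr : Irreducible (p.map (algebraMap R (FractionRing R))) :=
    hprim.irreducible_iff_irreducible_map_fraction_map.1 hp
  by_contra hpq
  have hnd : ¬ p.map (algebraMap R (FractionRing R)) ∣ q.map (algebraMap R (FractionRing R)) :=
    fun h => hpq (hprim.dvd_of_fraction_map_dvd_fraction_map h)
  obtain ⟨a, b, hab⟩ := (hirr.coprime_iff_not_dvd).2 hnd
  have hψ : (IsFractionRing.lift hφ : FractionRing R →+* L).comp
      (algebraMap R (FractionRing R)) = φ := by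
    ext r
    simp
  have := congrArg (Polynomial.eval₂ (IsFractionRing.lift hφ : FractionRing R →+* L) ζ) hab
  simp [Polynomial.eval₂_add, Polynomial.eval₂_mul, Polynomial.eval₂_map, hψ, hp0, hq0] at this

theorem MvPolynomial.aeval_X_mul_C_injective_of_transcendental {K L : Type*} [Field K] [Field L]
    [Algebra K L] {ζ : L} (hζ : Transcendental K ζ) :
    Function.Injective (aeval (R := K) (fun i : Fin 2 =>
      (Polynomial.X * Polynomial.C ((![ζ, 1] : Fin 2 → L) i) : Polynomial L))) := by
  rw [injective_iff_map_eq_zero]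
  intro r hr
  rw [← sum_homogeneousComponent r]
  refine Finset.sum_eq_zero fun k _ => ?_
  have h1 : aeval (![ζ, 1] : Fin 2 → L) (homogeneousComponent k r) = 0 := by
    rw [← coeff_aeval_X_mul_C, hr, Polynomial.coeff_zero]
  have h2 : Polynomial.aeval ζ
      (aeval (![Polynomial.X, 1] : Fin 2 → Polynomial K) (homogeneousComponent k r)) = 0 := by
    rw [← h1]
    change ((Polynomial.aeval ζ).comp (aeval (![Polynomial.X, 1] : Fin 2 → Polynomial K))) _ = _
    congr 1
    ext i
    fin_cases i <;> simp
  have h3 := (transcendental_iff.1 hζ) _ h2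
  rw [← Polynomial.homogenize_eq_of_isHomogeneous (homogeneousComponent_isHomogeneous k r) h3]
  simp

theorem MvPolynomial.isAlgebraic_of_common_zero {K L : Type*} [Field K] [Field L] [Algebra K L]
    {p q : MvPolynomial (Fin 3) K} (hp : Irreducible p) (hpq : ¬ p ∣ q) (z : Fin 3 → L)
    (hz : z 2 = 1)
    (hp0 : aeval (fun i => (Polynomial.X * Polynomial.C (z i) : Polynomial L)) p = 0)
    (hq0 : aeval (fun i => (Polynomial.X * Polynomial.C (z i) : Polynomial L)) q = 0) :
    IsAlgebraic K (z 1) := by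
  by_contra hζ
  have hinj := MvPolynomial.aeval_X_mul_C_injective_of_transcendental (K := K) hζ
  set ψ := aeval (R := K) (fun i : Fin 2 =>
      (Polynomial.X * Polynomial.C ((![z 1, 1] : Fin 2 → L) i) : Polynomial L)) with hψ
  let φ : MvPolynomial (Fin 2) K →+* FractionRing (Polynomial L) :=
    (algebraMap (Polynomial L) (FractionRing (Polynomial L))).comp ψ.toRingHom
  have hφ : Function.Injective φ :=
    (IsFractionRing.injective (Polynomial L) (FractionRing (Polynomial L))).comp hinj
  have hev : ∀ u : MvPolynomial (Fin 3) K, (finSuccEquiv K 2 u).eval₂ φ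
      (algebraMap _ _ (Polynomial.X * Polynomial.C (z 0))) = algebraMap _ (FractionRing (Polynomial L))
        (aeval (fun i => (Polynomial.X * Polynomial.C (z i) : Polynomial L)) u) := by
    intro u
    have : (Polynomial.eval₂RingHom φ
          (algebraMap _ _ (Polynomial.X * Polynomial.C (z 0)))).comp
          (finSuccEquiv K 2).toAlgHom.toRingHom =
        (algebraMap (Polynomial L) (FractionRing (Polynomial L))).comp
          (aeval (fun i => (Polynomial.X * Polynomial.C (z i) : Polynomial L))).toRingHom := by
      apply MvPolynomial.ringHom_ext
      · intro r
        simp [finSuccEquiv_apply, φ]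
      · intro i
        refine Fin.cases ?_ (fun i => ?_) i
        · simp [finSuccEquiv_X_zero]
        · change Polynomial.eval₂ φ _ (finSuccEquiv K 2 (X i.succ)) =
            algebraMap (Polynomial L) _ (aeval (R := K) _ (X i.succ))
          rw [finSuccEquiv_X_succ, Polynomial.eval₂_C, aeval_X]
          fin_cases i <;> simp [φ, hψ, hz]
    exact congrArg (fun g => g u) this
  have hirr : Irreducible (finSuccEquiv K 2 p) := (MulEquiv.irreducible_iff (finSuccEquiv K 2)).2 hp
  refine hpq ((map_dvd_iff (finSuccEquiv K 2)).1 ?_)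
  exact Polynomial.dvd_of_common_root hφ _ hirr (by rw [hev, hp0, map_zero])
    (by rw [hev, hq0, map_zero])

theorem IsAlgClosed.mem_range_of_isAlgebraic {K L : Type*} [Field K] [IsAlgClosed K] [Field L]
    [Algebra K L] {x : L} (hx : IsAlgebraic K x) : ∃ c, algebraMap K L c = x := by
  have := minpoly.mem_range_of_degree_eq_one K x
    (IsAlgClosed.degree_eq_one_of_irreducible K (minpoly.irreducible hx.isIntegral))
  exact this

/-- Ternary forms without common factor have only finitely many projective zeros over any
extension, all of them defined over the algebraically closed base field. -/
theorem MvPolynomial.exists_eq_C_smul_of_common_zero {K L : Type*} [Field K] [IsAlgClosed K]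
    [Field L] [Algebra K L] {u : Fin 3 → MvPolynomial (Fin 3) K} {e : ℕ}
    (hu : ∀ i, (u i).IsHomogeneous e) (h0 : ∃ i, u i ≠ 0)
    (hcop : ∀ p, Irreducible p → ∃ i, ¬ p ∣ u i) (h : Fin 3 → L)
    (hh : ∀ i, aeval h (u i) = 0) :
    ∃ (c : Fin 3 → K) (s : L), ∀ i, h i = algebraMap K L (c i) * s := by
  by_cases hz : ∀ i, h i = 0
  · exact ⟨0, 0, fun i => by simp [hz]⟩
  push Not at hz
  obtain ⟨j, hj⟩ := hz
  let z : Fin 3 → L := fun i => h i / h j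
  set Ψ := aeval (R := K) (fun i => (Polynomial.X * Polynomial.C (z i) : Polynomial L)) with hΨ
  have hΨu : ∀ i, Ψ (u i) = 0 := by
    intro i
    have : (fun i => (Polynomial.X * Polynomial.C (z i) : Polynomial L)) =
        fun i => (Polynomial.X * Polynomial.C (h j)⁻¹) * algebraMap L _ (h i) := by
      ext1 i
      simp only [z, div_eq_inv_mul, Polynomial.algebraMap_eq, map_mul, mul_assoc]
    rw [hΨ, this, (hu i).aeval_mul]
    have hmap := aeval_algebraMap_apply (Polynomial L) h (u i)
    rw [hh, map_zero] at hmap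
    exact mul_eq_zero_of_right _ hmap
  obtain ⟨p, hp, hp0⟩ : ∃ p, Irreducible p ∧ Ψ p = 0 := by
    obtain ⟨i, hi⟩ := h0
    have hp : ∀ v : MvPolynomial (Fin 3) K, v ≠ 0 → Ψ v = 0 → ∃ p, Irreducible p ∧ Ψ p = 0 := by
      intro v
      induction v using WfDvdMonoid.induction_on_irreducible with
      | zero => exact fun h => absurd rfl h
      | unit v hv => exact fun _ h => absurd h (hv.map Ψ).ne_zero
      | mul a p ha hp ih =>
        intro _ h
        rcases mul_eq_zero.1 ((map_mul Ψ p a).symm.trans h) with h | h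
        · exact ⟨p, hp, h⟩
        · exact ih ha h
    exact hp _ hi (hΨu i)
  obtain ⟨l, hl⟩ := hcop p hp
  have halg : ∀ i, IsAlgebraic K (z i) := by
    intro i
    have hzj : z j = 1 := div_self hj
    by_cases hij : i = j
    · rw [hij, hzj]
      exact isAlgebraic_one
    obtain ⟨σ, hσ1, hσ2⟩ : ∃ σ : Equiv.Perm (Fin 3), σ 1 = i ∧ σ 2 = j := by
      revert hij
      clear * -
      revert i j
      decide
    have hren : ∀ v, aeval (fun i => (Polynomial.X * Polynomial.C ((z ∘ σ) i) : Polynomial L))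
        (renameEquiv K σ.symm v) = Ψ v := by
      intro v
      rw [renameEquiv_apply, aeval_rename, hΨ]
      congr 2
      ext1 i
      simp
    have := MvPolynomial.isAlgebraic_of_common_zero (p := renameEquiv K σ.symm p)
      (q := renameEquiv K σ.symm (u l))
      ((MulEquiv.irreducible_iff (renameEquiv K σ.symm)).2 hp)
      (fun h => hl ((map_dvd_iff (renameEquiv K σ.symm)).1 h)) (z ∘ σ)
      (by simp [hσ2, hzj]) (by rw [hren, hp0]) (by rw [hren, hΨu])
    simpa [hσ1] using this
  choose c hc using fun i => IsAlgClosed.mem_range_of_isAlgebraic (halg i)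
  exact ⟨c, h j, fun i => by rw [hc, div_mul_cancel₀ _ hj]⟩

theorem MvPolynomial.pderiv_comm_s2 {σ R : Type*} [CommRing R] (i j : σ) (p : MvPolynomial σ R) :
    pderiv i (pderiv j p) = pderiv j (pderiv i p) := by
  classical
  have : ⁅pderiv (R := R) i, pderiv (R := R) j⁆ = 0 := by
    apply MvPolynomial.derivation_ext
    intro k
    simp only [Derivation.commutator_apply, pderiv_X, Pi.single_apply, Derivation.zero_apply]
    split_ifs <;> simp
  have h := congrArg (fun D => D p) this
  simpa [Derivation.commutator_apply, sub_eq_zero] using h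

theorem mul_eq_mul_of_orthogonal_of_cross_ne_zero {A : Type*} [CommRing A] [IsDomain A]
    {v w : Fin 3 → A} {a b : Fin 3} (hvw : v a * w b ≠ v b * w a) {r s : Fin 3 → A}
    (hvr : ∑ i, v i * r i = 0) (hwr : ∑ i, w i * r i = 0)
    (hvs : ∑ i, v i * s i = 0) (hws : ∑ i, w i * s i = 0) (i j : Fin 3) :
    r i * s j = r j * s i := by
  obtain ⟨n, hn⟩ : ∃ n : Fin 3 → A, n = ![v 1 * w 2 - v 2 * w 1, v 2 * w 0 - v 0 * w 2,
    v 0 * w 1 - v 1 * w 0] := ⟨_, rfl⟩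
  have key : ∀ t : Fin 3 → A, ∑ i, v i * t i = 0 → ∑ i, w i * t i = 0 →
      ∀ i j, n i * t j = n j * t i := by
    intro t hv hw
    rw [Fin.sum_univ_three] at hv hw
    have h01 : n 0 * t 1 = n 1 * t 0 := by
      simp only [hn, Matrix.cons_val]
      linear_combination w 2 * hv - v 2 * hw
    have h12 : n 1 * t 2 = n 2 * t 1 := by
      simp only [hn, Matrix.cons_val]
      linear_combination w 0 * hv - v 0 * hw
    have h20 : n 2 * t 0 = n 0 * t 2 := by
      simp only [hn, Matrix.cons_val]
      linear_combination w 1 * hv - v 1 * hw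
    intro i j
    fin_cases i <;> fin_cases j <;> first | rfl | assumption | (symm; assumption)
  obtain ⟨c, hc⟩ : ∃ c, n c ≠ 0 := by
    by_contra! h
    have h0 := h 0
    have h1 := h 1
    have h2 := h 2
    simp only [hn, Matrix.cons_val] at h0 h1 h2
    apply hvw
    fin_cases a <;> fin_cases b <;> simp only [Fin.zero_eta, Fin.mk_one, Fin.reduceFinMk] <;>
      first
      | rfl
      | linear_combination h0
      | linear_combination h1
      | linear_combination h2
      | linear_combination -h0
      | linear_combination -h1
      | linear_combination -h2
  refine mul_left_cancel₀ (mul_ne_zero hc hc) ?_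
  linear_combination (n c * s j) * key r hvr hwr c i + (n i * r c) * key s hvs hws c j -
    (n c * s i) * key r hvr hwr c j - (n j * r c) * key s hvs hws c i

theorem sum_mul_sum_mul_eq_zero_of_symmetric {σ A : Type*} [Fintype σ] [CommRing A]
    (v : σ → A) (H dv : σ → σ → A) (T : σ → σ → σ → A) (hH : ∀ i j, H i j = H j i)
    (hT : ∀ i j k, T i j k = T k j i) (hv : ∀ k, ∑ j, v j * H j k = 0)
    (hdv : ∀ i k, ∑ j, (dv i j * H j k + v j * T i j k) = 0) (k : σ) :
    ∑ j, (∑ i, v i * dv i j) * H j k = 0 := by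
  have hthird : ∑ i, ∑ j, v i * (v j * T k j i) = 0 := by
    have h1 : ∑ i, v i * ∑ j, (dv k j * H j i + v j * T k j i) = 0 := by
      simp only [hdv, mul_zero, Finset.sum_const_zero]
    have h2 : ∑ j, dv k j * ∑ i, v i * H i j = 0 := by
      simp only [hv, mul_zero, Finset.sum_const_zero]
    simp only [Finset.mul_sum, mul_add, Finset.sum_add_distrib] at h1 h2
    have h3 : ∑ i, ∑ j, v i * (dv k j * H j i) = 0 := by
      refine Eq.trans (Finset.sum_comm.trans ?_) h2
      refine Finset.sum_congr rfl fun j _ => Finset.sum_congr rfl fun i _ => ?_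
      rw [hH j i]
      ring
    linear_combination h1 - h3
  have h3 : ∑ i, v i * ∑ j, (dv i j * H j k + v j * T i j k) = 0 := by
    simp only [hdv, mul_zero, Finset.sum_const_zero]
  simp only [Finset.mul_sum, mul_add, Finset.sum_add_distrib] at h3
  have h4 : ∑ i, ∑ j, v i * (v j * T i j k) = 0 := by
    refine Eq.trans ?_ hthird
    exact Finset.sum_congr rfl fun i _ => Finset.sum_congr rfl fun j _ => by rw [hT i j k]
  have h5 : ∑ j, (∑ i, v i * dv i j) * H j k = ∑ i, ∑ j, v i * (dv i j * H j k) := by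
    rw [Finset.sum_comm]
    refine Finset.sum_congr rfl fun j _ => ?_
    rw [Finset.sum_mul]
    exact Finset.sum_congr rfl fun i _ => mul_assoc _ _ _
  rw [h5]
  linear_combination h3 - h4

/-- The derivative of a kernel vector of the Hessian along itself is again in the kernel. -/
theorem MvPolynomial.sum_kernel_deriv_mul_hessian {σ R : Type*} [Fintype σ] [CommRing R]
    (f : MvPolynomial σ R) (v : σ → MvPolynomial σ R)
    (hv : ∀ k, ∑ j, v j * pderiv j (pderiv k f) = 0) (k : σ) :
    ∑ j, (∑ i, v i * pderiv i (v j)) * pderiv j (pderiv k f) = 0 := by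
  refine sum_mul_sum_mul_eq_zero_of_symmetric v (fun j k => pderiv j (pderiv k f))
    (fun i j => pderiv i (v j)) (fun i j k => pderiv i (pderiv j (pderiv k f)))
    (fun i j => pderiv_comm_s2 i j f) (fun i j k => ?_) hv (fun i k => ?_) k
  · rw [pderiv_comm_s2 j k f, pderiv_comm_s2 i k, pderiv_comm_s2 i j f]
  · have h := congrArg (pderiv i) (hv k)
    rw [map_sum, map_zero] at h
    rw [← h]
    exact Finset.sum_congr rfl fun j _ => by rw [pderiv_mul]

/-- A ternary form with zero Hessian has a nonzero polynomial vector field with straight integral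
curves along which the partial derivatives are constant. -/
theorem MvPolynomial.exists_straight_field {K : Type*} [Field K] [CharZero K]
    (f : MvPolynomial (Fin 3) K) {m : ℕ} (hm : m ≠ 0) (hF : ∀ i, (pderiv i f).IsHomogeneous m)
    (hne : ¬ (pderiv 0 f = 0 ∧ pderiv 1 f = 0))
    (hHess : (Matrix.of fun i j : Fin 3 => pderiv i (pderiv j f)).det = 0) :
    ∃ h : Fin 3 → MvPolynomial (Fin 3) K, h ≠ 0 ∧
      (∀ k, ∑ j, h j * pderiv j (pderiv k f) = 0) ∧
      ∃ a b, a ≠ 0 ∧ ∀ i, a * (∑ j, h j * pderiv j (h i)) = b * h i := by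
  obtain ⟨v, hv0, hv⟩ := Matrix.exists_vecMul_eq_zero_iff.2 hHess
  replace hv : ∀ k, ∑ j, v j * pderiv j (pderiv k f) = 0 := fun k => congrFun hv k
  have hw := MvPolynomial.sum_kernel_deriv_mul_hessian f v hv
  set w : Fin 3 → MvPolynomial (Fin 3) K := fun j => ∑ i, v i * pderiv i (v j)
  by_cases hcr : ∀ a b, v a * w b = v b * w a
  · obtain ⟨a, ha⟩ := Function.ne_iff.1 hv0
    exact ⟨v, hv0, hv, v a, w a, ha, fun i => (hcr a i).trans (mul_comm _ _)⟩
  push Not at hcr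
  obtain ⟨a, b, hab⟩ := hcr
  have hminor : ∀ k l i j, pderiv i (pderiv k f) * pderiv j (pderiv l f) =
      pderiv j (pderiv k f) * pderiv i (pderiv l f) := fun k l =>
    mul_eq_mul_of_orthogonal_of_cross_ne_zero hab (r := fun i => pderiv i (pderiv k f))
      (s := fun i => pderiv i (pderiv l f)) (hv k) (hw k) (hv l) (hw l)
  have hker : ∀ k, pderiv 1 f * pderiv 0 (pderiv k f) - pderiv 0 f * pderiv 1 (pderiv k f) = 0 := by
    intro k
    have e0 := (hF 0).sum_X_mul_pderiv
    have e1 := (hF 1).sum_X_mul_pderiv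
    rw [Fin.sum_univ_three, nsmul_eq_mul] at e0 e1
    have hm' : (m : MvPolynomial (Fin 3) K) ≠ 0 := by exact_mod_cast hm
    refine (mul_eq_zero.1 (?_ : (m : MvPolynomial (Fin 3) K) * _ = 0)).resolve_left hm'
    have h0 := hminor 0 k 1 0
    have h1 := hminor 1 k 1 0
    have h2 := hminor 2 k 1 0
    rw [pderiv_comm_s2 0 1 f] at e1 h1
    rw [pderiv_comm_s2 1 2 f, pderiv_comm_s2 0 2 f] at h2
    linear_combination (-pderiv 0 (pderiv k f)) * e1 + pderiv 1 (pderiv k f) * e0 + X 0 * h0 +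
      X 1 * h1 + X 2 * h2
  refine ⟨![pderiv 1 f, -pderiv 0 f, 0], fun h => hne ?_, fun k => ?_, 1, 0, one_ne_zero,
    fun i => ?_⟩
  · have h0 := congrFun h 0
    have h1 := congrFun h 1
    simp at h0 h1
    exact ⟨h1, h0⟩
  · rw [Fin.sum_univ_three]
    simp only [Matrix.cons_val]
    linear_combination hker k
  · rw [Fin.sum_univ_three]
    fin_cases i
    · simp only [Matrix.cons_val, Fin.zero_eta]
      linear_combination hker 1
    · simp only [Matrix.cons_val, Fin.mk_one, map_neg]
      linear_combination -hker 0
    · simp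

theorem exists_ne_zero_orthogonal {K : Type*} [Field K] (c : Fin 3 → K) :
    ∃ a : Fin 3 → K, a ≠ 0 ∧ ∑ i, a i * c i = 0 := by
  by_cases h : c 0 = 0
  · exact ⟨![1, 0, 0], fun h => by simpa using congrFun h 0, by simp [Fin.sum_univ_three, h]⟩
  · refine ⟨![c 1, -c 0, 0], fun h' => h (by simpa using congrFun h' 1), ?_⟩
    simp [Fin.sum_univ_three]
    ring

theorem MvPolynomial.exists_sum_smul_pderiv_eq_zero {K : Type*} [Field K] [IsAlgClosed K]
    [CharZero K] (f : MvPolynomial (Fin 3) K) {m : ℕ} (hm : m ≠ 0)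
    (hF : ∀ i, (pderiv i f).IsHomogeneous m)
    (hHess : (Matrix.of fun i j : Fin 3 => pderiv i (pderiv j f)).det = 0) :
    ∃ a : Fin 3 → K, a ≠ 0 ∧ ∑ i, a i • pderiv i f = 0 := by
  by_cases hne : pderiv 0 f = 0 ∧ pderiv 1 f = 0
  · exact ⟨![1, 0, 0], fun h => by simpa using congrFun h 0,
      by simp [Fin.sum_univ_three, hne.1]⟩
  obtain ⟨h, hh0, hker, a, b, ha, hab⟩ := MvPolynomial.exists_straight_field f hm hF hne hHess
  let D : Derivation K (MvPolynomial (Fin 3) K) (MvPolynomial (Fin 3) K) :=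
    h 0 • pderiv 0 + h 1 • pderiv 1 + h 2 • pderiv 2
  have hDp : ∀ p, D p = ∑ j, h j * pderiv j p := fun p => by
    simp [D, Fin.sum_univ_three]
  have hDX : ∀ i, D (X i) = h i := fun i => by
    simp [hDp, pderiv_X, Pi.single_apply]
  have hline : ∀ i, aeval (fun i => Polynomial.C (X i) + Polynomial.C (h i) * Polynomial.X)
      (pderiv i f) = Polynomial.C (pderiv i f) := fun i =>
    MvPolynomial.aeval_line_eq_C h D hDX a b ha (fun i => by rw [hDp, hab]) _ (by rw [hDp, hker])
  have : NormalizedGCDMonoid (MvPolynomial (Fin 3) K) := Classical.arbitrary _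
  obtain ⟨u, hu, hgcd⟩ := Finset.univ.extract_gcd (fun i : Fin 3 => pderiv i f)
    Finset.univ_nonempty
  set G := Finset.univ.gcd (fun i : Fin 3 => pderiv i f) with hG
  replace hu : ∀ i, pderiv i f = G * u i := fun i => hu i (Finset.mem_univ i)
  obtain ⟨i₀, hi₀⟩ : ∃ i, pderiv i f ≠ 0 := by
    by_contra! h
    exact hne ⟨h 0, h 1⟩
  have hG0 : G ≠ 0 := fun h => hi₀ (by rw [hu, h, zero_mul])
  obtain ⟨g, hg⟩ : ∃ g, G.IsHomogeneous g :=
    IsHomogeneous.of_mul_left (by rw [← hu i₀]; exact hF i₀) (by rwa [← hu i₀])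
  have hui : ∀ i, (u i).IsHomogeneous (m - g) := by
    intro i
    by_cases hi : u i = 0
    · rw [hi]
      exact isHomogeneous_zero _ _ _
    have hGi : G * u i ≠ 0 := mul_ne_zero hG0 hi
    obtain ⟨k, hk⟩ : ∃ k, (u i).IsHomogeneous k :=
      IsHomogeneous.of_mul_left (v := G) (by rw [mul_comm, ← hu i]; exact hF i)
        (by rwa [mul_comm])
    have := (hg.mul hk).inj_right (hu i ▸ hF i) hGi
    rwa [← this, Nat.add_sub_cancel_left]
  by_cases he : m - g = 0
  · have hc : ∀ i, u i = C (coeff 0 (u i)) := fun i => by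
      have := hui i
      rw [he] at this
      exact totalDegree_eq_zero_iff_eq_C.1 (Nat.le_zero.1 this.totalDegree_le)
    obtain ⟨c, hc0, hc1⟩ := exists_ne_zero_orthogonal fun i => coeff 0 (u i)
    refine ⟨c, hc0, ?_⟩
    have : ∑ i, c i • pderiv i f = G * C (∑ i, c i * coeff 0 (u i)) := by
      rw [map_sum, Finset.mul_sum]
      refine Finset.sum_congr rfl fun i _ => ?_
      rw [hu i, smul_eq_C_mul, map_mul, ← hc i]
      ring
    rw [this, hc1, map_zero, mul_zero]
  have hzero : ∀ i, aeval h (u i) = 0 := by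
    intro i
    by_cases hi : u i = 0
    · rw [hi, map_zero]
    have hl := hline i
    rw [hu i, map_mul] at hl
    have hGi : G * u i ≠ 0 := mul_ne_zero hG0 hi
    have hne' : Polynomial.C (G * u i) ≠ 0 := Polynomial.C_ne_zero.2 hGi
    rw [← hl] at hne'
    have hdeg := congrArg Polynomial.natDegree hl
    rw [Polynomial.natDegree_mul (left_ne_zero_of_mul hne') (right_ne_zero_of_mul hne'),
      Polynomial.natDegree_C] at hdeg
    rw [← (hui i).coeff_aeval_line X h]
    exact Polynomial.coeff_eq_zero_of_natDegree_lt (by omega)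
  obtain ⟨c, s, hcs⟩ := MvPolynomial.exists_eq_C_smul_of_common_zero
    (L := FractionRing (MvPolynomial (Fin 3) K)) hui
    ⟨i₀, fun h => hi₀ (by rw [hu, h, mul_zero])⟩
    (fun p hp => by
      by_contra! hd
      refine hp.not_isUnit (isUnit_of_dvd_one ?_)
      rw [← hgcd]
      exact Finset.dvd_gcd fun i _ => hd i)
    (fun i => algebraMap _ _ (h i))
    (fun i => by
      have := aeval_algebraMap_apply (FractionRing (MvPolynomial (Fin 3) K)) h (u i)
      rw [hzero, map_zero] at this
      exact this)
  obtain ⟨l, hl⟩ := Function.ne_iff.1 hh0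
  have hl' : algebraMap _ (FractionRing (MvPolynomial (Fin 3) K)) (h l) ≠ 0 := fun h0 =>
    hl ((map_eq_zero_iff _ (IsFractionRing.injective _ _)).1 h0)
  have hs : s ≠ 0 := by
    rintro rfl
    exact hl' (by rw [hcs, mul_zero])
  refine ⟨c, fun hc => hl' (by rw [hcs, hc]; simp), ?_⟩
  have hk : ∀ k, pderiv k (∑ i, c i • pderiv i f) = 0 := by
    intro k
    apply IsFractionRing.injective (MvPolynomial (Fin 3) K)
      (FractionRing (MvPolynomial (Fin 3) K))
    refine mul_left_cancel₀ hs ?_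
    have := congrArg (algebraMap _ (FractionRing (MvPolynomial (Fin 3) K))) (hker k)
    rw [map_zero, map_sum] at this
    rw [map_zero, mul_zero, ← this, map_sum, map_sum, Finset.mul_sum]
    refine Finset.sum_congr rfl fun i _ => ?_
    rw [map_mul, hcs, Derivation.map_smul, pderiv_comm_s2, smul_eq_C_mul, map_mul,
      IsScalarTower.algebraMap_apply K (MvPolynomial (Fin 3) K), algebraMap_eq]
    ring
  have hom : (∑ i, c i • pderiv i f).IsHomogeneous m :=
    IsHomogeneous.sum _ _ _ fun i _ => by rw [smul_eq_C_mul]; exact (hF i).C_mul _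
  have e := hom.sum_X_mul_pderiv
  simp only [hk, mul_zero, Finset.sum_const_zero] at e
  exact (smul_eq_zero.1 e.symm).resolve_left hm

theorem Matrix.exists_isUnit_det_col {K : Type*} [Field K] (a : Fin 3 → K) (ha : a ≠ 0) :
    ∃ B : Matrix (Fin 3) (Fin 3) K, IsUnit B.det ∧ ∀ i, B i 2 = a i := by
  by_cases h2 : a 2 = 0
  · by_cases h1 : a 1 = 0
    · have h0 : a 0 ≠ 0 := fun h0 => ha (by ext i; fin_cases i <;> assumption)
      refine ⟨!![0, 0, a 0; 1, 0, a 1; 0, 1, a 2], ?_, fun i => by fin_cases i <;> rfl⟩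
      simpa [Matrix.det_fin_three] using h0
    · refine ⟨!![1, 0, a 0; 0, 0, a 1; 0, 1, a 2], ?_, fun i => by fin_cases i <;> rfl⟩
      simpa [Matrix.det_fin_three] using h1
  · refine ⟨!![1, 0, a 0; 0, 1, a 1; 0, 0, a 2], ?_, fun i => by fin_cases i <;> rfl⟩
    simpa [Matrix.det_fin_three] using h2

theorem MvPolynomial.pderiv_bind₁ {σ τ R : Type*} [Fintype σ] [CommRing R]
    (g : σ → MvPolynomial τ R) (k : τ) (p : MvPolynomial σ R) :
    pderiv k (bind₁ g p) = ∑ i, bind₁ g (pderiv i p) * pderiv k (g i) := by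
  classical
  induction p using MvPolynomial.induction_on with
  | C r => simp
  | add p q hp hq => simp only [map_add, add_mul, Finset.sum_add_distrib, hp, hq]
  | mul_X p j hp =>
    rw [map_mul, bind₁_X_right, pderiv_mul, hp]
    simp only [pderiv_mul, map_add, map_mul, bind₁_X_right, add_mul, Finset.sum_add_distrib,
      pderiv_X, Pi.single_apply, Finset.sum_mul]
    congr 1
    · exact Finset.sum_congr rfl fun i _ => by ring
    · rw [Finset.sum_eq_single j]
      · simp
      · intro i _ hi
        simp [hi.symm]
      · simp

/-- A ternary form of degree at least `2` with identically vanishing Hessian determinant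
has linearly dependent partial derivatives; equivalently, a variable can be eliminated
from it by an (invertible) linear transformation of the variables. -/
theorem ternary_form_with_zero_hessian
    {K : Type*} [Field K] [IsAlgClosed K] [CharZero K]
    (f : MvPolynomial (Fin 3) K) (d : ℕ) (hd : 2 ≤ d) (hf : f.IsHomogeneous d)
    (hHess : (Matrix.of fun i j : Fin 3 => pderiv i (pderiv j f)).det = 0) :
    (∃ a : Fin 3 → K, a ≠ 0 ∧ ∑ i, a i • pderiv i f = 0) ∧
    ∃ (A : Matrix (Fin 3) (Fin 3) K) (f' : MvPolynomial (Fin 3) K),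
      IsUnit A.det ∧
      bind₁ (fun i : Fin 3 => ∑ j : Fin 3, C (A i j) * X j) f' = f ∧
      pderiv 2 f' = 0 := by
  obtain ⟨a, ha, haf⟩ := MvPolynomial.exists_sum_smul_pderiv_eq_zero f (m := d - 1) (by omega)
    (fun i => hf.pderiv) hHess
  refine ⟨⟨a, ha, haf⟩, ?_⟩
  obtain ⟨B, hB, hBa⟩ := Matrix.exists_isUnit_det_col a ha
  refine ⟨B⁻¹, bind₁ (fun i => ∑ j, C (B i j) * X j) f, B.isUnit_nonsing_inv_det hB, ?_, ?_⟩
  · have hid : (fun i : Fin 3 => bind₁ (fun i : Fin 3 => ∑ j : Fin 3, C (B⁻¹ i j) * X j)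
        (∑ j, C (B i j) * X j)) = (X : Fin 3 → MvPolynomial (Fin 3) K) := by
      ext1 i
      have hBB : ∀ k, ∑ j, B i j * B⁻¹ j k = (1 : Matrix (Fin 3) (Fin 3) K) i k := fun k => by
        rw [← B.mul_nonsing_inv hB, Matrix.mul_apply]
      simp only [map_sum, map_mul, bind₁_C_right, bind₁_X_right, Finset.mul_sum]
      rw [Finset.sum_comm]
      simp only [← mul_assoc, ← Finset.sum_mul, ← C_mul, ← map_sum, hBB, Matrix.one_apply]
      simp
    rw [bind₁_bind₁, hid]
    simp
  · rw [MvPolynomial.pderiv_bind₁]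
    have hcol : ∀ i, pderiv 2 (∑ j, C (B i j) * X j : MvPolynomial (Fin 3) K) = C (a i) := by
      intro i
      simp [pderiv_X, Pi.single_apply, hBa]
    have := congrArg (bind₁ fun i => ∑ j, C (B i j) * X j) haf
    rw [map_sum, map_zero] at this
    rw [← this]
    refine Finset.sum_congr rfl fun i _ => ?_
    rw [hcol, smul_eq_C_mul, map_mul, bind₁_C_right, mul_comm]
end

section
/- Let f ∈ K[x₁,x₂,x₃,x₄] be a homogeneous polynomial of degree ≥ 2 with zero Hessian. Then a variable can be eliminated from f by a linear transformation of the variables: the partial derivatives ∂f/∂x₁, ∂f/∂x₂, ∂f/∂x₃, ∂f/∂x₄ are linearly dependent over K; equivalently, there exists an invertible matrix A ∈ GL(4,K) such that the polynomial f′ defined by f′(Ax) = f(x) satisfies ∂f′/∂x₄ = 0. -/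
open MvPolynomial

namespace ZeroHessian

section Derivations

variable {K σ : Type*} [Field K]

/-- The derivation `∑ i, h i * ∂/∂x_i`, that is, the vector field with components `h`. -/
noncomputable def vectorField (h : σ → MvPolynomial σ K) :
    Derivation K (MvPolynomial σ K) (MvPolynomial σ K) :=
  mkDerivation K h

theorem vectorField_X (h : σ → MvPolynomial σ K) (i : σ) : vectorField h (X i) = h i :=
  mkDerivation_X K h i

theorem derivation_aeval [Fintype σ] {A : Type*} [CommRing A] [Algebra K A] (D : Derivation K A A)
    (F : σ → A) (G : MvPolynomial σ K) :
    D (aeval F G) = ∑ i, aeval F (pderiv i G) * D (F i) := by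
  classical
  induction G using MvPolynomial.induction_on with
  | C c => simp
  | add p q hp hq => simp [hp, hq, add_mul, Finset.sum_add_distrib]
  | mul_X p i hp =>
    have key : ∀ j, aeval F (pderiv j (p * X i)) * D (F j) =
        F i * (aeval F (pderiv j p) * D (F j)) + if j = i then aeval F p * D (F i) else 0 := by
      intro j
      rw [Derivation.leibniz, pderiv_X]
      rcases eq_or_ne j i with rfl | hj
      · simp; ring
      · simp [hj, hj.symm]; ring
    rw [Finset.sum_congr rfl fun j _ => key j, Finset.sum_add_distrib, ← Finset.mul_sum, ← hp]
    simp
    ring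

theorem vectorField_apply [Fintype σ] (h : σ → MvPolynomial σ K) (a : MvPolynomial σ K) :
    vectorField h a = ∑ i, h i * pderiv i a := by
  conv_lhs => rw [← aeval_X_left_apply a, derivation_aeval]
  simp [vectorField_X, mul_comm]

theorem derivation_aeval_eq_zero [Fintype σ] {A : Type*} [CommRing A] [Algebra K A]
    (D : Derivation K A A) (F : σ → A) (hF : ∀ i, D (F i) = 0) (G : MvPolynomial σ K) :
    D (aeval F G) = 0 := by
  rw [derivation_aeval]
  simp [hF]

/-- The substitution `x ↦ x + t h(x)`, as a polynomial in `t`. -/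
noncomputable def flow (h : σ → MvPolynomial σ K) :
    MvPolynomial σ K →ₐ[K] Polynomial (MvPolynomial σ K) :=
  aeval fun i => Polynomial.C (X i) + Polynomial.C (h i) * Polynomial.X

theorem flow_coeff_zero (h : σ → MvPolynomial σ K) (a : MvPolynomial σ K) :
    (flow h a).coeff 0 = a := by
  induction a using MvPolynomial.induction_on with
  | C c => simp [flow, Polynomial.algebraMap_apply, algebraMap_eq]
  | add p q hp hq => simp [hp, hq]
  | mul_X p i hp =>
    rw [map_mul, Polynomial.mul_coeff_zero, hp]
    simp [flow]

theorem flow_coeff_succ (h : σ → MvPolynomial σ K) (hh : ∀ i, vectorField h (h i) = 0)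
    (a : MvPolynomial σ K) (k : ℕ) :
    ((k : MvPolynomial σ K) + 1) * (flow h a).coeff (k + 1) =
      vectorField h ((flow h a).coeff k) := by
  induction a using MvPolynomial.induction_on generalizing k with
  | C c =>
    rcases k with _ | k <;>
    simp [flow, Polynomial.algebraMap_apply, algebraMap_eq, Polynomial.coeff_C]
  | add p q hp hq => simp [mul_add, hp, hq]
  | mul_X p i hp =>
    have key : flow h (p * X i) =
        flow h p * Polynomial.C (X i) + flow h p * Polynomial.C (h i) * Polynomial.X := by
      rw [map_mul]
      simp [flow, mul_add, mul_assoc]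
    rw [key]
    rcases k with _ | k
    · have := hp 0
      simp only [Polynomial.coeff_add, Polynomial.coeff_mul_C, Polynomial.coeff_mul_X,
        Polynomial.coeff_mul_X_zero, Derivation.leibniz, smul_eq_mul, vectorField_X, map_add,
        map_zero] at this ⊢
      push_cast at this ⊢
      linear_combination (X i) * this
    · have h1 := hp (k + 1)
      have h0 := hp k
      simp only [Polynomial.coeff_add, Polynomial.coeff_mul_C, Polynomial.coeff_mul_X,
        Derivation.leibniz, smul_eq_mul, vectorField_X, map_add, hh] at h0 h1 ⊢
      push_cast at h0 h1 ⊢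
      linear_combination (X i) * h1 + h i * h0

theorem flow_eq_C [CharZero K] (h : σ → MvPolynomial σ K) (hh : ∀ i, vectorField h (h i) = 0)
    {a : MvPolynomial σ K} (ha : vectorField h a = 0) : flow h a = Polynomial.C a := by
  ext1 k
  rcases k with _ | k
  · simp [flow_coeff_zero]
  · rw [Polynomial.coeff_C_succ]
    induction k with
    | zero =>
      have := flow_coeff_succ h hh a 0
      simpa [flow_coeff_zero, ha] using this
    | succ k ih =>
      have := flow_coeff_succ h hh a (k + 1)
      rw [ih, map_zero] at this
      refine (mul_eq_zero.mp this).resolve_left ?_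
      exact_mod_cast Nat.succ_ne_zero (k + 1)

/-- The kernel of the vector field `h` is factorially closed if `h` is constant along itself. -/
theorem vectorField_eq_zero_of_mul [CharZero K] (h : σ → MvPolynomial σ K)
    (hh : ∀ i, vectorField h (h i) = 0) {a b : MvPolynomial σ K} (hab : a * b ≠ 0)
    (hD : vectorField h (a * b) = 0) : vectorField h a = 0 := by
  have hfl := flow_eq_C h hh hD
  rw [map_mul] at hfl
  have hab' : flow h a * flow h b ≠ 0 := by
    rw [hfl]; simpa using hab
  have hdeg := congrArg Polynomial.natDegree hfl
  rw [Polynomial.natDegree_C, Polynomial.natDegree_mul (left_ne_zero_of_mul hab')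
    (right_ne_zero_of_mul hab')] at hdeg
  have h1 := flow_coeff_succ h hh a 0
  rw [flow_coeff_zero, Polynomial.coeff_eq_zero_of_natDegree_lt (by omega), mul_zero] at h1
  exact h1.symm

theorem eval_flow (h : σ → MvPolynomial σ K) (a : MvPolynomial σ K) (z : σ → K) (t : K) :
    eval z ((flow h a).eval (C t)) = eval (fun i => z i + t * eval z (h i)) a := by
  induction a using MvPolynomial.induction_on with
  | C c => simp [flow, Polynomial.algebraMap_apply, algebraMap_eq]
  | add p q hp hq => simp [hp, hq]
  | mul_X p i hp =>
    rw [map_mul, Polynomial.eval_mul, map_mul, hp]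
    simp [flow, mul_comm t]

theorem eval_add_smul_of_vectorField_eq_zero [CharZero K] (h : σ → MvPolynomial σ K)
    (hh : ∀ i, vectorField h (h i) = 0) {a : MvPolynomial σ K} (ha : vectorField h a = 0)
    (z : σ → K) (t : K) :
    eval (fun i => z i + t * eval z (h i)) a = eval z a := by
  rw [← eval_flow, flow_eq_C h hh ha, Polynomial.eval_C]

end Derivations

section Homogeneous

variable {K σ : Type*} [Field K]

theorem eval_smul_of_isHomogeneous {R : MvPolynomial σ K} {n : ℕ} (hR : R.IsHomogeneous n)
    {L : Type*} [CommRing L] [Algebra K L] (c : L) (v : σ → L) :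
    aeval (fun i => c * v i) R = c ^ n * aeval v R := by
  rw [aeval_def, aeval_def, eval₂_eq, eval₂_eq, Finset.mul_sum]
  refine Finset.sum_congr rfl fun d hd => ?_
  rw [Finset.prod_congr rfl fun i _ => mul_pow c (v i) (d i), Finset.prod_mul_distrib,
    Finset.prod_pow_eq_pow_sum, hR.degree_eq_sum_deg_support hd]
  ring

/-- The substitution `x ↦ t x`, as a polynomial in `t`. -/
noncomputable def scaling : MvPolynomial σ K →ₐ[K] Polynomial (MvPolynomial σ K) :=
  aeval fun i => Polynomial.X * Polynomial.C (X i)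

theorem coeff_scaling (a : MvPolynomial σ K) (k : ℕ) :
    (scaling a).coeff k = homogeneousComponent k a := by
  have h : ∀ n, scaling (homogeneousComponent n a) =
      Polynomial.X ^ n * Polynomial.C (homogeneousComponent n a) := by
    intro n
    rw [scaling, eval_smul_of_isHomogeneous (homogeneousComponent_isHomogeneous n a)]
    congr 1
    have := comp_aeval_apply (R := K) (fun i => (X i : MvPolynomial σ K))
      (Polynomial.CAlgHom (R := K) (A := MvPolynomial σ K)) (homogeneousComponent n a)
    simpa using this.symm
  conv_lhs => rw [← sum_homogeneousComponent a]
  rw [map_sum, Finset.sum_congr rfl fun n _ => h n, Polynomial.finsetSum_coeff]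
  simp only [Polynomial.coeff_X_pow_mul', Polynomial.coeff_C]
  by_cases hk : k ∈ Finset.range (a.totalDegree + 1)
  · rw [Finset.sum_eq_single k]
    · simp
    · intro b _ hb
      split_ifs with h1 h2
      · omega
      · rfl
      · rfl
    · exact fun hk' => absurd hk hk'
  · rw [homogeneousComponent_eq_zero _ _ (by simpa using hk)]
    refine Finset.sum_eq_zero fun b hb => ?_
    split_ifs with h1 h2
    · simp at hb hk; omega
    · rfl
    · rfl

theorem isHomogeneous_of_mul {a b : MvPolynomial σ K} {n : ℕ} (hab : a * b ≠ 0)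
    (h : (a * b).IsHomogeneous n) : ∃ k, a.IsHomogeneous k := by
  have hne : ∀ c : MvPolynomial σ K, c ≠ 0 → scaling c ≠ 0 := by
    intro c hc h0
    apply hc
    rw [← sum_homogeneousComponent c]
    refine Finset.sum_eq_zero fun k _ => ?_
    rw [← coeff_scaling, h0, Polynomial.coeff_zero]
  have ha := hne a (left_ne_zero_of_mul hab)
  have hb := hne b (right_ne_zero_of_mul hab)
  have hmon : scaling a * scaling b = Polynomial.C (a * b) * Polynomial.X ^ n := by
    rw [← map_mul]
    ext1 k
    rw [coeff_scaling, Polynomial.coeff_C_mul_X_pow, homogeneousComponent_of_mem h]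
  have h1 := congrArg Polynomial.natDegree hmon
  have h2 := congrArg Polynomial.natTrailingDegree hmon
  rw [Polynomial.natDegree_mul ha hb, Polynomial.natDegree_C_mul_X_pow _ _ hab] at h1
  rw [Polynomial.natTrailingDegree_mul ha hb, Polynomial.C_mul_X_pow_eq_monomial,
    Polynomial.natTrailingDegree_monomial hab] at h2
  have h3 := (scaling a).natTrailingDegree_le_natDegree
  have h4 := (scaling b).natTrailingDegree_le_natDegree
  refine ⟨(scaling a).natDegree, ?_⟩
  have : homogeneousComponent (scaling a).natDegree a = a := by
    conv_rhs => rw [← sum_homogeneousComponent a]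
    have hz : ∀ k, k ≠ (scaling a).natDegree → homogeneousComponent k a = 0 := by
      intro k hk
      rw [← coeff_scaling]
      rcases lt_or_gt_of_ne hk with hk | hk
      · exact Polynomial.coeff_eq_zero_of_lt_natTrailingDegree (by omega)
      · exact Polynomial.coeff_eq_zero_of_natDegree_lt hk
    refine (Finset.sum_eq_single _ (fun k _ hk => hz k hk) fun hk => ?_).symm
    exact homogeneousComponent_eq_zero _ _ (by simpa using hk)
  have hk := homogeneousComponent_isHomogeneous (scaling a).natDegree a
  rwa [this] at hk

theorem isHomogeneous_of_dvd {a b : MvPolynomial σ K} {n : ℕ} (hb : b ≠ 0)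
    (h : b.IsHomogeneous n) (hab : a ∣ b) : ∃ k, a.IsHomogeneous k := by
  obtain ⟨c, rfl⟩ := hab
  exact isHomogeneous_of_mul hb h

/-- An algebraic relation between forms of the same positive degree yields a homogeneous one. -/
theorem exists_homogeneous_relation {τ : Type*} {F : τ → MvPolynomial σ K} {n : ℕ} (hn : n ≠ 0)
    (hF : ∀ i, (F i).IsHomogeneous n) (h : ¬ AlgebraicIndependent K F) :
    ∃ (e : ℕ) (G : MvPolynomial τ K), G ≠ 0 ∧ G.IsHomogeneous e ∧ aeval F G = 0 := by
  rw [algebraicIndependent_iff] at h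
  push Not at h
  obtain ⟨G, hG, hG0⟩ := h
  obtain ⟨e, he⟩ : ∃ e, homogeneousComponent e G ≠ 0 := by
    by_contra! hc
    apply hG0
    rw [← sum_homogeneousComponent G]
    exact Finset.sum_eq_zero fun k _ => hc k
  refine ⟨e, homogeneousComponent e G, he, homogeneousComponent_isHomogeneous e G, ?_⟩
  have hhom : ∀ k, (aeval F (homogeneousComponent k G)).IsHomogeneous (n * k) := fun k =>
    (homogeneousComponent_isHomogeneous k G).aeval F hF
  have h1 : homogeneousComponent (n * e) (aeval F G) = aeval F (homogeneousComponent e G) := by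
    conv_lhs => rw [← sum_homogeneousComponent G]
    rw [map_sum, map_sum, Finset.sum_eq_single e]
    · rw [homogeneousComponent_of_mem (hhom e), if_pos rfl]
    · intro k _ hk
      rw [homogeneousComponent_of_mem (hhom k), if_neg]
      intro h
      exact hk (Nat.eq_of_mul_eq_mul_left (Nat.pos_of_ne_zero hn) h).symm
    · intro he'
      exact absurd (homogeneousComponent_eq_zero _ _ (by simpa using he')) he
  rw [← h1, hG, map_zero]

end Homogeneous

section AlgebraicIndependence

variable {K : Type*} [Field K]

theorem derivation_eq_zero_of_isAlgebraic {S A : Type*} [CommRing S] [IsDomain S] [CharZero S]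
    [CommRing A] [IsDomain A] [Algebra S A] [FaithfulSMul S A]
    (D : Derivation S A A) {x : A} (hx : IsAlgebraic S x) : D x = 0 := by
  classical
  have hex : ∃ n, ∃ p : Polynomial S, p ≠ 0 ∧ Polynomial.aeval x p = 0 ∧ p.natDegree = n := by
    obtain ⟨p, hp, hp'⟩ := hx
    exact ⟨_, p, hp, hp', rfl⟩
  obtain ⟨p, hp0, hpx, hpn⟩ := Nat.find_spec hex
  have hD := D.map_aeval p x
  rw [hpx, map_zero, smul_eq_mul, eq_comm, mul_eq_zero] at hD
  refine hD.resolve_left fun hd => ?_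
  have hdeg : p.natDegree ≠ 0 := by
    intro h0
    rw [Polynomial.eq_C_of_natDegree_eq_zero h0, Polynomial.aeval_C,
      FaithfulSMul.algebraMap_eq_zero_iff] at hpx
    apply hp0
    rw [Polynomial.eq_C_of_natDegree_eq_zero h0, hpx, map_zero]
  have hp' : Polynomial.derivative p ≠ 0 := fun h0 =>
    hdeg (Polynomial.derivative_eq_zero.mp h0)
  exact Nat.find_min hex (hpn ▸ Polynomial.natDegree_derivative_lt hdeg) ⟨_, hp', hd, rfl⟩

theorem isAlgebraic_adjoin_of_algebraicIndependent {ι σ : Type} [Fintype ι] [Fintype σ]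
    (hc : Fintype.card σ ≤ Fintype.card ι) {F : ι → MvPolynomial σ K}
    (h : AlgebraicIndependent K F) :
    Algebra.IsAlgebraic (Algebra.adjoin K (Set.range F)) (MvPolynomial σ K) := by
  have : IsTranscendenceBasis K F := by
    refine h.isTranscendenceBasis_of_lift_trdeg_le_of_finite ?_
    rw [MvPolynomial.trdeg_of_isDomain]
    simpa using hc
  exact this.isAlgebraic

/-- The Jacobian criterion in characteristic zero. -/
theorem not_algebraicIndependent_of_jacobian_eq_zero [CharZero K] {σ : Type} [Fintype σ]
    [DecidableEq σ] (F : σ → MvPolynomial σ K)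
    (hdet : (Matrix.of fun i j => pderiv i (F j)).det = 0) : ¬ AlgebraicIndependent K F := by
  intro hF
  obtain ⟨v, hv0, hv⟩ := Matrix.exists_vecMul_eq_zero_iff.mpr hdet
  have hD : ∀ j, vectorField v (F j) = 0 := by
    intro j
    have := congrFun hv j
    rw [vectorField_apply]
    simpa [Matrix.vecMul, dotProduct] using this
  let S := Algebra.adjoin K (Set.range F)
  have hS : ∀ s : S, vectorField v (s : MvPolynomial σ K) = 0 := by
    rintro ⟨s, hs⟩
    change s ∈ Algebra.adjoin K (Set.range F) at hs
    rw [Algebra.adjoin_range_eq_range_aeval] at hs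
    obtain ⟨G, rfl⟩ := hs
    exact derivation_aeval_eq_zero _ _ hD G
  have := isAlgebraic_adjoin_of_algebraicIndependent le_rfl hF
  let D : Derivation S (MvPolynomial σ K) (MvPolynomial σ K) :=
    Derivation.mk'
      { toFun := vectorField v
        map_add' := map_add _
        map_smul' := fun s a => by
          rw [Algebra.smul_def, Algebra.smul_def, Derivation.leibniz]
          have := hS s
          change (s : MvPolynomial σ K) • _ + a • (vectorField v (s : MvPolynomial σ K)) = _
          rw [this]
          simp }
      fun a b => (vectorField v).leibniz a b
  apply hv0
  ext1 i
  rw [← vectorField_X v i]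
  exact derivation_eq_zero_of_isAlgebraic D (Algebra.IsAlgebraic.isAlgebraic (X i))

theorem injective_of_algebraicIndependent_comp {ι A B : Type*} [CommRing A] [IsDomain A]
    [CommRing B] [Algebra K A] [Algebra K B] (Z : ι → A)
    [Algebra.IsAlgebraic (Algebra.adjoin K (Set.range Z)) A] (φ : A →ₐ[K] B)
    (h : AlgebraicIndependent K (φ ∘ Z)) : Function.Injective φ := by
  rw [injective_iff_map_eq_zero]
  intro r hr
  by_contra hr0
  obtain ⟨c, hc, hdvd⟩ := (Algebra.IsAlgebraic.isAlgebraic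
    (R := Algebra.adjoin K (Set.range Z)) r).exists_nonzero_dvd (mem_nonZeroDivisors_of_ne_zero hr0)
  obtain ⟨c, hcm⟩ := c
  rw [Algebra.adjoin_range_eq_range_aeval] at hcm
  obtain ⟨G, rfl⟩ := hcm
  obtain ⟨s, hs⟩ := hdvd
  have h1 : φ (aeval Z G) = 0 := by
    have : aeval Z G = r * s := hs
    rw [this, map_mul, hr, zero_mul]
  have hG : G = 0 :=
    algebraicIndependent_iff.mp h G ((comp_aeval_apply Z φ G).symm.trans h1)
  exact hc (Subtype.ext (by simp [hG]))

/-- If two elements without common factor are killed by a map to a domain, then the image has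
transcendence degree smaller by at least two. -/
theorem not_algebraicIndependent_of_map_eq_zero {ι σ : Type} [Fintype ι] [Fintype σ]
    (hc : Fintype.card σ ≤ Fintype.card ι + 1) {B : Type*} [CommRing B] [IsDomain B] [Algebra K B]
    (θ : MvPolynomial σ K →ₐ[K] B) {q r : MvPolynomial σ K} (hq : Prime q)
    (hθq : θ q = 0) (hθr : θ r = 0) (hqr : ¬ q ∣ r) (Y : ι → MvPolynomial σ K) :
    ¬ AlgebraicIndependent K (θ ∘ Y) := by
  intro hY
  let I : Ideal (MvPolynomial σ K) := Ideal.span {q}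
  have hI : I.IsPrime := (Ideal.span_singleton_prime hq.ne_zero).mpr hq
  let π : MvPolynomial σ K →ₐ[K] MvPolynomial σ K ⧸ I := Ideal.Quotient.mkₐ K I
  have hker : ∀ a ∈ I, θ a = 0 := by
    intro a ha
    obtain ⟨b, rfl⟩ := Ideal.mem_span_singleton'.mp ha
    rw [map_mul, hθq, mul_zero]
  let ψ : MvPolynomial σ K ⧸ I →ₐ[K] B := Ideal.Quotient.liftₐ I θ hker
  have hψ : ∀ a, ψ (π a) = θ a := fun a => Ideal.Quotient.liftₐ_apply I θ hker _
  have hYI : AlgebraicIndependent K (π ∘ Y) := by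
    apply AlgebraicIndependent.of_comp ψ
    convert hY using 1
    ext i
    exact hψ (Y i)
  have hdep : ∀ Z : Option ι → MvPolynomial σ K, ¬ AlgebraicIndependent K (π ∘ Z) := by
    intro Z hZ
    have hZ' : AlgebraicIndependent K Z := AlgebraicIndependent.of_comp π hZ
    have := isAlgebraic_adjoin_of_algebraicIndependent (by simpa using hc) hZ'
    have hinj := injective_of_algebraicIndependent_comp Z π hZ
    apply hq.ne_zero
    apply hinj
    rw [map_zero]
    exact Ideal.Quotient.eq_zero_iff_mem.mpr (Ideal.mem_span_singleton_self q)
  have halg : Algebra.IsAlgebraic (Algebra.adjoin K (Set.range (π ∘ Y)))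
      (MvPolynomial σ K ⧸ I) := by
    refine ⟨fun b => ?_⟩
    obtain ⟨b, rfl⟩ := Ideal.Quotient.mk_surjective b
    by_contra hb
    have := (hYI.option_iff_transcendental (π b)).mpr hb
    apply hdep fun o => o.elim b Y
    convert this using 1
    ext o
    cases o <;> rfl
  have hinj := injective_of_algebraicIndependent_comp (π ∘ Y) ψ (by
    convert hY using 1
    ext i
    exact hψ (Y i))
  have hr : π r = 0 := by
    apply hinj
    rw [hψ, hθr, map_zero]
  exact hqr (Ideal.mem_span_singleton.mp (Ideal.Quotient.eq_zero_iff_mem.mp hr))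

end AlgebraicIndependence

section Reduction

variable {K σ : Type*} [Field K]

theorem exists_primitive {A ι : Type*} [CommRing A] [IsDomain A] [UniqueFactorizationMonoid A]
    [Fintype ι] {h : ι → A} (hh : h ≠ 0) :
    ∃ (c : A) (g : ι → A), c ≠ 0 ∧ (∀ i, h i = c * g i) ∧ ∀ q, (∀ i, q ∣ g i) → IsUnit q := by
  classical
  let := UniqueFactorizationMonoid.strongNormalizationMonoid (α := A)
  let := UniqueFactorizationMonoid.toNormalizedGCDMonoid A
  obtain ⟨i, hi⟩ := Function.ne_iff.mp hh
  obtain ⟨g, hg, hg1⟩ := Finset.extract_gcd h ⟨i, Finset.mem_univ i⟩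
  refine ⟨_, g, ?_, fun i => hg i (Finset.mem_univ i), fun q hq => ?_⟩
  · intro h0
    apply hi
    rw [hg i (Finset.mem_univ i), h0, zero_mul, Pi.zero_apply]
  · exact isUnit_of_dvd_one (hg1 ▸ Finset.dvd_gcd fun i _ => hq i)

theorem pderiv_eq_zero_imp_isHomogeneous_zero [CharZero K] [Fintype σ] {a : MvPolynomial σ K}
    {n : ℕ} (ha : a.IsHomogeneous n) (ha0 : a ≠ 0) (h : ∀ i, pderiv i a = 0) : n = 0 := by
  have := ha.sum_X_mul_pderiv
  simp only [h, mul_zero, Finset.sum_const_zero] at this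
  by_contra hn
  exact ha0 ((smul_eq_zero.mp this.symm).resolve_left hn)

theorem pderiv_comm (i j : σ) (a : MvPolynomial σ K) :
    pderiv i (pderiv j a) = pderiv j (pderiv i a) := by
  classical
  have : ⁅pderiv (R := K) i, pderiv j⁆ =
      (0 : Derivation K (MvPolynomial σ K) (MvPolynomial σ K)) := by
    refine derivation_ext fun k => ?_
    simp [Derivation.commutator_apply, pderiv_X, Pi.single_apply, apply_ite]
  have := DFunLike.congr_fun this a
  rwa [Derivation.commutator_apply, Derivation.zero_apply, sub_eq_zero] at this

theorem exists_vectorField [CharZero K] {σ : Type} [Fintype σ] [DecidableEq σ]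
    {f : MvPolynomial σ K} {d : ℕ} (hd : 2 ≤ d) (hf : f.IsHomogeneous d)
    (hdet : (Matrix.of fun i j => pderiv i (pderiv j f)).det = 0) :
    ∃ (n : ℕ) (h : σ → MvPolynomial σ K), h ≠ 0 ∧ (∀ i, (h i).IsHomogeneous n) ∧
      (∀ i, vectorField h (h i) = 0) ∧ ∀ i, vectorField h (pderiv i f) = 0 := by
  have hex := exists_homogeneous_relation (n := d - 1) (by omega) (fun i => hf.pderiv (i := i))
    (not_algebraicIndependent_of_jacobian_eq_zero _ hdet)
  classical
  obtain ⟨G, hG0, hGh, hG⟩ := Nat.find_spec hex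
  have hmin := fun {e} => Nat.find_min hex (m := e)
  generalize Nat.find hex = e at hGh hmin
  have hD : ∀ i,
      vectorField (fun i => aeval (fun i => pderiv i f) (pderiv i G)) (pderiv i f) = 0 := by
    intro j
    rw [vectorField_apply, ← (pderiv j).map_zero, ← hG, derivation_aeval]
    refine Finset.sum_congr rfl fun i _ => ?_
    rw [pderiv_comm]
  refine ⟨(d - 1) * (e - 1), _, ?_, fun i => (hGh.pderiv).aeval _ fun i => hf.pderiv,
    fun i => derivation_aeval_eq_zero _ _ hD _, hD⟩
  intro h0
  have h0' := fun i => congrFun h0 i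
  simp only [Pi.zero_apply] at h0'
  rcases eq_or_ne e 0 with rfl | he
  · rw [← totalDegree_zero_iff_isHomogeneous, totalDegree_eq_zero_iff_eq_C] at hGh
    rw [hGh, aeval_C, algebraMap_eq, C_eq_zero] at hG
    rw [hG, C_0] at hGh
    exact hG0 hGh
  · refine he (pderiv_eq_zero_imp_isHomogeneous_zero hGh hG0 fun i => ?_)
    by_contra hi
    exact hmin (by omega) ⟨_, hi, hGh.pderiv, h0' i⟩

/-- The vector field `h` has components of degree `m` without common factor, which are constant
along the field. -/
structure IsReduced (h : σ → MvPolynomial σ K) (m : ℕ) : Prop where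
  isHomogeneous : ∀ i, (h i).IsHomogeneous m
  vectorField_eq_zero : ∀ i, vectorField h (h i) = 0
  isUnit : ∀ q, (∀ i, q ∣ h i) → IsUnit q

theorem exists_isReduced [CharZero K] [Fintype σ] {n : ℕ} {h : σ → MvPolynomial σ K} (hh : h ≠ 0)
    (hn : ∀ i, (h i).IsHomogeneous n) (hD : ∀ i, vectorField h (h i) = 0) :
    ∃ (m : ℕ) (g : σ → MvPolynomial σ K), IsReduced g m ∧
      ∀ a, vectorField h a = 0 → vectorField g a = 0 := by
  obtain ⟨c, g, hc, hg, hu⟩ := exists_primitive hh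
  have hcg : ∀ a, vectorField h a = 0 → vectorField g a = 0 := by
    intro a ha
    rw [vectorField_apply] at ha ⊢
    simp only [hg, mul_assoc] at ha
    rw [← Finset.mul_sum] at ha
    exact (mul_eq_zero.mp ha).resolve_left hc
  obtain ⟨i, hi⟩ := Function.ne_iff.mp hh
  obtain ⟨k, hk⟩ := isHomogeneous_of_mul (hg i ▸ hi) (hg i ▸ hn i)
  refine ⟨n - k, g, ⟨fun j => ?_, fun j => hcg _ ?_, hu⟩, hcg⟩
  · rcases eq_or_ne (g j) 0 with h0 | h0
    · rw [h0]; exact isHomogeneous_zero _ _ _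
    · have h1 : g j * c ≠ 0 := mul_ne_zero h0 hc
      have h2 : (g j * c).IsHomogeneous n := by rw [mul_comm, ← hg]; exact hn j
      obtain ⟨l, hl⟩ := isHomogeneous_of_mul h1 h2
      have := (hl.mul hk).inj_right h2 h1
      rwa [show n - k = l by omega]
  · rcases eq_or_ne (g j) 0 with h0 | h0
    · rw [h0, map_zero]
    · refine vectorField_eq_zero_of_mul h hD (b := c) (mul_ne_zero h0 hc) ?_
      rw [mul_comm, ← hg]; exact hD j

end Reduction

section Line

variable {K σ : Type*} [Field K]

/-- The restriction of a polynomial to the line `s ↦ s v + w`. -/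
noncomputable def line (v w : σ → K) : MvPolynomial σ K →ₐ[K] Polynomial K :=
  aeval fun i => Polynomial.C (v i) * Polynomial.X + Polynomial.C (w i)

theorem eval_line (v w : σ → K) (a : MvPolynomial σ K) (s : K) :
    (line v w a).eval s = eval (fun i => v i * s + w i) a := by
  induction a using MvPolynomial.induction_on with
  | C c => simp [line]
  | add p q hp hq => simp [hp, hq]
  | mul_X p i hp =>
    rw [map_mul, Polynomial.eval_mul, map_mul, hp]
    simp [line]

theorem eval_aeval {τ : Type*} (g : σ → MvPolynomial τ K) (a : MvPolynomial σ K) (z : τ → K) :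
    eval z (aeval g a) = eval (fun i => eval z (g i)) a := by
  have := comp_aeval_apply (R := K) g (aeval (R := K) z) a
  simpa [coe_aeval_eq_eval] using this

theorem aeval_eq_zero_of_vectorField_eq_zero [CharZero K] {h : σ → MvPolynomial σ K}
    (hh : ∀ i, vectorField h (h i) = 0) {a : MvPolynomial σ K} {n : ℕ} (hn : n ≠ 0)
    (ha : a.IsHomogeneous n) (hD : vectorField h a = 0) : aeval h a = 0 := by
  apply MvPolynomial.funext
  intro z
  rw [eval_aeval, map_zero]
  have h1 : line z (fun i => eval z (h i)) a = Polynomial.C (eval z a) * Polynomial.X ^ n := by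
    apply Polynomial.eq_of_infinite_eval_eq
    refine (Set.finite_singleton (0 : K)).infinite_compl.mono fun s hs => ?_
    have hs : s ≠ 0 := hs
    have h2 := eval_smul_of_isHomogeneous ha s fun i => z i + s⁻¹ * eval z (h i)
    rw [Set.mem_ofPred_eq, eval_line]
    rw [aeval_eq_eval, aeval_eq_eval] at h2
    rw [eval_add_smul_of_vectorField_eq_zero h hh hD] at h2
    rw [Polynomial.eval_mul, Polynomial.eval_C, Polynomial.eval_pow, Polynomial.eval_X, mul_comm,
      ← h2]
    congr 2
    ext i
    field_simp
  have h2 := congrArg (Polynomial.eval 0) h1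
  rw [eval_line] at h2
  simpa [hn] using h2

end Line

section Divisibility

variable {K σ : Type*} [Field K]

theorem exists_prime_dvd_map_eq_zero {A B : Type*} [CommRing A] [IsDomain A]
    [UniqueFactorizationMonoid A] [CommRing B] [IsDomain B] (φ : A →+* B) {a : A} (ha : a ≠ 0)
    (hφ : φ a = 0) : ∃ q, Prime q ∧ q ∣ a ∧ φ q = 0 := by
  obtain ⟨s, hs, hsa⟩ := UniqueFactorizationMonoid.exists_prime_factors a ha
  have h0 : (s.map φ).prod = 0 := by
    rw [Multiset.prod_hom]
    exact zero_dvd_iff.mp (hφ ▸ map_dvd φ hsa.symm.dvd)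
  obtain ⟨q, hq, hq0⟩ := Multiset.mem_map.mp (Multiset.prod_eq_zero_iff.mp h0)
  exact ⟨q, hs q hq, (Multiset.dvd_prod hq).trans hsa.dvd, hq0⟩

theorem dvd_aeval_sub_aeval {A : Type*} [CommRing A] [Algebra K A] {F G : σ → A} {q : A}
    (h : ∀ i, q ∣ F i - G i) (P : MvPolynomial σ K) : q ∣ aeval F P - aeval G P := by
  have hφ : ∀ x y : A, q ∣ x - y ↔
      Ideal.Quotient.mkₐ K (Ideal.span {q}) x = Ideal.Quotient.mkₐ K (Ideal.span {q}) y := by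
    intro x y
    rw [← Ideal.mem_span_singleton]
    exact Ideal.Quotient.eq.symm
  rw [hφ, comp_aeval_apply, comp_aeval_apply]
  congr 2
  ext i
  exact (hφ _ _).mp (h i)

theorem eq_zero_of_isHomogeneous_of_dvd {p q : MvPolynomial σ K} {n e : ℕ}
    (hp : p.IsHomogeneous n) (hq : q.IsHomogeneous e) (hne : n < e) (h : q ∣ p) : p = 0 := by
  by_contra hp0
  have hq0 : q ≠ 0 := fun h0 => hp0 (zero_dvd_iff.mp (h0 ▸ h))
  have := totalDegree_le_of_dvd_of_isDomain h hp0
  rw [hp.totalDegree hp0, hq.totalDegree hq0] at this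
  omega

theorem vectorField_C_eq_zero_of_dvd [Fintype σ] {q : MvPolynomial σ K} {e : ℕ}
    (hq : q.IsHomogeneous e) (τ : σ → K) (h : q ∣ vectorField (fun i => C (τ i)) q) :
    vectorField (fun i => C (τ i)) q = 0 := by
  rcases eq_or_ne e 0 with rfl | he
  · rw [← totalDegree_zero_iff_isHomogeneous, totalDegree_eq_zero_iff_eq_C] at hq
    rw [hq, ← algebraMap_eq, Derivation.map_algebraMap]
  · refine eq_zero_of_isHomogeneous_of_dvd (n := e - 1) ?_ hq (by omega) h
    rw [vectorField_apply]
    exact IsHomogeneous.sum _ _ _ fun i _ => hq.pderiv.C_mul _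

end Divisibility

section Vertex

variable {K σ : Type*} [Field K]

/-- `q` is a prime form that is a cone with vertex `τ`, such that `h` is a multiple of `τ` along
the zero set of `q`. -/
structure IsVertex (h : σ → MvPolynomial σ K) (b q : MvPolynomial σ K) (τ : σ → K) : Prop where
  prime : Prime q
  not_dvd : ¬ q ∣ b
  dvd : ∀ k, q ∣ h k - C (τ k) * b
  eval_add : ∀ z t, eval (fun i => z i + t * τ i) q = eval z q
  isHomogeneous : ∃ e, q.IsHomogeneous e

theorem exists_dvd_sub_C_mul [IsAlgClosed K] {q b p : MvPolynomial σ K} (hq : Prime q) {c t₀ : K}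
    (hqb : ¬ q ∣ b) {G : MvPolynomial (Fin 3) K} {e : ℕ} (hG : G.IsHomogeneous e)
    (hG0 : eval ![c, 1, t₀] G ≠ 0) (hGq : q ∣ aeval ![C c * b, b, p] G) :
    ∃ τ : K, q ∣ p - C τ * b := by
  have hI : (Ideal.span {q}).IsPrime := (Ideal.span_singleton_prime hq.ne_zero).mpr hq
  let L := FractionRing (MvPolynomial σ K ⧸ Ideal.span {q})
  let φ : MvPolynomial σ K →ₐ[K] L :=
    (IsScalarTower.toAlgHom K (MvPolynomial σ K ⧸ Ideal.span {q}) L).comp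
      (Ideal.Quotient.mkₐ K (Ideal.span {q}))
  have hφ : ∀ x, φ x = 0 ↔ q ∣ x := by
    intro x
    rw [← Ideal.mem_span_singleton, ← Ideal.Quotient.eq_zero_iff_mem]
    exact FaithfulSMul.algebraMap_eq_zero_iff (MvPolynomial σ K ⧸ Ideal.span {q}) L
  have hb : φ b ≠ 0 := fun h => hqb ((hφ b).mp h)
  have h1 : aeval ![algebraMap K L c, 1, φ p / φ b] G = 0 := by
    have h2 := eval_smul_of_isHomogeneous hG (φ b) ![algebraMap K L c, 1, φ p / φ b]
    have h3 : aeval (fun i => φ b * ![algebraMap K L c, 1, φ p / φ b] i) G = 0 := by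
      rw [← (hφ _).mpr hGq, comp_aeval_apply]
      congr 2
      ext i
      fin_cases i
      · simp [mul_comm, ← algebraMap_eq]
      · simp
      · simp [mul_div_cancel₀ _ hb]
    rw [h3] at h2
    exact (mul_eq_zero.mp h2.symm).resolve_left (pow_ne_zero _ hb)
  let P : Polynomial K := aeval ![Polynomial.C c, 1, Polynomial.X] G
  have hP0 : P ≠ 0 := by
    intro h0
    apply hG0
    have h2 : Polynomial.aeval t₀ P = 0 := by rw [h0, map_zero]
    rw [show P = _ from rfl, comp_aeval_apply] at h2
    rw [← h2, ← aeval_eq_eval]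
    congr 2
    ext i
    fin_cases i <;> simp
  have hP : Polynomial.aeval (φ p / φ b) P = 0 := by
    rw [← h1, show P = _ from rfl, comp_aeval_apply]
    congr 2
    ext i
    fin_cases i <;> simp
  have hφint : IsIntegral K (φ p / φ b) := IsAlgebraic.isIntegral ⟨P, hP0, hP⟩
  obtain ⟨τ, hτ⟩ := minpoly.mem_range_of_degree_eq_one K (φ p / φ b)
    (IsAlgClosed.degree_eq_one_of_irreducible K (minpoly.irreducible hφint))
  refine ⟨τ, (hφ _).mp ?_⟩
  rw [map_sub, map_mul, ← algebraMap_eq, AlgHom.commutes]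
  change algebraMap K L τ = _ at hτ
  rw [hτ, div_mul_cancel₀ _ hb, sub_self]

theorem finite_setOf_forall_eval_eq_zero [Infinite K] {G : MvPolynomial (Fin 3) K} {e : ℕ}
    (hG : G.IsHomogeneous e) (hG0 : G ≠ 0) :
    {c : K | ∀ t, eval ![c, 1, t] G = 0}.Finite := by
  obtain ⟨c₀, t₀, h0⟩ : ∃ c₀ t₀ : K, eval ![c₀, 1, t₀] G ≠ 0 := by
    by_contra! hc
    have h1 : G * X 1 = 0 := by
      apply MvPolynomial.funext
      intro z
      rw [map_mul, eval_X, map_zero]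
      rcases eq_or_ne (z 1) 0 with hz | hz
      · rw [hz, mul_zero]
      · have h2 := eval_smul_of_isHomogeneous hG (z 1) ![z 0 / z 1, 1, z 2 / z 1]
        rw [aeval_eq_eval, aeval_eq_eval, hc, mul_zero] at h2
        rw [← zero_mul (z 1), ← h2]
        congr 3
        ext i
        fin_cases i <;> simp [mul_div_cancel₀ _ hz]
    exact (mul_ne_zero hG0 (X_ne_zero 1)) h1
  have hl : ∀ c, (line ![1, 0, 0] ![0, 1, t₀] G).eval c = eval ![c, 1, t₀] G := by
    intro c
    rw [eval_line]
    congr 2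
    ext i
    fin_cases i <;> simp
  have hne : line ![1, 0, 0] ![0, 1, t₀] G ≠ 0 := by
    intro h
    rw [← hl, h] at h0
    simp at h0
  refine (Polynomial.finite_setOfPred_isRoot hne).subset fun c hc => ?_
  exact (hl c).trans (hc t₀)

/-- A member of a pencil of forms without common factor can be chosen to avoid the prime factors of
a given form. -/
theorem exists_linear_combination_coprime [Infinite K] [Finite σ] {ι : Type} [Fintype ι]
    {h : ι → MvPolynomial σ K}
    (hu : ∀ q, (∀ i, q ∣ h i) → IsUnit q) {a : MvPolynomial σ K} (ha : a ≠ 0) :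
    ∃ v : ι → K, ∀ q, Prime q → q ∣ a → ¬ q ∣ ∑ i, C (v i) * h i := by
  classical
  obtain ⟨s, hs, hsa⟩ := UniqueFactorizationMonoid.exists_prime_factors a ha
  let W : MvPolynomial σ K → Submodule K (ι → K) := fun q =>
    (((Ideal.span {q}).restrictScalars K).comap
      (Fintype.linearCombination K h))
  have hW : ∀ q v, v ∈ W q ↔ q ∣ ∑ i, C (v i) * h i := by
    intro q v
    simp [W, Fintype.linearCombination_apply, Ideal.mem_span_singleton, smul_eq_C_mul]
  have := Subspace.biUnion_ne_univ_of_top_notMem (s := s.toFinset.image W) (by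
    intro ht
    obtain ⟨q, hq, hqt⟩ := Finset.mem_image.mp ht
    apply (hs q (Multiset.mem_toFinset.mp hq)).not_isUnit
    refine hu q fun i => ?_
    have := (hW q (Pi.single i 1)).mp (hqt ▸ Submodule.mem_top)
    rw [Finset.sum_eq_single i] at this
    · simpa using this
    · intro j _ hj; simp [hj]
    · simp)
  obtain ⟨v, hv⟩ := (Set.ne_univ_iff_exists_notMem _).mp this
  refine ⟨v, fun q hq hqa hqv => hv ?_⟩
  obtain ⟨p, hp, hqp⟩ := hq.exists_mem_multiset_dvd (hqa.trans hsa.symm.dvd)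
  simp only [Set.mem_iUnion]
  refine ⟨W p, Finset.mem_image_of_mem _ (Multiset.mem_toFinset.mpr hp), ?_⟩
  rw [SetLike.mem_coe, hW]
  exact (hq.associated_of_dvd (hs p hp) hqp).symm.dvd.trans hqv

end Vertex

section Pencil

variable {K : Type*} [Field K]

theorem IsReduced.isVertex {σ : Type*} [Fintype σ] [CharZero K] {h : σ → MvPolynomial σ K} {m : ℕ}
    (hh : IsReduced h m) {b p q : MvPolynomial σ K} {n : ℕ} {τ : σ → K} (hq : Prime q)
    (hqb : ¬ q ∣ b) (hτ : ∀ k, q ∣ h k - C (τ k) * b) (hp : p.IsHomogeneous n) (hp0 : p ≠ 0)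
    (hD : vectorField h p = 0) (hqp : q ∣ p) : IsVertex h b q τ := by
  obtain ⟨e, he⟩ := isHomogeneous_of_dvd hp0 hp hqp
  refine ⟨hq, hqb, hτ, ?_, e, he⟩
  have hDq : vectorField h q = 0 := by
    obtain ⟨s, rfl⟩ := hqp
    exact vectorField_eq_zero_of_mul h hh.vectorField_eq_zero hp0 hD
  have h1 : q ∣ b * vectorField (fun i => C (τ i)) q := by
    have h2 : q ∣ ∑ k, (h k - C (τ k) * b) * pderiv k q :=
      Finset.dvd_sum fun k _ => (hτ k).mul_right _
    have h3 : ∑ k, (h k - C (τ k) * b) * pderiv k q =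
        vectorField h q - b * vectorField (fun i => C (τ i)) q := by
      rw [vectorField_apply, vectorField_apply, Finset.mul_sum, ← Finset.sum_sub_distrib]
      exact Finset.sum_congr rfl fun k _ => by ring
    rwa [h3, hDq, zero_sub, dvd_neg] at h2
  have h0 := vectorField_C_eq_zero_of_dvd he τ ((hq.dvd_or_dvd h1).resolve_left hqb)
  intro z t
  have := eval_add_smul_of_vectorField_eq_zero (fun i => C (τ i))
    (fun i => by rw [← algebraMap_eq, Derivation.map_algebraMap]) h0 z t
  simpa using this

/-- In the pencil spanned by `h i` and a linear combination `b` of the components of `h`, all prime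
factors of the members with parameter in `Λ` have a vertex. -/
structure IsPencil {σ : Type*} [Fintype σ] (h : σ → MvPolynomial σ K) (b : MvPolynomial σ K) (i : σ)
    (Λ : Set K) : Prop where
  exists_eq_sum : ∃ v : σ → K, b = ∑ j, C (v j) * h j
  infinite : Λ.Infinite
  zero_notMem : 0 ∉ Λ
  sub_ne_zero : ∀ c ∈ Λ, h i - C c * b ≠ 0
  exists_isVertex : ∀ c ∈ Λ, ∀ q, Prime q → q ∣ h i - C c * b → ∃ τ, IsVertex h b q τ ∧ τ i = c

theorem IsReduced.exists_isPencil [IsAlgClosed K] [CharZero K] {h : Fin 4 → MvPolynomial (Fin 4) K}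
    {m : ℕ} (hh : IsReduced h m) (hm : m ≠ 0) :
    ∃ b i Λ, IsPencil h b i Λ := by
  obtain ⟨i, hi⟩ : ∃ i, h i ≠ 0 := by
    by_contra! h0
    exact not_isUnit_zero (hh.isUnit 0 fun i => by rw [h0])
  obtain ⟨v, hv⟩ := exists_linear_combination_coprime hh.isUnit hi
  have hbm : (∑ j, C (v j) * h j).IsHomogeneous m :=
    IsHomogeneous.sum _ _ _ fun j _ => (hh.isHomogeneous j).C_mul _
  have hbD : vectorField h (∑ j, C (v j) * h j) = 0 := by
    rw [map_sum]
    refine Finset.sum_eq_zero fun j _ => ?_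
    rw [← smul_eq_C_mul, Derivation.map_smul, hh.vectorField_eq_zero, smul_zero]
  have hbX : aeval h (∑ j, C (v j) * X j) = ∑ j, C (v j) * h j := by
    simp [algebraMap_eq]
  obtain ⟨b, hb⟩ : ∃ b, b = ∑ j, C (v j) * h j := ⟨_, rfl⟩
  rw [← hb] at hbm hbD hbX
  simp only [← hb] at hv
  have haθ := aeval_eq_zero_of_vectorField_eq_zero hh.vectorField_eq_zero hm (hh.isHomogeneous i)
    (hh.vectorField_eq_zero i)
  have hbθ := aeval_eq_zero_of_vectorField_eq_zero hh.vectorField_eq_zero hm hbm hbD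
  obtain ⟨p, hp, hpa, hpθ⟩ := exists_prime_dvd_map_eq_zero (aeval (R := K) h).toRingHom hi haθ
  have hrel : ∀ k, ∃ (e : ℕ) (G : MvPolynomial (Fin 3) K), G ≠ 0 ∧ G.IsHomogeneous e ∧
      aeval ![h i, b, h k] G = 0 := by
    intro k
    have h1 := not_algebraicIndependent_of_map_eq_zero (ι := Fin 3) (by simp) (aeval (R := K) h) hp
      hpθ hbθ (hv p hp hpa) ![X i, ∑ j, C (v j) * X j, X k]
    refine exists_homogeneous_relation hm ?_ ?_
    · intro j
      fin_cases j
      exacts [hh.isHomogeneous i, hbm, hh.isHomogeneous k]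
    · convert h1 using 2
      ext1 j
      fin_cases j <;> simp [← hbX]
  choose e G hG0 hGh hG using hrel
  have hsub : ∀ c, c ≠ 0 → h i - C c * b ≠ 0 := by
    intro c hc h0
    apply hv p hp hpa
    have h1 : p ∣ C c * b := (sub_eq_zero.mp h0) ▸ hpa
    exact ((hc.isUnit.map C).dvd_mul_left).mp h1
  refine ⟨b, i, ({0} ∪ ⋃ k, {c : K | ∀ t, eval ![c, 1, t] (G k) = 0})ᶜ, ⟨v, hb⟩, ?_, ?_, ?_, ?_⟩
  · exact ((Set.finite_singleton 0).union (Set.finite_iUnion fun k =>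
      finite_setOf_forall_eval_eq_zero (hGh k) (hG0 k))).infinite_compl
  · simp
  · intro c hc
    simp at hc
    exact hsub c hc.1
  · intro c hc q hq hqc
    simp at hc
    obtain ⟨hc0, ht⟩ := hc
    have hqb : ¬ q ∣ b := fun hqb =>
      hv q hq ((dvd_sub_left (hqb.mul_left _)).mp hqc) hqb
    have hτ : ∀ k, ∃ τ, q ∣ h k - C τ * b := by
      intro k
      obtain ⟨t, ht⟩ := ht k
      refine exists_dvd_sub_C_mul hq hqb (hGh k) ht ?_
      rw [← dvd_sub_right (a := q) (b := aeval ![h i, b, h k] (G k)) (by rw [hG]; exact dvd_zero _)]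
      refine dvd_aeval_sub_aeval (fun j => ?_) _
      fin_cases j <;> simp [hqc]
    choose τ hτ using hτ
    refine ⟨τ, hh.isVertex hq hqb hτ (n := m) ((hh.isHomogeneous i).sub (hbm.C_mul c)) (hsub c hc0)
      ?_ hqc, ?_⟩
    · rw [map_sub, ← smul_eq_C_mul, Derivation.map_smul, hbD, hh.vectorField_eq_zero,
        smul_zero, sub_zero]
    · by_contra hne
      apply hqb
      have h1 : q ∣ C (τ i - c) * b := by
        rw [← dvd_neg]
        convert (dvd_sub (hτ i) hqc) using 1
        rw [C_sub]; ring
      exact (((sub_ne_zero.mpr hne).isUnit.map C).dvd_mul_left).mp h1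

end Pencil

section Vertices

variable {K σ : Type*} [Field K] {h : σ → MvPolynomial σ K} {b q q' : MvPolynomial σ K}
  {τ τ' : σ → K}

theorem IsVertex.eq_of_dvd (V : IsVertex h b q τ) (V' : IsVertex h b q' τ') (hqq' : q ∣ q') :
    τ = τ' := by
  ext k
  by_contra hne
  apply V.not_dvd
  have h1 : q ∣ C (τ k - τ' k) * b := by
    convert (dvd_sub (hqq'.trans (V'.dvd k)) (V.dvd k)) using 1
    rw [C_sub]; ring
  exact (((sub_ne_zero.mpr hne).isUnit.map C).dvd_mul_left).mp h1

theorem IsVertex.eval_h (V : IsVertex h b q τ) {z : σ → K} (hz : eval z q = 0) (k : σ) :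
    eval z (h k) = τ k * eval z b := by
  have h1 := map_dvd (eval z) (V.dvd k)
  rw [hz, zero_dvd_iff, map_sub, map_mul, eval_C, sub_eq_zero] at h1
  exact h1

theorem IsVertex.eval_vertex (V : IsVertex h b q τ) (V' : IsVertex h b q' τ')
    (h0 : aeval h q = 0) : eval τ' q = 0 := by
  obtain ⟨e, he⟩ := V.isHomogeneous
  have h1 := dvd_aeval_sub_aeval (fun k => mul_comm b (C (τ' k)) ▸ V'.dvd k) q
  rw [h0, zero_sub, dvd_neg, eval_smul_of_isHomogeneous he] at h1
  have h2 : aeval (fun k => (C (τ' k) : MvPolynomial σ K)) q = C (eval τ' q) := by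
    have := comp_aeval_apply (R := K) τ' (Algebra.ofId K (MvPolynomial σ K)) q
    rw [aeval_eq_eval] at this
    exact this.symm
  rw [h2] at h1
  by_contra hne
  exact V'.not_dvd (V'.prime.dvd_of_dvd_pow (((Ne.isUnit hne).map C).dvd_mul_right.mp h1))

theorem IsVertex.eval_add_vertex (V : IsVertex h b q τ) (V' : IsVertex h b q' τ')
    (h0 : aeval h q = 0) (s t : K) : eval (fun j => s * τ' j + t * τ j) q = 0 := by
  obtain ⟨e, he⟩ := V.isHomogeneous
  have h1 := eval_smul_of_isHomogeneous he s τ'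
  rw [aeval_eq_eval, aeval_eq_eval, V.eval_vertex V' h0, mul_zero] at h1
  rw [V.eval_add, h1]

theorem IsVertex.eval_h_add_vertex (V : IsVertex h b q τ) (V' : IsVertex h b q' τ')
    (h0 : aeval h q = 0) (h0' : aeval h q' = 0) {i : σ} (hne : τ i ≠ τ' i) (s t : K) (k : σ) :
    eval (fun j => s * τ' j + t * τ j) (h k) = 0 := by
  have h1 := V.eval_add_vertex V' h0 s t
  have h2 := V'.eval_add_vertex V h0' t s
  simp only [add_comm (t * τ _)] at h2
  have h3 := (V.eval_h h1 i).symm.trans (V'.eval_h h2 i)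
  rw [V.eval_h h1 k]
  have h4 : (τ i - τ' i) * eval (fun j => s * τ' j + t * τ j) b = 0 := by
    rw [sub_mul, h3, sub_self]
  rw [(mul_eq_zero.mp h4).resolve_left (sub_ne_zero.mpr hne), mul_zero]

/-- The lines spanned by infinitely many vertices are dense in the closure of the image of `h`. -/
theorem aeval_eq_zero_of_forall_vertex [Infinite K] {Λ : Set K} (hΛ : Λ.Infinite)
    {q : K → MvPolynomial σ K}
    {τ : K → σ → K} {i : σ} (hV : ∀ c ∈ Λ, IsVertex h b (q c) (τ c)) (hτ : ∀ c ∈ Λ, τ c i = c)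
    {P : MvPolynomial σ K} (hP : ∀ c ∈ Λ, ∀ s, eval (fun j => s * τ c j) P = 0) :
    aeval h P = 0 := by
  classical
  have hdvd : ∀ c ∈ Λ, q c ∣ aeval h P := by
    intro c hc
    have h1 := dvd_aeval_sub_aeval (fun k => (hV c hc).dvd k) P
    have h2 : aeval (fun k => C (τ c k) * b) P = 0 := by
      apply MvPolynomial.funext
      intro z
      rw [eval_aeval, map_zero, ← hP c hc (eval z b)]
      congr 2
      ext k
      simp [mul_comm]
    rwa [h2, sub_zero] at h1
  by_contra h0
  obtain ⟨s, hs, hsa⟩ := UniqueFactorizationMonoid.exists_prime_factors _ h0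
  have hf : ∀ c, ∃ p, c ∈ Λ → p ∈ s ∧ Associated (q c) p := by
    intro c
    by_cases hc : c ∈ Λ
    · obtain ⟨p, hp, hqp⟩ := (hV c hc).prime.exists_mem_multiset_dvd
        ((hdvd c hc).trans hsa.symm.dvd)
      exact ⟨p, fun _ => ⟨hp, (hV c hc).prime.associated_of_dvd (hs p hp) hqp⟩⟩
    · exact ⟨0, fun h => absurd h hc⟩
  choose p hp using hf
  obtain ⟨c, hc, c', hc', hne, heq⟩ := hΛ.exists_ne_map_eq_of_mapsTo (f := p) (t := s.toFinset)
    (fun c hc => by simpa using (hp c hc).1) s.toFinset.finite_toSet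
  apply hne
  have h1 : Associated (q c) (q c') := (hp c hc).2.trans (heq ▸ (hp c' hc').2.symm)
  rw [← hτ c hc, (hV c hc).eq_of_dvd (hV c' hc') h1.dvd, hτ c' hc']

variable [Fintype σ] {i : σ} {Λ : Set K}

theorem IsPencil.exists_map_eq_zero (hP : IsPencil h b i Λ) {B : Type*} [CommRing B] [IsDomain B]
    [Algebra K B] (φ : MvPolynomial σ K →ₐ[K] B) (hφ : ∀ k, φ (h k) = 0) :
    ∃ (q : K → MvPolynomial σ K) (τ : K → σ → K), ∀ c ∈ Λ,
      IsVertex h b (q c) (τ c) ∧ τ c i = c ∧ φ (q c) = 0 := by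
  have hex : ∀ c, ∃ (q : MvPolynomial σ K) (τ : σ → K), c ∈ Λ →
      IsVertex h b q τ ∧ τ i = c ∧ φ q = 0 := by
    intro c
    by_cases hc : c ∈ Λ
    · obtain ⟨v, hv⟩ := hP.exists_eq_sum
      have hb : φ b = 0 := by simp [hv, hφ]
      obtain ⟨q, hq, hqc, hq0⟩ := exists_prime_dvd_map_eq_zero φ.toRingHom (hP.sub_ne_zero c hc)
        (by simp [hφ, hb])
      obtain ⟨τ, hτ, hτi⟩ := hP.exists_isVertex c hc q hq hqc
      exact ⟨q, τ, fun _ => ⟨hτ, hτi, hq0⟩⟩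
    · exact ⟨0, 0, fun h => absurd h hc⟩
  choose q τ hqτ using hex
  exact ⟨q, τ, hqτ⟩

/-- The components of `h` vanish on the secant variety of the image of `h`. -/
theorem IsPencil.eval_add_eq_zero [Infinite K] (hP : IsPencil h b i Λ)
    (hh : ∀ k, aeval h (h k) = 0) (x y : σ → K) (k : σ) :
    eval (fun j => eval x (h j) + eval y (h j)) (h k) = 0 := by
  obtain ⟨q, τ, hq⟩ := hP.exists_map_eq_zero (aeval h) hh
  have key : ∀ (z : σ → K) (Λ' : Set K), Λ' ⊆ Λ → Λ'.Infinite →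
      (∀ c ∈ Λ', ∀ s, eval (fun j => s * τ c j + z j) (h k) = 0) →
      ∀ x, eval (fun j => eval x (h j) + z j) (h k) = 0 := by
    intro z Λ' hΛ' hinf hz x
    have h1 : ∀ w, eval w (aeval (fun j => X j + C (z j)) (h k)) =
        eval (fun j => w j + z j) (h k) := by
      intro w
      rw [eval_aeval]
      simp
    have h2 := aeval_eq_zero_of_forall_vertex hinf (fun c hc => (hq c (hΛ' hc)).1)
      (fun c hc => (hq c (hΛ' hc)).2.1) (P := aeval (fun j => X j + C (z j)) (h k))
      (fun c hc s => by rw [h1]; exact hz c hc s)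
    rw [← h1, ← eval_aeval, h2, map_zero]
  refine key _ Λ subset_rfl hP.infinite (fun c hc s => ?_) x
  simp only [add_comm (s * τ c _)]
  refine key _ (Λ \ {c}) Set.sdiff_subset (hP.infinite.sdiff (Set.finite_singleton c))
    (fun c' hc' t => ?_) y
  refine (hq c hc).1.eval_h_add_vertex (hq c' hc'.1).1 (hq c hc).2.2 (hq c' hc'.1).2.2 (i := i) ?_
    t s k
  rw [(hq c hc).2.1, (hq c' hc'.1).2.1]
  exact fun h => hc'.2 h.symm

theorem IsPencil.exists_secant_eq_zero [Infinite K] (hP : IsPencil h b i Λ)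
    (hh : ∀ k, aeval h (h k) = 0) :
    ∃ (q : K → MvPolynomial σ K) (τ : K → σ → K), ∀ c ∈ Λ,
      IsVertex h b (q c) (τ c) ∧ τ c i = c ∧
        ∀ x y, eval (fun j => eval x (h j) + eval y (h j)) (q c) = 0 := by
  have hev : ∀ (z : σ ⊕ σ → K) p,
      eval z (aeval (fun j => rename Sum.inl (h j) + rename Sum.inr (h j)) p) =
        eval (fun j => eval (z ∘ Sum.inl) (h j) + eval (z ∘ Sum.inr) (h j)) p := by
    intro z p
    rw [eval_aeval]
    simp [eval_rename]
  obtain ⟨q, τ, hq⟩ := hP.exists_map_eq_zero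
    (aeval fun j => rename Sum.inl (h j) + rename Sum.inr (h j)) (fun k => by
      apply MvPolynomial.funext
      intro z
      rw [hev, hP.eval_add_eq_zero hh, map_zero])
  refine ⟨q, τ, fun c hc => ⟨(hq c hc).1, (hq c hc).2.1, fun x y => ?_⟩⟩
  have := hev (Sum.elim x y) (q c)
  rw [(hq c hc).2.2, map_zero] at this
  simpa using this.symm

end Vertices

section LinearForms

variable {K σ : Type*} [Field K] [Fintype σ] [DecidableEq σ]

/-- A linear functional as a polynomial. -/
noncomputable def linearForm (l : (σ → K) →ₗ[K] K) : MvPolynomial σ K :=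
  ∑ j, C (l (Pi.single j 1)) * X j

theorem eval_linearForm (l : (σ → K) →ₗ[K] K) (z : σ → K) : eval z (linearForm l) = l z := by
  rw [LinearMap.pi_apply_eq_sum_univ l z]
  simp only [linearForm, map_sum, map_mul, eval_C, eval_X, smul_eq_mul]
  refine Finset.sum_congr rfl fun j _ => ?_
  rw [mul_comm]
  congr 2
  ext k
  simp [Pi.single_apply, eq_comm]

theorem not_isUnit_linearForm (l : (σ → K) →ₗ[K] K) : ¬ IsUnit (linearForm l) := by
  intro h
  have := h.map (eval (0 : σ → K))
  rw [eval_linearForm, map_zero] at this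
  exact not_isUnit_zero this

theorem linearForm_dvd [Infinite K] {l : (σ → K) →ₗ[K] K} (hl : l ≠ 0) {q : MvPolynomial σ K}
    (hq : ∀ z, l z = 0 → eval z q = 0) : linearForm l ∣ q := by
  obtain ⟨w, hw⟩ : ∃ w, l w = 1 := LinearMap.surjective hl 1
  have h1 : linearForm l ∣ aeval (fun k => X k) q -
      aeval (fun k => X k - C (w k) * linearForm l) q :=
    dvd_aeval_sub_aeval (fun k => by simp) q
  have h2 : aeval (fun k => X k - C (w k) * linearForm l) q = 0 := by
    apply MvPolynomial.funext
    intro z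
    rw [eval_aeval, map_zero]
    apply hq
    have : (fun k => eval z (X k - C (w k) * linearForm l)) = z - l z • w := by
      ext k
      simp [eval_linearForm, mul_comm]
    rw [this, map_sub, map_smul, hw, smul_eq_mul, mul_one, sub_self]
  rwa [h2, sub_zero, aeval_X_left_apply] at h1

end LinearForms

section Span

variable {K : Type*} [Field K]

theorem exists_linear_combination_eq_zero [IsAlgClosed K] {σ : Type*} {h : σ → MvPolynomial σ K}
    {m : ℕ} (hm : m ≠ 0) (hh : ∀ k, (h k).IsHomogeneous m) {b q : MvPolynomial σ K} {τ : σ → K}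
    (V : IsVertex h b q τ)
    (hq : ∀ x y, eval (fun j => eval x (h j) + eval y (h j)) q = 0) (x y : σ → K) (r s t : K) :
    eval (fun j => r * eval x (h j) + s * eval y (h j) + t * τ j) q = 0 := by
  have hs : ∀ (r : K) (x : σ → K), ∃ x' : σ → K, ∀ j, eval x' (h j) = r * eval x (h j) := by
    intro r x
    obtain ⟨s, hs⟩ := IsAlgClosed.exists_pow_nat_eq r (Nat.pos_of_ne_zero hm)
    refine ⟨fun j => s * x j, fun j => ?_⟩
    have := eval_smul_of_isHomogeneous (hh j) s x
    rwa [aeval_eq_eval, aeval_eq_eval, hs] at this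
  obtain ⟨x', hx⟩ := hs r x
  obtain ⟨y', hy⟩ := hs s y
  rw [V.eval_add (fun j => r * eval x (h j) + s * eval y (h j)), ← hq x' y']
  congr 2
  ext j
  rw [hx, hy]

theorem exists_linearForm_dvd [IsAlgClosed K] {h : Fin 4 → MvPolynomial (Fin 4) K} {m : ℕ}
    (hm : m ≠ 0) (hh : ∀ k, (h k).IsHomogeneous m) {b q : MvPolynomial (Fin 4) K} {τ : Fin 4 → K}
    (V : IsVertex h b q τ) (hτ : τ ≠ 0)
    (hq : ∀ x y, eval (fun j => eval x (h j) + eval y (h j)) q = 0)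
    (hS : 3 ≤ Module.finrank K
      (Submodule.span K (Set.range fun (x : Fin 4 → K) (j : Fin 4) => eval x (h j)))) :
    ∃ l : (Fin 4 → K) →ₗ[K] K, l ≠ 0 ∧
      LinearMap.ker l =
        Submodule.span K (Set.range fun (x : Fin 4 → K) (j : Fin 4) => eval x (h j)) ∧
      linearForm l ∣ q ∧ q ∣ linearForm l := by
  classical
  have hlin := exists_linear_combination_eq_zero hm hh V hq
  obtain ⟨ev, hev⟩ : ∃ ev : (Fin 4 → K) → Fin 4 → K, ev = fun x j => eval x (h j) := ⟨_, rfl⟩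
  have hev' : ∀ x j, eval x (h j) = ev x j := fun x j => by rw [hev]
  rw [← hev] at hS ⊢
  simp only [hev'] at hlin
  have hout : ∀ T : Finset (Fin 4 → K), T.card ≤ 2 →
      ∃ x, ev x ∉ Submodule.span K (T : Set (Fin 4 → K)) := by
    intro T hT
    by_contra! hc
    have h1 : Submodule.span K (Set.range ev) ≤ Submodule.span K (T : Set (Fin 4 → K)) :=
      Submodule.span_le.mpr (by rintro _ ⟨x, rfl⟩; exact hc x)
    have h2 := Submodule.finrank_mono h1
    have h3 := finrank_span_finset_le_card (R := K) T
    simp only [Set.finrank] at h3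
    omega
  obtain ⟨x, hx⟩ := hout {τ} (by simp)
  obtain ⟨y, hy⟩ := hout {ev x, τ} Finset.card_le_two
  simp only [Finset.coe_singleton, Finset.coe_insert] at hx hy
  have hlt : ∀ (T : Set (Fin 4 → K)) v, v ∉ Submodule.span K T →
      Module.finrank K (Submodule.span K T) < Module.finrank K (Submodule.span K (insert v T)) := by
    intro T v hv
    refine Submodule.finrank_lt_finrank_of_lt (lt_of_le_of_ne
      (Submodule.span_mono (Set.subset_insert _ _)) fun he => hv ?_)
    rw [he]
    exact Submodule.subset_span (Set.mem_insert _ _)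
  have h1 := hlt _ _ hx
  have h2 := hlt _ _ hy
  rw [finrank_span_singleton hτ] at h1
  have h3 : Module.finrank K (Submodule.span K {ev y, ev x, τ}) ≤ 3 := by
    have := finrank_span_finset_le_card (R := K) ({ev y, ev x, τ} : Finset (Fin 4 → K))
    simp only [Finset.coe_singleton, Finset.coe_insert] at this
    exact this.trans Finset.card_le_three
  have htop : Submodule.span K {ev y, ev x, τ} < ⊤ := by
    rw [lt_top_iff_ne_top]
    intro he
    rw [he, finrank_top] at h3
    simp at h3
  obtain ⟨l, hl, hle⟩ := Submodule.exists_le_ker_of_lt_top _ htop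
  have hker : Module.finrank K (LinearMap.ker l) = 3 := by
    have := Module.Dual.finrank_ker_add_one_of_ne_zero hl
    simp at this
    exact this
  have hkerW := Submodule.eq_of_le_of_finrank_le hle (by omega)
  have hdvd : linearForm l ∣ q := by
    refine linearForm_dvd hl fun z hz => ?_
    have hz' : z ∈ Submodule.span K {ev y, ev x, τ} := by rw [hkerW]; exact hz
    obtain ⟨r, s, t, rfl⟩ := Submodule.mem_span_triple.mp hz'
    exact hlin y x r s t
  have hdvd' : q ∣ linearForm l :=
    ((V.prime.irreducible.dvd_iff.mp hdvd).resolve_left (not_isUnit_linearForm l)).dvd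
  refine ⟨l, hl, ?_, hdvd, hdvd'⟩
  symm
  refine Submodule.eq_of_le_of_finrank_le (Submodule.span_le.mpr ?_) (by omega)
  rintro _ ⟨z, rfl⟩
  have h4 := map_dvd (eval (ev z)) hdvd'
  have h5 := hlin z z 1 0 0
  simp only [one_mul, zero_mul, add_zero] at h5
  rw [show eval (ev z) q = 0 from h5, zero_dvd_iff, eval_linearForm] at h4
  exact h4

theorem finrank_span_le_two [IsAlgClosed K] [CharZero K] {h : Fin 4 → MvPolynomial (Fin 4) K}
    {m : ℕ} (hm : m ≠ 0) (hh : IsReduced h m) :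
    Module.finrank K
      (Submodule.span K (Set.range fun (x : Fin 4 → K) (j : Fin 4) => eval x (h j))) ≤ 2 := by
  by_contra! hS
  obtain ⟨b, i, Λ, hP⟩ := hh.exists_isPencil hm
  obtain ⟨q, τ, hq⟩ := hP.exists_secant_eq_zero fun k =>
    aeval_eq_zero_of_vectorField_eq_zero hh.vectorField_eq_zero hm (hh.isHomogeneous k)
      (hh.vectorField_eq_zero k)
  have hl : ∀ c ∈ Λ, _ := fun c hc =>
    exists_linearForm_dvd hm hh.isHomogeneous (hq c hc).1 (fun h0 => hP.zero_notMem (by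
      have := (hq c hc).2.1
      rw [h0, Pi.zero_apply] at this
      rwa [this])) (hq c hc).2.2 hS
  obtain ⟨c, hc⟩ := hP.infinite.nonempty
  obtain ⟨c', hc', hne⟩ := (hP.infinite.sdiff (Set.finite_singleton c)).nonempty
  obtain ⟨l, hl0, hker, -, hdvd⟩ := hl c hc
  obtain ⟨l', -, hker', hdvd', -⟩ := hl c' hc'
  have h1 : linearForm l ∣ q c' := by
    refine linearForm_dvd hl0 fun z hz => ?_
    have hz' : l' z = 0 := by
      have : z ∈ LinearMap.ker l := hz
      rw [hker, ← hker'] at this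
      exact this
    have := map_dvd (eval z) hdvd'
    rwa [eval_linearForm, hz', zero_dvd_iff] at this
  have h2 := (hq c hc).1.eq_of_dvd (hq c' hc').1 (hdvd.trans h1)
  apply hne
  rw [Set.mem_singleton_iff, ← (hq c hc).2.1, ← (hq c' hc').2.1, h2]

end Span

section Dependence

variable {K : Type*} [Field K]

theorem pderiv_eq_zero_of_dvd_mul {σ : Type*} {a b : MvPolynomial σ K} {n : ℕ}
    (ha : a.IsHomogeneous n) (hab : IsRelPrime a b) (j : σ) (h : a ∣ b * pderiv j a) :
    pderiv j a = 0 := by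
  rcases eq_or_ne n 0 with rfl | hn
  · rw [← totalDegree_zero_iff_isHomogeneous, totalDegree_eq_zero_iff_eq_C] at ha
    rw [ha, pderiv_C]
  · exact eq_zero_of_isHomogeneous_of_dvd ha.pderiv ha (by omega) (hab.dvd_of_dvd_mul_left h)

theorem exists_eq_C_of_pderiv_eq_zero {σ : Type*} [Fintype σ] [CharZero K] {a : MvPolynomial σ K}
    {n : ℕ} (ha : a.IsHomogeneous n) (ha0 : a ≠ 0) (h : ∀ j, pderiv j a = 0) :
    ∃ c : K, c ≠ 0 ∧ a = C c := by
  obtain rfl := pderiv_eq_zero_imp_isHomogeneous_zero ha ha0 h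
  rw [← totalDegree_zero_iff_isHomogeneous, totalDegree_eq_zero_iff_eq_C] at ha
  refine ⟨_, fun h0 => ha0 ?_, ha⟩
  rw [ha, h0, C_0]

/-- Two forms whose Wronskians vanish are proportional. -/
theorem exists_C_mul_eq_C_mul {σ : Type*} [Fintype σ] [CharZero K] {p q : MvPolynomial σ K}
    {n : ℕ} (hp : p.IsHomogeneous n) (hq : q.IsHomogeneous n) (hp0 : p ≠ 0) (hq0 : q ≠ 0)
    (h : ∀ j, p * pderiv j q = q * pderiv j p) :
    ∃ c c' : K, c ≠ 0 ∧ C c' * p = C c * q := by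
  obtain ⟨g, r, hg, hr, hu⟩ := exists_primitive (h := ![p, q]) (by
    intro h0; exact hp0 (congrFun h0 0))
  have hpr : p = g * r 0 := hr 0
  have hqr : q = g * r 1 := hr 1
  have hcop : IsRelPrime (r 0) (r 1) := fun d h0 h1 => hu d (by
    intro i; fin_cases i; exacts [h0, h1])
  have hr0 : r 0 ≠ 0 := by rintro h0; rw [h0, mul_zero] at hpr; exact hp0 hpr
  have hr1 : r 1 ≠ 0 := by rintro h0; rw [h0, mul_zero] at hqr; exact hq0 hqr
  have hw : ∀ j, r 0 * pderiv j (r 1) = r 1 * pderiv j (r 0) := by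
    intro j
    have h1 := h j
    rw [hpr, hqr, Derivation.leibniz, Derivation.leibniz] at h1
    simp only [smul_eq_mul] at h1
    apply mul_left_cancel₀ (mul_ne_zero hg hg)
    linear_combination h1
  obtain ⟨k, hk⟩ := isHomogeneous_of_dvd hp0 hp ⟨g, by rw [mul_comm, ← hpr]⟩
  obtain ⟨k', hk'⟩ := isHomogeneous_of_dvd hq0 hq ⟨g, by rw [mul_comm, ← hqr]⟩
  obtain ⟨c, hc, hc0⟩ := exists_eq_C_of_pderiv_eq_zero hk hr0 fun j =>
    pderiv_eq_zero_of_dvd_mul hk hcop j ⟨_, (hw j).symm⟩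
  obtain ⟨c', -, hc1⟩ := exists_eq_C_of_pderiv_eq_zero hk' hr1 fun j =>
    pderiv_eq_zero_of_dvd_mul hk' hcop.symm j ⟨_, hw j⟩
  refine ⟨c, c', hc, ?_⟩
  rw [← hc0, ← hc1, hpr, hqr]
  ring

theorem exists_eq_sum_of_finrank_span {σ : Type*} [Fintype σ] [DecidableEq σ] [Infinite K]
    (h : σ → MvPolynomial σ K) {n : ℕ}
    (hn : Module.finrank K (Submodule.span K (Set.range fun (x : σ → K) (j : σ) => eval x (h j))) =
      n) :
    ∃ (r : Fin n → σ → K) (α : Fin n → MvPolynomial σ K), LinearIndependent K r ∧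
      ∀ j, h j = ∑ k, C (r k j) * α k := by
  obtain ⟨S, hS⟩ : ∃ S, S =
    Submodule.span K (Set.range fun (x : σ → K) (j : σ) => eval x (h j)) := ⟨_, rfl⟩
  rw [← hS] at hn
  obtain ⟨P, hP⟩ := S.subtype.exists_leftInverse_of_injective S.ker_subtype
  let B := Module.finBasisOfFinrankEq K S hn
  have hα : ∀ k x, eval x (∑ j, C (B.coord k (P (Pi.single j 1))) * h j) =
      B.coord k (P fun j => eval x (h j)) := by
    intro k x
    have := eval_linearForm ((B.coord k).comp P) fun j => eval x (h j)
    rw [LinearMap.comp_apply] at this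
    rw [← this, linearForm]
    simp
  refine ⟨fun k => B k, fun k => ∑ j, C (B.coord k (P (Pi.single j 1))) * h j, ?_, fun j => ?_⟩
  · exact B.linearIndependent.map' S.subtype S.ker_subtype
  · apply MvPolynomial.funext
    intro x
    have hx : (fun j => eval x (h j)) ∈ S := by
      rw [hS]; exact Submodule.subset_span ⟨x, rfl⟩
    have h1 : P (fun j => eval x (h j)) = ⟨_, hx⟩ :=
      LinearMap.congr_fun hP ⟨fun j => eval x (h j), hx⟩
    have h2 := congrFun (congrArg Subtype.val (B.sum_repr ⟨_, hx⟩)) j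
    rw [map_sum, Finset.sum_congr rfl fun k _ => show _ = (B k).val j * B.coord k ⟨_, hx⟩ by
      rw [map_mul, eval_C, hα, h1]]
    simpa only [AddSubmonoidClass.coe_finsetSum, Finset.sum_apply, SetLike.val_smul, Pi.smul_apply,
      smul_eq_mul, mul_comm, Module.Basis.coord_apply] using h2.symm

theorem exists_sum_pderiv_eq_zero [CharZero K] {f : MvPolynomial (Fin 4) K} {d : ℕ} (hd : 2 ≤ d)
    (hf : f.IsHomogeneous d) {h : Fin 4 → MvPolynomial (Fin 4) K} (hh : h ≠ 0)
    (hD : ∀ j, vectorField h (pderiv j f) = 0)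
    (hS : Module.finrank K
      (Submodule.span K (Set.range fun (x : Fin 4 → K) (j : Fin 4) => eval x (h j))) ≤ 2) :
    ∃ a : Fin 4 → K, a ≠ 0 ∧ ∑ i, C (a i) * pderiv i f = 0 := by
  have hDf : vectorField h f = 0 := by
    have h1 := congrArg (vectorField h) hf.sum_X_mul_pderiv
    simp only [map_sum, Derivation.leibniz, hD, mul_zero, zero_add, vectorField_X, smul_eq_mul,
      map_nsmul, mul_comm (pderiv _ f)] at h1
    rw [← vectorField_apply] at h1
    have h2 : ((d : MvPolynomial (Fin 4) K) - 1) * vectorField h f = 0 := by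
      rw [nsmul_eq_mul] at h1
      linear_combination - h1
    refine (mul_eq_zero.mp h2).resolve_left (sub_ne_zero.mpr ?_)
    exact_mod_cast (by omega : d ≠ 1)
  have hcomm : ∀ (a : Fin 4 → K) j, pderiv j (∑ i, C (a i) * pderiv i f) =
      ∑ i, C (a i) * pderiv i (pderiv j f) := by
    intro a j
    simp [pderiv_comm j]
  have hhom : ∀ a : Fin 4 → K, (∑ i, C (a i) * pderiv i f).IsHomogeneous (d - 1) := fun a =>
    IsHomogeneous.sum _ _ _ fun i _ => hf.pderiv.C_mul _
  obtain ⟨n, hn⟩ : ∃ n, Module.finrank K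
      (Submodule.span K (Set.range fun (x : Fin 4 → K) (j : Fin 4) => eval x (h j))) = n := ⟨_, rfl⟩
  obtain ⟨r, α, hr, hα⟩ := exists_eq_sum_of_finrank_span h hn
  rw [hn] at hS
  have hsum : ∀ g, vectorField h g = ∑ k, α k * ∑ i, C (r k i) * pderiv i g := by
    intro g
    simp only [vectorField_apply, hα, Finset.sum_mul, Finset.mul_sum]
    rw [Finset.sum_comm]
    exact Finset.sum_congr rfl fun k _ => Finset.sum_congr rfl fun i _ => by ring
  have hα0 : α ≠ 0 := by
    rintro rfl
    apply hh
    ext1 j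
    simp [hα]
  by_contra! hne
  have hfr := fun k => hne (r k) (hr.ne_zero k)
  rw [hsum] at hDf
  simp only [hsum, ← hcomm] at hD
  interval_cases n
  · exact hα0 (Subsingleton.elim _ _)
  · apply hα0
    ext1 k
    rw [Fin.sum_univ_one] at hDf
    rw [Subsingleton.elim k 0]
    exact (mul_eq_zero.mp hDf).resolve_right (hfr 0)
  · simp only [Fin.sum_univ_two] at hDf hD
    have hα00 : α 0 ≠ 0 := by
      intro h0
      rw [h0, zero_mul, zero_add] at hDf
      apply hα0
      ext1 k
      fin_cases k
      exacts [h0, (mul_eq_zero.mp hDf).resolve_right (hfr 1)]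
    obtain ⟨c, c', hc, hcc⟩ := exists_C_mul_eq_C_mul (hhom (r 0)) (hhom (r 1)) (hfr 0) (hfr 1)
      fun j => by
        apply mul_left_cancel₀ hα00
        linear_combination pderiv j (∑ i, C (r 1 i) * pderiv i f) * hDf -
          (∑ i, C (r 1 i) * pderiv i f) * hD j
    refine hne (c' • r 0 - c • r 1) (fun h0 => hc ?_) ?_
    · have := LinearIndependent.pair_iff.mp (show LinearIndependent K ![r 0, r 1] by
        convert hr using 1
        ext1 k
        fin_cases k <;> rfl) c' (-c) (by rw [neg_smul, ← sub_eq_add_neg, h0])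
      exact neg_eq_zero.mp this.2
    · rw [Finset.mul_sum, Finset.mul_sum, ← sub_eq_zero, ← Finset.sum_sub_distrib] at hcc
      rw [← hcc]
      refine Finset.sum_congr rfl fun i _ => ?_
      simp only [Pi.sub_apply, Pi.smul_apply, smul_eq_mul, C_sub, C_mul]
      ring

end Dependence

section Elimination

variable {K σ : Type*} [Field K] [Fintype σ] [DecidableEq σ]

theorem exists_matrix_det_isUnit (i : σ) {a : σ → K} (ha : a ≠ 0) :
    ∃ B : Matrix σ σ K, IsUnit B.det ∧ ∀ k, B k i = a k := by
  obtain ⟨j, hj⟩ := Function.ne_iff.mp ha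
  refine ⟨((1 : Matrix σ σ K).updateCol j a).submatrix id (Equiv.swap i j), ?_, fun k => by simp⟩
  rw [Matrix.det_permute', ← Matrix.cramer_apply, Matrix.cramer_one, isUnit_iff_ne_zero]
  refine mul_ne_zero ?_ hj
  rcases Int.units_eq_one_or (Equiv.Perm.sign (Equiv.swap i j)) with h | h <;> simp [h]

/-- A linear relation between the partial derivatives allows eliminating any variable. -/
theorem exists_bind₁_eq_of_sum_pderiv_eq_zero (i₀ : σ) {f : MvPolynomial σ K} {a : σ → K}
    (ha : a ≠ 0) (haf : ∑ i, C (a i) * pderiv i f = 0) :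
    ∃ (A : Matrix σ σ K) (f' : MvPolynomial σ K), IsUnit A.det ∧
      bind₁ (fun i => ∑ j, C (A i j) * X j) f' = f ∧ pderiv i₀ f' = 0 := by
  obtain ⟨B, hB, hBa⟩ := exists_matrix_det_isUnit i₀ ha
  refine ⟨B⁻¹, bind₁ (fun i => ∑ j, C (B i j) * X j) f, ?_, ?_, ?_⟩
  · rw [Matrix.det_nonsing_inv]
    exact hB.ringInverse
  · rw [bind₁_bind₁]
    have hX : (fun i => bind₁ (fun i => ∑ j, C (B⁻¹ i j) * X j) (∑ j, C (B i j) * X j)) =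
        (X : σ → MvPolynomial σ K) := by
      ext1 i
      simp only [map_sum, map_mul, bind₁_X_right, bind₁_C_right, Finset.mul_sum]
      rw [Finset.sum_comm]
      simp only [← mul_assoc, ← C_mul, ← Finset.sum_mul, ← map_sum, ← Matrix.mul_apply,
        Matrix.mul_nonsing_inv B hB]
      simp [Matrix.one_apply]
    rw [hX, bind₁_X_left, AlgHom.id_apply]
  · rw [bind₁, derivation_aeval,
      ← map_zero (aeval (R := K) fun i => (∑ j, C (B i j) * X j : MvPolynomial σ K)), ← haf,
      map_sum]
    refine Finset.sum_congr rfl fun i _ => ?_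
    rw [map_mul, aeval_C, algebraMap_eq, mul_comm, ← hBa]
    congr 1
    simp [pderiv_X, Pi.single_apply]

end Elimination

theorem finrank_span_range_eval_le_one {K σ : Type*} [Field K] [Fintype σ]
    {g : σ → MvPolynomial σ K} (hg : ∀ i, (g i).IsHomogeneous 0) :
    Module.finrank K (Submodule.span K (Set.range fun (x : σ → K) (j : σ) => eval x (g j))) ≤
      1 := by
  have h : (fun (x : σ → K) (j : σ) => eval x (g j)) = fun _ j => coeff 0 (g j) := by
    ext x j
    have hj := hg j
    rw [← totalDegree_zero_iff_isHomogeneous, totalDegree_eq_zero_iff_eq_C] at hj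
    conv_lhs => rw [hj, eval_C]
  rw [h, Set.range_const]
  exact (finrank_span_le_card _).trans (by simp)

end ZeroHessian

/-- A quaternary form of degree at least `2` with identically vanishing Hessian determinant
has linearly dependent partial derivatives; equivalently, a variable can be eliminated
from it by an (invertible) linear transformation of the variables. -/
theorem quaternary_form_with_zero_hessian
    {K : Type*} [Field K] [IsAlgClosed K] [CharZero K]
    (f : MvPolynomial (Fin 4) K) (d : ℕ) (hd : 2 ≤ d) (hf : f.IsHomogeneous d)
    (hHess : (Matrix.of fun i j : Fin 4 => pderiv i (pderiv j f)).det = 0) :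
    (∃ a : Fin 4 → K, a ≠ 0 ∧ ∑ i, a i • pderiv i f = 0) ∧
    ∃ (A : Matrix (Fin 4) (Fin 4) K) (f' : MvPolynomial (Fin 4) K),
      IsUnit A.det ∧
      bind₁ (fun i : Fin 4 => ∑ j : Fin 4, C (A i j) * X j) f' = f ∧
      pderiv 3 f' = 0 := by
  obtain ⟨n, h, hh, hn, hD, hDf⟩ := ZeroHessian.exists_vectorField hd hf hHess
  obtain ⟨m, g, hg, hker⟩ := ZeroHessian.exists_isReduced hh hn hD
  have hS : Module.finrank K (Submodule.span K
      (Set.range fun (x : Fin 4 → K) (j : Fin 4) => eval x (g j))) ≤ 2 := by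
    rcases eq_or_ne m 0 with rfl | hm
    · exact (ZeroHessian.finrank_span_range_eval_le_one hg.isHomogeneous).trans one_le_two
    · exact ZeroHessian.finrank_span_le_two hm hg
  have hg0 : g ≠ 0 := by
    rintro rfl
    exact not_isUnit_zero (hg.isUnit 0 fun _ => dvd_rfl)
  obtain ⟨a, ha, haf⟩ :=
    ZeroHessian.exists_sum_pderiv_eq_zero hd hf hg0 (fun j => hker _ (hDf j)) hS
  refine ⟨⟨a, ha, ?_⟩, ZeroHessian.exists_bind₁_eq_of_sum_pderiv_eq_zero 3 ha haf⟩
  simpa only [smul_eq_C_mul] using haf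
end

section
/- Let h = (h₁,…,hₙ) be a self-vanishing system of forms in K[x₁,…,xₙ] and let f ∈ K[x₁,…,xₙ] be a homogeneous polynomial. Then the following are equivalent: (a) Σⱼ hⱼ·(∂f/∂xⱼ) = 0; (b) f⁽ʲ⁾(x,h) = 0 for every j ≥ 1; (c) the identity f(x₁ + t·h₁(x), …, xₙ + t·hₙ(x)) = f(x₁,…,xₙ) holds in the polynomial ring K[x₁,…,xₙ,t]. -/
open MvPolynomial

/-- The polarization operator `𝒟ₓ(y) = ∑ᵢ yᵢ ∂/∂xᵢ` on `K[x₁,…,xₙ,y₁,…,yₙ]`,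
where the `x`-variables are indexed by `Sum.inl` and the `y`-variables by `Sum.inr`. -/
noncomputable def polarize {K : Type*} [CommSemiring K] {n : ℕ}
    (p : MvPolynomial (Fin n ⊕ Fin n) K) : MvPolynomial (Fin n ⊕ Fin n) K :=
  ∑ i : Fin n, X (Sum.inr i) * pderiv (Sum.inl i) p

/-- The polynomial `f⁽ʲ⁾(x,y) = (1/j!) · 𝒟ₓ(y)ʲ f ∈ K[x,y]`. -/
noncomputable def polarPow {K : Type*} [Field K] [CharZero K] {n : ℕ}
    (f : MvPolynomial (Fin n) K) (j : ℕ) : MvPolynomial (Fin n ⊕ Fin n) K :=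
  ((j.factorial : K)⁻¹) • (polarize^[j] (rename Sum.inl f))

theorem derivation_aeval_eq_sum {K σ S : Type*} [CommSemiring K] [Fintype σ] [CommRing S]
    [Algebra K S] (D : Derivation K S S) (g : σ → S) (p : MvPolynomial σ K) :
    D (aeval g p) = ∑ i, aeval g (pderiv i p) * D (g i) := by
  classical
  induction p using MvPolynomial.induction_on with
  | C a => simp [← algebraMap_eq]
  | add p q hp hq => simp [hp, hq, add_mul, Finset.sum_add_distrib]
  | mul_X p j hp =>
    simp only [map_mul, aeval_X, Derivation.leibniz, hp, smul_eq_mul, pderiv_X, map_add, add_mul,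
      Finset.sum_add_distrib, Finset.mul_sum]
    congr 1
    · rw [Finset.sum_eq_single j (by simp +contextual [eq_comm]) (by simp)]
      simp
    · exact Finset.sum_congr rfl fun i _ ↦ by ring

/-- A derivation sending the images of the `x`-variables to those of the `y`-variables, and
annihilating the latter, intertwines with the polarization operator. -/
theorem derivation_iterate_aeval_eq_polarize {K S : Type*} [CommSemiring K] [CommRing S]
    [Algebra K S] {n : ℕ} (D : Derivation K S S) (g : Fin n ⊕ Fin n → S)
    (hl : ∀ i, D (g (Sum.inl i)) = g (Sum.inr i)) (hr : ∀ i, D (g (Sum.inr i)) = 0)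
    (j : ℕ) (p : MvPolynomial (Fin n ⊕ Fin n) K) :
    D^[j] (aeval g p) = aeval g (polarize^[j] p) := by
  have key : Function.Semiconj (aeval g) (polarize (K := K)) D := fun p ↦ by
    simp [derivation_aeval_eq_sum D g p, polarize, hl, hr, mul_comm]
  exact (key.iterate_right j p).symm

theorem aeval_polarPow_eq_zero_iff {K : Type*} [Field K] [CharZero K] {n : ℕ}
    (h : Fin n → MvPolynomial (Fin n) K) (f : MvPolynomial (Fin n) K) (j : ℕ) :
    aeval (Sum.elim X h) (polarPow f j) = 0 ↔
      aeval (Sum.elim X h) (polarize^[j] (rename Sum.inl f)) = 0 := by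
  simp [polarPow, Nat.factorial_ne_zero]

/-- If `D = ∑ᵢ hᵢ ∂/∂xᵢ` annihilates each `hⱼ`, then `j! · f⁽ʲ⁾(x,h) = Dʲ f`. -/
theorem aeval_iterate_polarize_of_selfVanishing {K : Type*} [Field K] {n : ℕ}
    (h : Fin n → MvPolynomial (Fin n) K) (hsv : ∀ j, ∑ i, h i * pderiv i (h j) = 0)
    (f : MvPolynomial (Fin n) K) (j : ℕ) :
    aeval (Sum.elim X h) (polarize^[j] (rename Sum.inl f)) =
      (fun p ↦ ∑ i, h i * pderiv i p)^[j] f := by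
  have hD : ⇑(mkDerivation K h) = fun p ↦ ∑ i, h i * pderiv i p := funext fun p ↦ by
    simpa [mul_comm, mkDerivation_X] using derivation_aeval_eq_sum (mkDerivation K h) X p
  rw [← derivation_iterate_aeval_eq_polarize (mkDerivation K h) _ (by simp [mkDerivation_X])
    (by simp [hD, hsv]), hD, aeval_rename, Sum.elim_comp_inl, aeval_X_left_apply]

/-- Taylor's formula: the coefficient of `tʲ` in `f(x + t·h)` is `f⁽ʲ⁾(x,h)`. -/
theorem factorial_mul_coeff_aeval_add {K : Type*} [Field K] {n : ℕ}
    (h : Fin n → MvPolynomial (Fin n) K) (f : MvPolynomial (Fin n) K) (j : ℕ) :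
    (j.factorial : MvPolynomial (Fin n) K) *
        (aeval (fun i : Fin n => Polynomial.C (X i) + Polynomial.X * Polynomial.C (h i)) f).coeff j
      = aeval (Sum.elim X h) (polarize^[j] (rename Sum.inl f)) := by
  let g : Fin n ⊕ Fin n → Polynomial (MvPolynomial (Fin n) K) :=
    Sum.elim (fun i ↦ Polynomial.C (X i) + Polynomial.X * Polynomial.C (h i))
      (fun i ↦ Polynomial.C (h i))
  have hder := derivation_iterate_aeval_eq_polarize
    ((Polynomial.derivative' (R := MvPolynomial (Fin n) K)).restrictScalars K) g
    (fun i ↦ by simp [g]) (fun i ↦ by simp [g]) j (rename Sum.inl f)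
  have hev (p : MvPolynomial (Fin n ⊕ Fin n) K) :
      (aeval g p).coeff 0 = aeval (Sum.elim X h) p := by
    have hhom : ((Polynomial.aeval (0 : MvPolynomial (Fin n) K)).restrictScalars K).comp (aeval g)
        = aeval (Sum.elim X h) := by
      ext i : 1
      cases i <;> simp [g]
    simpa [Polynomial.coeff_zero_eq_aeval_zero] using DFunLike.congr_fun hhom p
  rw [← hev, ← hder, aeval_rename]
  change _ = (Polynomial.derivative^[j] _).coeff 0
  simp [Polynomial.coeff_iterate_derivative, Nat.descFactorial_self, g, Sum.elim_comp_inl]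

/-- For a self-vanishing system `h` and a homogeneous polynomial `f`, the following are
equivalent: (a) `∑ⱼ hⱼ ∂f/∂xⱼ = 0`; (b) `f⁽ʲ⁾(x,h) = 0` for all `j ≥ 1`;
(c) `f(x + t·h(x)) = f(x)` identically in `K[x,t]`. -/
theorem svs_solution_tfae
    {K : Type*} [Field K] [IsAlgClosed K] [CharZero K] {n : ℕ}
    (h : Fin n → MvPolynomial (Fin n) K) (e : ℕ)
    (hh : ∀ j, (h j).IsHomogeneous e)
    (hsv : ∀ j, ∑ i, h i * pderiv i (h j) = 0)
    (f : MvPolynomial (Fin n) K) (d : ℕ) (hf : f.IsHomogeneous d) :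
    ((∑ j, h j * pderiv j f = 0) ↔
      (∀ j : ℕ, 1 ≤ j → aeval (Sum.elim X h) (polarPow f j) = 0)) ∧
    ((∀ j : ℕ, 1 ≤ j → aeval (Sum.elim X h) (polarPow f j) = 0) ↔
      aeval (fun i : Fin n => Polynomial.C (X i) + Polynomial.X * Polynomial.C (h i)) f
        = Polynomial.C f) := by
  refine ⟨?_, ?_⟩
  · simp only [aeval_polarPow_eq_zero_iff, aeval_iterate_polarize_of_selfVanishing h hsv]
    refine ⟨fun ha j hj ↦ ?_, fun hb ↦ hb 1 le_rfl⟩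
    obtain ⟨k, rfl⟩ := Nat.exists_eq_add_of_le' hj
    rw [Function.iterate_succ_apply, ha]
    exact Function.iterate_fixed (by simp) k
  · simp only [aeval_polarPow_eq_zero_iff, ← factorial_mul_coeff_aeval_add, mul_eq_zero,
      Nat.cast_eq_zero, Nat.factorial_ne_zero, false_or]
    refine ⟨fun hb ↦ Polynomial.ext fun j ↦ ?_, fun hc j hj ↦ ?_⟩
    · rcases Nat.eq_zero_or_pos j with rfl | hj
      · have h0 := factorial_mul_coeff_aeval_add h f 0
        rw [Function.iterate_zero_apply, aeval_rename, Sum.elim_comp_inl,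
          aeval_X_left_apply] at h0
        simpa using h0
      · rw [hb j hj, Polynomial.coeff_C_of_ne_zero hj.ne']
    · rw [hc, Polynomial.coeff_C_of_ne_zero (Nat.ne_of_gt hj)]
end

section
/- Let h = (h₁,…,hₙ) be a self-vanishing system of forms in K[x₁,…,xₙ]. If f, g ∈ K[x₁,…,xₙ] are nonzero polynomials such that the product f·g satisfies Σⱼ hⱼ·(∂(fg)/∂xⱼ) = 0, then both Σⱼ hⱼ·(∂f/∂xⱼ) = 0 and Σⱼ hⱼ·(∂g/∂xⱼ) = 0. -/
open MvPolynomial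

namespace Derivation

variable {R A : Type*} [CommRing R] [CommRing A] [Algebra R A] (D : Derivation R A A)

theorem iterate_mul_eq_zero {m k : ℕ} {f g : A} (hf : D^[m] f = 0) (hg : D^[k] g = 0) :
    D^[m + k] (f * g) = 0 := by
  induction m generalizing f g k with
  | zero =>
    obtain rfl : f = 0 := hf
    rw [zero_mul, iterate_map_zero]
  | succ m ihm =>
    induction k generalizing g with
    | zero =>
      obtain rfl : g = 0 := hg
      rw [mul_zero, iterate_map_zero]
    | succ k ihk =>
      rw [← add_assoc, Function.iterate_succ_apply, leibniz, iterate_map_add, smul_eq_mul,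
        smul_eq_mul, ihk hg, mul_comm g, add_right_comm, add_assoc, ihm hf hg, add_zero]

theorem iterate_add_mul {a b : ℕ} {f g : A} (hf : D^[a + 1] f = 0) (hg : D^[b + 1] g = 0) :
    D^[a + b] (f * g) = (a + b).choose a * (D^[a] f * D^[b] g) := by
  induction a generalizing f g b with
  | zero =>
    induction b generalizing g with
    | zero => simp
    | succ b ihb =>
      rw [← add_assoc, Function.iterate_succ_apply, leibniz, iterate_map_add, smul_eq_mul,
        smul_eq_mul, ihb hg, show D f = 0 from hf, mul_zero, iterate_map_zero, add_zero]
      simp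
  | succ a iha =>
    induction b generalizing g with
    | zero =>
      rw [add_zero, Function.iterate_succ_apply, leibniz, iterate_map_add, smul_eq_mul,
        smul_eq_mul, show D g = 0 from hg, mul_zero, iterate_map_zero, zero_add, mul_comm g]
      simpa using iha hf hg
    | succ b ihb =>
      rw [← add_assoc, Function.iterate_succ_apply, leibniz, iterate_map_add, smul_eq_mul,
        smul_eq_mul, ihb hg, mul_comm g, show a + 1 + b = a + (b + 1) by ring, iha hf hg,
        show a + (b + 1) + 1 = (a + b + 1) + 1 by ring, Nat.choose_succ_succ,
        ← Function.iterate_succ_apply, ← Function.iterate_succ_apply,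
        show a + (b + 1) = a + b + 1 by ring]
      push_cast
      ring

/-- The kernel of a locally nilpotent derivation of a domain of characteristic zero is
factorially closed. -/
theorem eq_zero_of_mul_eq_zero_of_locally_nilpotent [IsDomain A] [CharZero A]
    (hD : ∀ f, ∃ m, D^[m] f = 0) {f g : A} (hf : f ≠ 0) (hg : g ≠ 0) (hfg : D (f * g) = 0) :
    D f = 0 ∧ D g = 0 := by
  classical
  have key (p : A) (hp : p ≠ 0) : ∃ a, D^[a] p ≠ 0 ∧ D^[a + 1] p = 0 := by
    obtain ⟨a, ha⟩ : ∃ a, Nat.find (hD p) = a + 1 :=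
      Nat.exists_eq_succ_of_ne_zero fun h0 ↦ hp (by simpa [h0] using Nat.find_spec (hD p))
    exact ⟨a, Nat.find_min (hD p) (by lia), ha ▸ Nat.find_spec (hD p)⟩
  obtain ⟨a, ha, ha'⟩ := key f hf
  obtain ⟨b, hb, hb'⟩ := key g hg
  have hab : a + b = 0 := by
    by_contra hne
    obtain ⟨c, hc⟩ := Nat.exists_eq_succ_of_ne_zero hne
    have hlead := D.iterate_add_mul ha' hb'
    have hzero : D^[a + b] (f * g) = 0 := by
      rw [hc, Function.iterate_succ_apply, hfg, iterate_map_zero]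
    exact mul_ne_zero (Nat.cast_ne_zero.2 (Nat.choose_pos (Nat.le_add_right a b)).ne')
      (mul_ne_zero ha hb) (hlead.symm.trans hzero)
  obtain ⟨rfl, rfl⟩ := Nat.add_eq_zero_iff.1 hab
  exact ⟨ha', hb'⟩

end Derivation

theorem MvPolynomial.derivation_locally_nilpotent {σ R : Type*} [CommRing R]
    (D : Derivation R (MvPolynomial σ R) (MvPolynomial σ R)) (hD : ∀ i, ∃ m, D^[m] (X i) = 0)
    (f : MvPolynomial σ R) : ∃ m, D^[m] f = 0 := by
  induction f using MvPolynomial.induction_on with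
  | C r => exact ⟨1, derivation_C D r⟩
  | add p q hp hq =>
    obtain ⟨m, hm⟩ := hp
    obtain ⟨k, hk⟩ := hq
    refine ⟨m + k, ?_⟩
    rw [iterate_map_add, Function.iterate_add_apply, Function.iterate_add_apply D m k q, hk,
      ← Function.iterate_add_apply, add_comm m k, Function.iterate_add_apply, hm]
    simp
  | mul_X p i hp =>
    obtain ⟨m, hm⟩ := hp
    obtain ⟨k, hk⟩ := hD i
    exact ⟨m + k, D.iterate_mul_eq_zero hm hk⟩

theorem MvPolynomial.mkDerivation_eq_sum_pderiv {σ R : Type*} [Fintype σ] [CommRing R]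
    (h : σ → MvPolynomial σ R) (f : MvPolynomial σ R) :
    mkDerivation R h f = ∑ j, h j * pderiv j f := by
  classical
  have hD : mkDerivation R h = ∑ j, h j • pderiv j := by
    refine derivation_ext fun i ↦ ?_
    rw [← Derivation.coeFnAddMonoidHom_apply (∑ j, h j • pderiv j), map_sum, Finset.sum_apply]
    simp [pderiv_X, Pi.single_apply]
  rw [hD, ← Derivation.coeFnAddMonoidHom_apply, map_sum, Finset.sum_apply]
  simp

/-- If `h` is a self-vanishing system of forms and the product `f·g` of two nonzero
polynomials satisfies `∑ⱼ hⱼ ∂(fg)/∂xⱼ = 0`, then so do both `f` and `g`. -/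
theorem svs_factor_of_solution
    {K : Type*} [Field K] [IsAlgClosed K] [CharZero K] {n : ℕ}
    (h : Fin n → MvPolynomial (Fin n) K) (e : ℕ)
    (hh : ∀ j, (h j).IsHomogeneous e)
    (hsv : ∀ j, ∑ i, h i * pderiv i (h j) = 0)
    (f g : MvPolynomial (Fin n) K) (hf : f ≠ 0) (hg : g ≠ 0)
    (hfg : ∑ j, h j * pderiv j (f * g) = 0) :
    (∑ j, h j * pderiv j f = 0) ∧ (∑ j, h j * pderiv j g = 0) := by
  simp only [← mkDerivation_eq_sum_pderiv] at hsv hfg ⊢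
  refine (mkDerivation K h).eq_zero_of_mul_eq_zero_of_locally_nilpotent
    (derivation_locally_nilpotent _ fun i ↦ ⟨2, ?_⟩) hf hg hfg
  simp [mkDerivation_X, hsv]
end

section
/- Let h = (h₁,…,hₙ) be a self-vanishing system of forms in R = K[x₁,…,xₙ] with hₙ ≠ 0. In the fraction field K(x₁,…,xₙ) set sᵢ = xᵢ − (hᵢ/hₙ)·xₙ for 1 ≤ i ≤ n−1. Then for every f ∈ R with Σⱼ hⱼ·(∂f/∂xⱼ) = 0 one has f = f(s₁,…,s_{n−1},0) (f equals the result of substituting xᵢ ↦ sᵢ for i < n and xₙ ↦ 0 into f), and moreover Sol(h;R) = K[s₁,…,s_{n−1}] ∩ K[x₁,…,xₙ], the intersection taken inside K(x₁,…,xₙ). -/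
open MvPolynomial

section Flow

variable {K σ : Type*} [Field K]

theorem mkDerivation_eq_sum_mul_pderiv [Fintype σ] (h : σ → MvPolynomial σ K)
    (f : MvPolynomial σ K) : mkDerivation K h f = ∑ j, h j * pderiv j f := by
  classical
  induction f using MvPolynomial.induction_on with
  | C a => simp
  | add p q hp hq => simp [hp, hq, mul_add, Finset.sum_add_distrib]
  | mul_X p i hp =>
    simp only [Derivation.leibniz, smul_eq_mul, mkDerivation_X, hp, pderiv_X, mul_add,
      Finset.sum_add_distrib, Finset.mul_sum]
    congr 1
    · rw [Finset.sum_eq_single i]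
      · simp [mul_comm]
      · intro j _ hj
        simp [hj.symm]
      · simp
    · exact Finset.sum_congr rfl fun j _ => by ring

/-- The ring homomorphism `f ↦ f(x + T h)`. -/
noncomputable def flow (h : σ → MvPolynomial σ K) :
    MvPolynomial σ K →ₐ[K] Polynomial (MvPolynomial σ K) :=
  aeval fun i => Polynomial.C (X i) + Polynomial.C (h i) * Polynomial.X

/-- Along the lines `x + T h`, differentiating in `T` amounts to applying the derivation `D` with
`D xᵢ = hᵢ` coefficientwise, as soon as `D` annihilates the direction `h`. -/
theorem coeff_succ_flow_mul (D : Derivation K (MvPolynomial σ K) (MvPolynomial σ K))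
    (h : σ → MvPolynomial σ K) (hX : ∀ i, D (X i) = h i) (hD : ∀ i, D (h i) = 0)
    (f : MvPolynomial σ K) (k : ℕ) :
    (flow h f).coeff (k + 1) * (k + 1) = D ((flow h f).coeff k) := by
  induction f using MvPolynomial.induction_on generalizing k with
  | C a =>
    have : flow h (C a) = Polynomial.C (C a) := by
      rw [← algebraMap_eq, AlgHom.commutes]; rfl
    rw [this]
    cases k <;> simp [Polynomial.coeff_C]
  | add p q hp hq => simp [add_mul, hp, hq]
  | mul_X p i hp =>
    have hi : flow h (p * X i)
        = flow h p * Polynomial.C (X i) + flow h p * Polynomial.C (h i) * Polynomial.X := by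
      simp [flow]; ring
    rw [hi]
    cases k with
    | zero =>
      have := hp 0
      simp [Polynomial.coeff_mul_X] at this ⊢
      rw [← this, hX]; ring
    | succ k =>
      have h1 := hp k
      have h2 := hp (k + 1)
      simp [Polynomial.coeff_mul_X, hX, hD] at h1 h2 ⊢
      rw [← h1, ← h2]; ring

theorem coeff_zero_flow (h : σ → MvPolynomial σ K) (f : MvPolynomial σ K) :
    (flow h f).coeff 0 = f := by
  induction f using MvPolynomial.induction_on with
  | C a =>
    have : flow h (C a) = Polynomial.C (C a) := by
      rw [← algebraMap_eq, AlgHom.commutes]; rfl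
    simp [this]
  | add p q hp hq => simp [hp, hq]
  | mul_X p i hp => rw [map_mul, Polynomial.mul_coeff_zero, hp]; simp [flow]

theorem flow_eq_C [CharZero K] (D : Derivation K (MvPolynomial σ K) (MvPolynomial σ K))
    (h : σ → MvPolynomial σ K) (hX : ∀ i, D (X i) = h i) (hD : ∀ i, D (h i) = 0)
    {f : MvPolynomial σ K} (hf : D f = 0) : flow h f = Polynomial.C f := by
  have key : ∀ k, (flow h f).coeff (k + 1) = 0 := by
    intro k
    have hk := coeff_succ_flow_mul D h hX hD f k
    have h0 : D ((flow h f).coeff k) = 0 := by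
      induction k with
      | zero => rwa [coeff_zero_flow]
      | succ k ih =>
        have hk' := coeff_succ_flow_mul D h hX hD f k
        rw [ih hk', mul_eq_zero] at hk'
        rw [hk'.resolve_right (by exact_mod_cast Nat.succ_ne_zero k), map_zero]
    rw [h0, mul_eq_zero] at hk
    exact hk.resolve_right (by exact_mod_cast Nat.succ_ne_zero k)
  ext1 k
  cases k with
  | zero => simp [coeff_zero_flow]
  | succ k => simp [key]

/-- A polynomial killed by `D` is constant along the lines with direction `h`. -/
theorem aeval_add_mul_eq_algebraMap [CharZero K] {L : Type*} [CommRing L]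
    [Algebra (MvPolynomial σ K) L] [Algebra K L] [IsScalarTower K (MvPolynomial σ K) L]
    (D : Derivation K (MvPolynomial σ K) (MvPolynomial σ K))
    (h : σ → MvPolynomial σ K) (hX : ∀ i, D (X i) = h i) (hD : ∀ i, D (h i) = 0)
    {f : MvPolynomial σ K} (hf : D f = 0) (t : L) :
    aeval (fun i => algebraMap (MvPolynomial σ K) L (X i) + algebraMap _ L (h i) * t) f
      = algebraMap (MvPolynomial σ K) L f := by
  have hcomp : aeval (fun i => algebraMap (MvPolynomial σ K) L (X i) + algebraMap _ L (h i) * t)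
      = ((Polynomial.aeval t).restrictScalars K).comp (flow h) := by
    ext i
    simp [flow]
  rw [hcomp, AlgHom.comp_apply, flow_eq_C D h hX hD hf]
  simp

/-- If the generators `s` become constants of `D` after multiplication by a nonzero constant `c`,
every polynomial expression in `s` that lies in the base ring is a constant of `D`. -/
theorem derivation_eq_zero_of_mem_adjoin {A L : Type*} [CommRing A] [IsDomain A] [Algebra K A]
    [CommRing L] [Algebra A L] [FaithfulSMul A L] [Algebra K L] [IsScalarTower K A L]
    (D : Derivation K A A) {c : A} (hc : c ≠ 0) (hDc : D c = 0) {S : Set L}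
    (hS : ∀ z ∈ S, ∃ a, D a = 0 ∧ z * algebraMap A L c = algebraMap A L a)
    {f : A} (hf : algebraMap A L f ∈ Algebra.adjoin K S) : D f = 0 := by
  have hpow : ∀ N, D (c ^ N) = 0 := fun N => by simp [Derivation.leibniz_pow, hDc]
  have key : ∀ z ∈ Algebra.adjoin K S, ∃ (N : ℕ) (a : A),
      D a = 0 ∧ z * algebraMap A L c ^ N = algebraMap A L a := by
    intro z hz
    induction hz using Algebra.adjoin_induction with
    | mem z hz =>
      obtain ⟨a, ha, hza⟩ := hS z hz
      exact ⟨1, a, ha, by rwa [pow_one]⟩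
    | algebraMap r =>
      exact ⟨0, algebraMap K A r, D.map_algebraMap r, by
        rw [pow_zero, mul_one, ← IsScalarTower.algebraMap_apply]⟩
    | add x y _ _ hx hy =>
      obtain ⟨N, a, ha, hxa⟩ := hx
      obtain ⟨M, b, hb, hyb⟩ := hy
      refine ⟨N + M, a * c ^ M + b * c ^ N, by simp [ha, hb, hpow], ?_⟩
      simp only [map_add, map_mul, map_pow, ← hxa, ← hyb]
      ring
    | mul x y _ _ hx hy =>
      obtain ⟨N, a, ha, hxa⟩ := hx
      obtain ⟨M, b, hb, hyb⟩ := hy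
      refine ⟨N + M, a * b, by simp [ha, hb], ?_⟩
      simp only [map_mul, ← hxa, ← hyb]
      ring
  obtain ⟨N, a, ha, hfa⟩ := key _ hf
  rw [← map_pow, ← map_mul] at hfa
  have hfa' := FaithfulSMul.algebraMap_injective A L hfa
  have hDf : c ^ N * D f = 0 := by
    have := congrArg D hfa'
    simpa [ha, hpow] using this
  exact (mul_eq_zero.mp hDf).resolve_left (pow_ne_zero N hc)

end Flow

/-- Let `h = (h₁,…,hₙ)` be a self-vanishing system of forms with `hₙ ≠ 0`, and in the
fraction field set `sᵢ = xᵢ − (hᵢ/hₙ)·xₙ`.  Then every solution `f` of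
`∑ⱼ hⱼ ∂f/∂xⱼ = 0` satisfies `f = f(s₁,…,s_{n−1},0)`, and the set of solutions is
exactly `K[s₁,…,s_{n−1}] ∩ K[x₁,…,xₙ]`, the intersection being taken in `K(x₁,…,xₙ)`. -/
theorem svs_solutions_eq_subring_of_fraction_field
    {K : Type*} [Field K] [IsAlgClosed K] [CharZero K] {n : ℕ}
    (h : Fin (n + 1) → MvPolynomial (Fin (n + 1)) K) (e : ℕ)
    (hh : ∀ j, (h j).IsHomogeneous e)
    (hsv : ∀ j, ∑ i, h i * pderiv i (h j) = 0)
    (hlast : h (Fin.last n) ≠ 0)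
    (s : Fin n → FractionRing (MvPolynomial (Fin (n + 1)) K))
    (hs : ∀ i : Fin n, s i =
      algebraMap (MvPolynomial (Fin (n + 1)) K) (FractionRing (MvPolynomial (Fin (n + 1)) K))
          (X i.castSucc) -
        algebraMap (MvPolynomial (Fin (n + 1)) K) (FractionRing (MvPolynomial (Fin (n + 1)) K))
            (h i.castSucc) /
          algebraMap (MvPolynomial (Fin (n + 1)) K) (FractionRing (MvPolynomial (Fin (n + 1)) K))
            (h (Fin.last n)) *
        algebraMap (MvPolynomial (Fin (n + 1)) K) (FractionRing (MvPolynomial (Fin (n + 1)) K))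
          (X (Fin.last n))) :
    (∀ f : MvPolynomial (Fin (n + 1)) K, (∑ j, h j * pderiv j f = 0) →
      algebraMap (MvPolynomial (Fin (n + 1)) K) (FractionRing (MvPolynomial (Fin (n + 1)) K)) f
        = aeval (fun i : Fin (n + 1) =>
            Fin.lastCases (0 : FractionRing (MvPolynomial (Fin (n + 1)) K)) s i) f) ∧
    ((fun f : MvPolynomial (Fin (n + 1)) K =>
        algebraMap (MvPolynomial (Fin (n + 1)) K) (FractionRing (MvPolynomial (Fin (n + 1)) K)) f)
          '' {f | ∑ j, h j * pderiv j f = 0}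
      = ↑(Algebra.adjoin K (Set.range s)) ∩
        Set.range (algebraMap (MvPolynomial (Fin (n + 1)) K)
          (FractionRing (MvPolynomial (Fin (n + 1)) K)))) := by
  let D := mkDerivation K h
  have hDsum : ∀ f, ∑ j, h j * pderiv j f = D f := fun f =>
    (mkDerivation_eq_sum_mul_pderiv h f).symm
  simp only [hDsum] at hsv ⊢
  have hX : ∀ i, D (X i) = h i := mkDerivation_X K h
  have hL : algebraMap (MvPolynomial (Fin (n + 1)) K)
      (FractionRing (MvPolynomial (Fin (n + 1)) K)) (h (Fin.last n)) ≠ 0 := by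
    simpa using hlast
  have subst_eq : ∀ f : MvPolynomial (Fin (n + 1)) K, D f = 0 →
      algebraMap _ (FractionRing (MvPolynomial (Fin (n + 1)) K)) f
        = aeval (fun i : Fin (n + 1) => Fin.lastCases
            (0 : FractionRing (MvPolynomial (Fin (n + 1)) K)) s i) f := by
    intro f hf
    rw [← aeval_add_mul_eq_algebraMap D h hX hsv hf
      (-(algebraMap (MvPolynomial (Fin (n + 1)) K) _ (X (Fin.last n)) /
        algebraMap _ _ (h (Fin.last n))))]
    congr 2
    funext i
    cases i using Fin.lastCases with
    | last => rw [Fin.lastCases_last, mul_neg, mul_div_cancel₀ _ hL, add_neg_cancel]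
    | cast i => simp only [Fin.lastCases_castSucc, hs]; field_simp; ring
  refine ⟨subst_eq, Set.Subset.antisymm ?_ ?_⟩
  · rintro _ ⟨f, hf, rfl⟩
    refine ⟨?_, f, rfl⟩
    beta_reduce
    rw [subst_eq f hf, SetLike.mem_coe, aeval_def]
    refine eval₂_mem (fun _ _ => Subalgebra.algebraMap_mem _ _) fun i => ?_
    cases i using Fin.lastCases with
    | last => simp
    | cast i => simpa using Algebra.subset_adjoin (Set.mem_range_self i)
  · rintro _ ⟨hf, f, rfl⟩
    refine ⟨f, derivation_eq_zero_of_mem_adjoin D hlast (hsv _) ?_ hf, rfl⟩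
    rintro _ ⟨i, rfl⟩
    refine ⟨X i.castSucc * h (Fin.last n) - h i.castSucc * X (Fin.last n), ?_, ?_⟩
    · simp [hX, hsv]; ring
    · rw [hs]; simp only [map_sub, map_mul]; field_simp
end

section
/- Let h = (h₁,…,hₙ) be a self-vanishing system of forms in K[x₁,…,xₙ] and let f ∈ K[x₁,…,xₙ] be homogeneous of positive degree with Σⱼ hⱼ·(∂f/∂xⱼ) = 0. Then f(h₁,…,hₙ) = 0, i.e., substituting xⱼ ↦ hⱼ into f gives the zero polynomial. In particular, if the common degree of the hⱼ is positive, then hⱼ(h₁,…,hₙ) = 0 for every j. -/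
open MvPolynomial

theorem Derivation.iterate_succ_mul_of_apply_apply_eq_zero {R A : Type*} [CommRing R] [CommRing A]
    [Algebra R A] (D : Derivation R A A) {a : A} (ha : D (D a) = 0) (b : A) (k : ℕ) :
    D^[k + 1] (a * b) = a * D^[k + 1] b + (k + 1) * (D a * D^[k] b) := by
  induction k with
  | zero =>
    simp only [zero_add, Function.iterate_one, Derivation.leibniz, smul_eq_mul, Nat.cast_zero,
      Function.iterate_zero, id_eq]
    ring
  | succ k ih =>
    have hk : D ((k : A) + 1) = 0 := by simp
    rw [Function.iterate_succ_apply', ih, map_add, Derivation.leibniz, Derivation.leibniz,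
      Derivation.leibniz, ha, hk, ← Function.iterate_succ_apply' D, ← Function.iterate_succ_apply' D]
    simp only [smul_eq_mul]
    push_cast
    ring

theorem Derivation.apply_mvPolynomial_aeval_eq_zero {R A σ : Type*} [CommRing R] [CommRing A]
    [Algebra R A] (D : Derivation R A A) {x : σ → A} (hx : ∀ i, D (x i) = 0)
    (p : MvPolynomial σ R) : D (aeval x p) = 0 := by
  induction p using MvPolynomial.induction_on with
  | C a => simp
  | add p q hp hq => simp [hp, hq]
  | mul_X p i hp => simp [hp, hx]

/-- If `D` kills each `D (X i)`, then on forms of degree `d` the operator `D ^ d` is `d !` times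
the substitution `X i ↦ D (X i)`. -/
theorem MvPolynomial.IsHomogeneous.iterate_derivation {K σ : Type*} [Field K] [CharZero K]
    [Fintype σ] (D : Derivation K (MvPolynomial σ K) (MvPolynomial σ K))
    (hD : ∀ i, D (D (X i)) = 0) {d : ℕ} {f : MvPolynomial σ K} (hf : f.IsHomogeneous d) :
    D^[d] f = d.factorial * MvPolynomial.aeval (fun i ↦ D (X i)) f := by
  induction d generalizing f with
  | zero =>
    rw [← totalDegree_zero_iff_isHomogeneous, totalDegree_eq_zero_iff_eq_C] at hf
    rw [hf]
    simp
  | succ d ih =>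
    have hkill (i : σ) : D^[d + 1] (pderiv i f) = 0 := by
      have hfact : D (d.factorial : MvPolynomial σ K) = 0 := D.map_natCast _
      rw [Function.iterate_succ_apply', ih (hf.pderiv (i := i)), Derivation.leibniz, hfact,
        D.apply_mvPolynomial_aeval_eq_zero hD, smul_zero, smul_zero, add_zero]
    have heuler := hf.sum_X_mul_pderiv
    have hsum := congrArg (MvPolynomial.aeval fun i ↦ D (X i)) heuler
    have hiter := congrArg (D.toLinearMap ^ (d + 1) : Module.End K _) heuler
    rw [map_sum, map_nsmul] at hsum hiter
    simp only [map_mul, aeval_X] at hsum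
    simp only [Module.End.pow_apply, Derivation.coeFn_coe,
      D.iterate_succ_mul_of_apply_apply_eq_zero (hD _), hkill, ih hf.pderiv] at hiter
    have hd : ((d + 1 : ℕ) : MvPolynomial σ K) ≠ 0 := Nat.cast_ne_zero.mpr d.succ_ne_zero
    refine mul_left_cancel₀ hd ?_
    rw [nsmul_eq_mul] at hsum hiter
    rw [← hiter, mul_left_comm, ← hsum, Finset.mul_sum, Nat.factorial_succ]
    refine Finset.sum_congr rfl fun i _ ↦ ?_
    push_cast
    ring

theorem MvPolynomial.mkDerivation_apply_eq_sum_mul_pderiv {R σ : Type*} [CommRing R] [Fintype σ]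
    (h : σ → MvPolynomial σ R) (f : MvPolynomial σ R) :
    mkDerivation R h f = ∑ i, h i * pderiv i f := by
  classical
  induction f using MvPolynomial.induction_on with
  | C a => simp
  | add p q hp hq => simp [hp, hq, mul_add, Finset.sum_add_distrib]
  | mul_X p i hp =>
    simp [hp, pderiv_X, mul_add, Finset.sum_add_distrib, Finset.mul_sum, Pi.single_apply,
      mul_comm, mul_left_comm]

theorem MvPolynomial.IsHomogeneous.aeval_eq_zero_of_derivation_eq_zero {K σ : Type*} [Field K]
    [CharZero K] [Fintype σ] (D : Derivation K (MvPolynomial σ K) (MvPolynomial σ K))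
    (hD : ∀ i, D (D (X i)) = 0) {d : ℕ} (hd : 0 < d) {f : MvPolynomial σ K}
    (hf : f.IsHomogeneous d) (hDf : D f = 0) : MvPolynomial.aeval (fun i ↦ D (X i)) f = 0 := by
  have hiter := hf.iterate_derivation D hD
  obtain ⟨k, rfl⟩ := Nat.exists_eq_succ_of_ne_zero hd.ne'
  rw [Function.iterate_succ_apply, hDf, iterate_map_zero] at hiter
  exact (mul_eq_zero.mp hiter.symm).resolve_left (Nat.cast_ne_zero.mpr (Nat.factorial_ne_zero _))

/-- If `h` is a self-vanishing system of forms and `f` is homogeneous of positive degree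
with `∑ⱼ hⱼ ∂f/∂xⱼ = 0`, then `f(h₁,…,hₙ) = 0`; in particular, if the common degree of
the `hⱼ` is positive, then `hⱼ(h₁,…,hₙ) = 0` for every `j`. -/
theorem svs_substituted_into_solution
    {K : Type*} [Field K] [IsAlgClosed K] [CharZero K] {n : ℕ}
    (h : Fin n → MvPolynomial (Fin n) K) (e : ℕ)
    (hh : ∀ j, (h j).IsHomogeneous e)
    (hsv : ∀ j, ∑ i, h i * pderiv i (h j) = 0)
    (f : MvPolynomial (Fin n) K) (d : ℕ) (hd : 0 < d) (hf : f.IsHomogeneous d)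
    (hsol : ∑ j, h j * pderiv j f = 0) :
    aeval h f = 0 ∧ (0 < e → ∀ j, aeval h (h j) = 0) := by
  have hX : (fun i ↦ mkDerivation K h (X i)) = h := funext (mkDerivation_X K h)
  have key {g : MvPolynomial (Fin n) K} {m : ℕ} (hm : 0 < m) (hg : g.IsHomogeneous m)
      (hDg : ∑ j, h j * pderiv j g = 0) : aeval h g = 0 := by
    rw [← hX]
    refine hg.aeval_eq_zero_of_derivation_eq_zero _ (fun i ↦ ?_) hm ?_
    · rw [mkDerivation_X, mkDerivation_apply_eq_sum_mul_pderiv, hsv]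
    · rw [mkDerivation_apply_eq_sum_mul_pderiv, hDg]
  exact ⟨key hd hf hsol, fun he j ↦ key he (hh j) (hsv j)⟩
end

section
/- Let h = (h₁,…,hₙ) be a self-vanishing system of forms in K[x₁,…,xₙ]. Then for every polynomial f ∈ K[x₁,…,xₙ] and every i ≥ 0, Σⱼ hⱼ·∂(f⁽ⁱ⁾(x,h))/∂xⱼ = (i+1)·f⁽ⁱ⁺¹⁾(x,h). -/
open MvPolynomial

/-- Substituting a self-vanishing system `h` for the `y`-variables turns the polarization operator
into the derivation `∑ⱼ hⱼ ∂/∂xⱼ`. -/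
theorem sum_mul_pderiv_aeval_eq_aeval_polarize {K : Type*} [CommSemiring K] {n : ℕ}
    (h : Fin n → MvPolynomial (Fin n) K)
    (hsv : ∀ j, ∑ i, h i * pderiv i (h j) = 0) (p : MvPolynomial (Fin n ⊕ Fin n) K) :
    ∑ j, h j * pderiv j (aeval (Sum.elim X h) p) = aeval (Sum.elim X h) (polarize p) := by
  induction p using MvPolynomial.induction_on with
  | C a => simp [polarize, ← algebraMap_eq]
  | add p q hp hq =>
    simp only [polarize, map_add, mul_add, Finset.sum_add_distrib] at hp hq ⊢
    rw [hp, hq]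
  | mul_X p v hp =>
    have hv : ∑ j, h j * pderiv j (Sum.elim X h v) =
        aeval (Sum.elim X h) (polarize (X v : MvPolynomial (Fin n ⊕ Fin n) K)) := by
      rcases v with v | v
      · simp [polarize, pderiv_X, Pi.single_apply]
      · simp [polarize, pderiv_X, hsv]
    have leibniz : ∀ a b : MvPolynomial (Fin n) K, ∑ j, h j * pderiv j (a * b) =
        a * ∑ j, h j * pderiv j b + b * ∑ j, h j * pderiv j a := fun a b ↦ by
      simp only [Derivation.leibniz, smul_eq_mul, Finset.mul_sum, ← Finset.sum_add_distrib]
      exact Finset.sum_congr rfl fun j _ ↦ by ring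
    have polarize_leibniz : polarize (p * X v) = p * polarize (X v) + X v * polarize p := by
      simp only [polarize, Derivation.leibniz, smul_eq_mul, Finset.mul_sum,
        ← Finset.sum_add_distrib]
      exact Finset.sum_congr rfl fun j _ ↦ by ring
    rw [polarize_leibniz, map_mul, leibniz, hp, aeval_X, hv]
    simp

/-- For a self-vanishing system `h` one has
`𝒟ₓ(h) (f⁽ⁱ⁾(x,h)) = (i+1) · f⁽ⁱ⁺¹⁾(x,h)` for every polynomial `f` and every `i ≥ 0`. -/
theorem svs_behaves_as_variables
    {K : Type*} [Field K] [IsAlgClosed K] [CharZero K] {n : ℕ}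
    (h : Fin n → MvPolynomial (Fin n) K) (e : ℕ)
    (hh : ∀ j, (h j).IsHomogeneous e)
    (hsv : ∀ j, ∑ i, h i * pderiv i (h j) = 0)
    (f : MvPolynomial (Fin n) K) (i : ℕ) :
    ∑ j, h j * pderiv j (aeval (Sum.elim X h) (polarPow f i)) =
      (i + 1) • aeval (Sum.elim X h) (polarPow f (i + 1)) := by
  simp only [polarPow, map_smul, Derivation.map_smul, mul_smul_comm, ← Finset.smul_sum]
  rw [sum_mul_pderiv_aeval_eq_aeval_polarize h hsv, ← Function.iterate_succ_apply' polarize,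
    ← Nat.cast_smul_eq_nsmul K, smul_smul]
  congr 1
  have hi : ((i : K) + 1) ≠ 0 := Nat.cast_add_one_ne_zero i
  have hf : (i.factorial : K) ≠ 0 := Nat.cast_ne_zero.mpr i.factorial_ne_zero
  push_cast [Nat.factorial_succ]
  field_simp
end
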